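/- Let k be a differential field of characteristic zero whose field of constants C is algebraically closed, and let k ⊂ K ⊆ E be differential fields such that E is an iterated Picard–Vessiot extension of k, i.e., there is a tower of differential fields k = E₀ ⊆ E₁ ⊆ ⋯ ⊆ Eₙ = E in which each Eᵢ is a Picard–Vessiot extension of Eᵢ₋₁ for some monic linear differential operator over Eᵢ₋₁. Then K can be resolved into a tower of differential fields k = K₀ ⊂ K₁ ⊂ ⋯ ⊂ K_m = K such that for every i = 1,…,m there exist a Picard–Vessiot extension F of Kᵢ₋₁ (for some monic linear differential operator over Kᵢ₋₁) and a differential field embedding of Kᵢ into F fixing Kᵢ₋₁ pointwise. -/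

import Mathlib

universe u

/-- A bundled differential field of characteristic zero: a field together with a derivation,
given as a raw function satisfying additivity and the Leibniz rule. -/
structure DFld : Type (u + 1) where
  carrier : Type u
  [fieldInst : Field carrier]
  [charZeroInst : CharZero carrier]
  deriv : carrier → carrier
  deriv_add : ∀ a b, deriv (a + b) = deriv a + deriv b
  deriv_mul : ∀ a b, deriv (a * b) = deriv a * b + a * deriv b

attribute [instance] DFld.fieldInst DFld.charZeroInst

/-- The result of applying the monic linear differential operator
`∂^n + a_{n-1} ∂^{n-1} + ⋯ + a_1 ∂ + a_0` (with coefficients `a`) to `y`,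
where the derivation is given by `D`. -/
def LApply {E : Type u} [Field E] (D : E → E) (n : ℕ) (a : Fin n → E) (y : E) : E :=
  D^[n] y + ∑ i : Fin n, a i * D^[(i : ℕ)] y

/-- `diffGen D k S` is the smallest differential subfield (w.r.t. the derivation `D`)
containing the subfield `k` and the set `S`; i.e. the differential field `k⟨S⟩`. -/
def diffGen {E : Type u} [Field E] (D : E → E) (k : Subfield E) (S : Set E) : Subfield E :=
  sInf {F : Subfield E | k ≤ F ∧ S ⊆ ↑F ∧ ∀ x ∈ F, D x ∈ F}

/-- The subfield of constants of a differential subfield `k`: `{x ∈ k | D x = 0}`. -/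
def constantsOf {E : Type u} [Field E] (D : Derivation ℤ E E) (k : Subfield E) : Subfield E where
  carrier := {x | x ∈ k ∧ D x = 0}
  zero_mem' := ⟨k.zero_mem, map_zero D⟩
  one_mem' := ⟨k.one_mem, D.map_one_eq_zero⟩
  add_mem' := by
    rintro a b ⟨hak, ha0⟩ ⟨hbk, hb0⟩
    exact ⟨k.add_mem hak hbk, by rw [map_add, ha0, hb0, add_zero]⟩
  neg_mem' := by
    rintro a ⟨hak, ha0⟩
    exact ⟨k.neg_mem hak, by rw [map_neg, ha0, neg_zero]⟩
  mul_mem' := by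
    rintro a b ⟨hak, ha0⟩ ⟨hbk, hb0⟩
    exact ⟨k.mul_mem hak hbk, by
      rw [Derivation.leibniz, ha0, hb0, smul_zero, smul_zero, add_zero]⟩
  inv_mem' := by
    rintro x ⟨hxk, hx0⟩
    refine ⟨k.inv_mem hxk, ?_⟩
    by_cases h : x = 0
    · simp [h]
    · have h1 : D (x * x⁻¹) = 0 := by rw [mul_inv_cancel₀ h, D.map_one_eq_zero]
      rw [Derivation.leibniz, hx0, smul_zero, add_zero, smul_eq_mul] at h1
      exact (mul_eq_zero.mp h1).resolve_left h

/-- `F` is a Picard–Vessiot extension of `k` (inside a common differential field) for the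
monic linear differential operator of order `n` with (lower-order) coefficients `a`:
both are differential subfields, the constants of `F` equal the constants of `k`,
the coefficients lie in `k`, and `F` is differentially generated over `k` by an
`n`-dimensional vector space (over the constants) of solutions. -/
def IsPVWith {E : Type u} [Field E] (D : E → E) (k F : Subfield E) (n : ℕ)
    (a : Fin n → E) : Prop :=
  k ≤ F ∧ (∀ x ∈ k, D x ∈ k) ∧ (∀ x ∈ F, D x ∈ F) ∧
  (∀ x ∈ F, D x = 0 → x ∈ k) ∧
  (∀ i, a i ∈ k) ∧
  ∃ y : Fin n → E,
    (∀ i, y i ∈ F) ∧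
    (∀ i, LApply D n a (y i) = 0) ∧
    (∀ c : Fin n → E, (∀ i, c i ∈ k ∧ D (c i) = 0) → (∑ i, c i * y i) = 0 → ∀ i, c i = 0) ∧
    diffGen D k (Set.range y) = F

/-- `F` is a Picard–Vessiot extension of `k` for some monic linear differential operator. -/
def IsPV {E : Type u} [Field E] (D : E → E) (k F : Subfield E) : Prop :=
  ∃ (n : ℕ) (a : Fin n → E), IsPVWith D k F n a

/-- Relative version: the differential subfield `F` is a Picard–Vessiot extension
of the differential subfield `kb ≤ F`. -/
def IsPVRel {E : Type u} [Field E] (D : E → E) (kb F : Subfield E)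
    (hF : ∀ x ∈ F, D x ∈ F) : Prop :=
  IsPV (fun x : ↥F => (⟨D ↑x, hF ↑x x.2⟩ : ↥F)) (Subfield.comap F.subtype kb) ⊤

/-- The ambient differential field (with derivation `D`) is a strongly normal extension of
its differential subfield `k`: it is finitely generated as a field extension of `k`, has no
new constants, and every differential embedding over `k` into a differential field extension
`M` lands in the compositum of the image of the base copy with the constants of `M`. -/
def IsSN {E : Type u} [Field E] (D : E → E) (k : Subfield E) : Prop :=
  (∀ x ∈ k, D x ∈ k) ∧
  (∃ s : Finset E, Subfield.closure (↑k ∪ ↑s) = (⊤ : Subfield E)) ∧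
  (∀ x : E, D x = 0 → x ∈ k) ∧
  ∀ (M : DFld.{u}) (ι σ : E →+* M.carrier),
    (∀ x, ι (D x) = M.deriv (ι x)) →
    (∀ x, σ (D x) = M.deriv (σ x)) →
    (∀ x ∈ k, σ x = ι x) →
    ∀ e : E, σ e ∈ Subfield.closure (Set.range ι ∪ {m : M.carrier | M.deriv m = 0})

/-- Relative version: the differential subfield `F` is a strongly normal extension of the
differential subfield `kb ≤ F`. -/
def IsSNRel {E : Type u} [Field E] (D : E → E) (kb F : Subfield E)
    (hF : ∀ x ∈ F, D x ∈ F) : Prop :=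
  IsSN (fun x : ↥F => (⟨D ↑x, hF ↑x x.2⟩ : ↥F)) (Subfield.comap F.subtype kb)

/-- `K` is a finite field extension of the subfield `M`. -/
def FinExt {E : Type u} [Field E] (M K : Subfield E) : Prop :=
  ∃ h : M ≤ K,
    letI : Algebra ↥M ↥K := (Subfield.inclusion h).toAlgebra
    Module.Finite ↥M ↥K

/-- The transcendence degree of the subfield `K` over the subfield `k`, as the supremum of the
cardinalities of subsets of `K` that are algebraically independent over `k`. -/
noncomputable def trdegOf {E : Type u} [Field E] (k K : Subfield E) : Cardinal.{u} :=
  ⨆ s : {s : Set E // s ⊆ (K : Set E) ∧ AlgebraicIndependent ↥k (fun x : ↥s => (x : E))},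
    Cardinal.mk ↥(s.1)

/-- `K` and `M` are free over `k`: every finite subset of `K` that is algebraically
independent over `k` remains algebraically independent over `M`. -/
def FreeOver {E : Type u} [Field E] (k K M : Subfield E) : Prop :=
  ∀ s : Finset E, (↑s : Set E) ⊆ (K : Set E) →
    AlgebraicIndependent ↥k (fun x : ↥(↑s : Set E) => (x : E)) →
    AlgebraicIndependent ↥M (fun x : ↥(↑s : Set E) => (x : E))

/-- `K` is a `k`-irreducible differential field: it is a finitely generated differential field
extension of `k` of transcendence degree at least 1, and every intermediate differential field
`k ⊂ M ⊆ K` has transcendence degree `0` or `trdeg(K|k)` over `k`. -/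
def IsIrred {E : Type u} [Field E] (D : E → E) (k K : Subfield E) : Prop :=
  (∃ s : Finset E, diffGen D k ↑s = K) ∧
  1 ≤ trdegOf k K ∧
  ∀ M : Subfield E, (∀ x ∈ M, D x ∈ M) → k < M → M ≤ K →
    trdegOf k M = 0 ∨ trdegOf k M = trdegOf k K

/-- `Kf` is a `d`-solvable extension of `k`: there is a tower of differential fields starting
at (a copy of) `k`, each step being a finite algebraic extension or a Picard–Vessiot extension
for an operator of order at most `d`, whose top contains (the copy of) `Kf`. -/
def IsDSolvable {E : Type u} [Field E] (D : E → E) (k Kf : Subfield E) (d : ℕ) : Prop :=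
  ∃ (Ω : DFld.{u}) (j : E →+* Ω.carrier),
    (∀ x, j (D x) = Ω.deriv (j x)) ∧
    ∃ (r : ℕ) (T : Fin (r + 1) → Subfield Ω.carrier),
      T 0 = Subfield.map j k ∧
      Subfield.map j Kf ≤ T (Fin.last r) ∧
      (∀ i, ∀ x ∈ T i, Ω.deriv x ∈ T i) ∧
      ∀ i : Fin r,
        FinExt (T i.castSucc) (T i.succ) ∨
        ∃ n ≤ d, ∃ a : Fin n → Ω.carrier, IsPVWith Ω.deriv (T i.castSucc) (T i.succ) n a

/-- `Kn` is generated over `kb`, as a differential field with the same constants, by one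
solution `z` of an inhomogeneous equation `L(y) = b` (with `L` monic over `kb` of order
`n ≤ d` and `b ∈ kb`) together with an `n`-dimensional space (over the constants) of
solutions of `L(y) = 0`. -/
def IsPVInhomLe {E : Type u} [Field E] (D : E → E) (kb Kn : Subfield E) (d : ℕ) : Prop :=
  kb ≤ Kn ∧ (∀ x ∈ kb, D x ∈ kb) ∧ (∀ x ∈ Kn, D x ∈ Kn) ∧
  (∀ x ∈ Kn, D x = 0 → x ∈ kb) ∧
  ∃ n, n ≤ d ∧ ∃ (a : Fin n → E) (b z : E) (y : Fin n → E),
    (∀ i, a i ∈ kb) ∧ b ∈ kb ∧ z ∈ Kn ∧ (∀ i, y i ∈ Kn) ∧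
    LApply D n a z = b ∧
    (∀ i, LApply D n a (y i) = 0) ∧
    (∀ c : Fin n → E, (∀ i, c i ∈ kb ∧ D (c i) = 0) → (∑ i, c i * y i) = 0 → ∀ i, c i = 0) ∧
    diffGen D kb (insert z (Set.range y)) = Kn

/-- `Kf` is a `d⁺`-solvable extension of `k`. -/
def IsDPlusSolvable {E : Type u} [Field E] (D : E → E) (k Kf : Subfield E) (d : ℕ) : Prop :=
  ∃ (Ω : DFld.{u}) (j : E →+* Ω.carrier),
    (∀ x, j (D x) = Ω.deriv (j x)) ∧
    ∃ (r : ℕ) (T : Fin (r + 1) → Subfield Ω.carrier),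
      T 0 = Subfield.map j k ∧
      Subfield.map j Kf ≤ T (Fin.last r) ∧
      (∀ i, ∀ x ∈ T i, Ω.deriv x ∈ T i) ∧
      ∀ i : Fin r,
        FinExt (T i.castSucc) (T i.succ) ∨ IsPVInhomLe Ω.deriv (T i.castSucc) (T i.succ) d

/-- `TSet D kb K` is the set of elements of `K` annihilated by some monic linear differential
operator with coefficients in `kb`. -/
def TSet {E : Type u} [Field E] (D : E → E) (kb K : Subfield E) : Set E :=
  {x | x ∈ K ∧ ∃ (n : ℕ) (a : Fin n → E), (∀ i, a i ∈ kb) ∧ LApply D n a x = 0}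


set_option linter.all false



namespace PVR

theorem lift_aux {R P B : Type*} [CommRing R] [CommRing P] [Algebra R P]
    [Algebra.FormallySmooth R P] [CommRing B] (φ : R →+* B) (π : B →+* P)
    (hs : Function.Surjective π) (hk : RingHom.ker π ^ 2 = ⊥)
    (hφ : ∀ r, π (φ r) = algebraMap R P r) :
    ∃ f : P →+* B, (∀ r, f (algebraMap R P r) = φ r) ∧ ∀ p, π (f p) = p := by
  letI : Algebra R B := φ.toAlgebra
  let g : B →ₐ[R] P := { π with commutes' := hφ }
  have hgs : Function.Surjective g := hs
  have hn : IsNilpotent (RingHom.ker (g : B →+* P)) := ⟨2, hk⟩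
  let f := Algebra.FormallySmooth.liftOfSurjective (AlgHom.id R P) g hgs hn
  refine ⟨f, fun r => f.commutes r, fun p => ?_⟩
  exact Algebra.FormallySmooth.liftOfSurjective_apply (AlgHom.id R P) g hgs hn p

/-- Derivation from an additive map satisfying the Leibniz rule. -/
def mkDer {P : Type*} [CommRing P] (f : P →+ P) (h : ∀ a b, f (a * b) = a * f b + b * f a) :
    Derivation ℤ P P :=
  Derivation.mk' f.toIntLinearMap (fun a b => by simpa using h a b)

@[simp] theorem mkDer_apply {P : Type*} [CommRing P] (f : P →+ P) (h) (a : P) :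
    mkDer f h a = f a := rfl

theorem der_ext {R P : Type*} [CommRing R] [CommRing P] [Algebra R P]
    [Algebra.FormallySmooth R P] (d : Derivation ℤ R P) :
    ∃ d' : Derivation ℤ P P, ∀ x, d' (algebraMap R P x) = d x := by
  let φ : R →+* TrivSqZeroExt P P :=
    { toFun := fun r => TrivSqZeroExt.inl (algebraMap R P r) + TrivSqZeroExt.inr (d r)
      map_one' := by simp
      map_zero' := by simp
      map_add' := fun a b => by
        ext <;> simp
      map_mul' := fun a b => by
        refine TrivSqZeroExt.ext ?_ ?_
        · simp [TrivSqZeroExt.fst_add, TrivSqZeroExt.fst_mul]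
        · simp only [map_mul, Derivation.leibniz, TrivSqZeroExt.snd_mul, TrivSqZeroExt.snd_add,
            TrivSqZeroExt.fst_add, TrivSqZeroExt.fst_inl, TrivSqZeroExt.snd_inl,
            TrivSqZeroExt.fst_inr, TrivSqZeroExt.snd_inr, MulOpposite.smul_eq_mul_unop,
            MulOpposite.unop_op, MulOpposite.op_add, smul_eq_mul, Algebra.smul_def, zero_add,
            add_zero]
          ring }
  obtain ⟨f, h1, h2⟩ := lift_aux φ (TrivSqZeroExt.fstHom ℤ P P).toRingHom
    (fun p => ⟨TrivSqZeroExt.inl p, by simp⟩)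
    (by
      rw [pow_two, eq_bot_iff, Ideal.mul_le]
      intro a ha b hb
      have ha' : a.fst = 0 := ha
      have hb' : b.fst = 0 := hb
      rw [Ideal.mem_bot]
      ext <;> simp [ha', hb'])
    (fun r => by simp [φ])
  have h2' : ∀ p, (f p).fst = p := h2
  refine ⟨mkDer (AddMonoidHom.mk' (fun p => (f p).snd) (fun a b => by simp)) (fun a b => ?_),
    fun x => ?_⟩
  · simp [h2']; ring
  · simp [h1, φ]

theorem formallySmooth_field (F P : Type*) [Field F] [Field P] [Algebra F P] [CharZero F] :
    Algebra.FormallySmooth F P := by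
  obtain ⟨s, hs⟩ := exists_isTranscendenceBasis' F P
  have : Algebra.IsAlgebraic (IntermediateField.adjoin F (Set.range hs.choose)) P :=
    hs.choose_spec.isAlgebraic_field
  exact Algebra.FormallySmooth.of_algebraicIndependent_of_isSeparable hs.choose_spec.1

theorem der_ext_field {F P : Type*} [Field F] [Field P] [Algebra F P] [CharZero F]
    (d : Derivation ℤ F P) :
    ∃ d' : Derivation ℤ P P, ∀ x, d' (algebraMap F P x) = d x :=
  haveI := formallySmooth_field F P
  der_ext d

theorem der_ext_frac {R P : Type*} [CommRing R] [IsDomain R] [Field P] [Algebra R P]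
    [IsFractionRing R P] (d : Derivation ℤ R P) :
    ∃ d' : Derivation ℤ P P, ∀ x, d' (algebraMap R P x) = d x :=
  haveI : Algebra.FormallyEtale R P := Algebra.FormallyEtale.of_isLocalization (nonZeroDivisors R)
  der_ext d

theorem der_ext_add {R S : Type*} [CommRing R] [CommRing S] [Algebra R S]
    [Algebra.FormallySmooth R S] (d : Derivation ℤ R R) :
    ∃ d' : S →+ S, (∀ a b, d' (a * b) = a * d' b + b * d' a) ∧
      (∀ x, d' (algebraMap R S x) = algebraMap R S (d x)) := by
  obtain ⟨d2, h2⟩ := der_ext (R := R) (P := S)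
    (Derivation.mk' ((algebraMap R S).toAddMonoidHom.toIntLinearMap ∘ₗ d.toLinearMap) (fun a b => by
      simp [Algebra.smul_def]))
  exact ⟨d2.toLinearMap.toAddMonoidHom, fun a b => by simp, h2⟩

theorem der_ext_mv {R : Type*} [CommRing R] {σ : Type*} (d : Derivation ℤ R R)
    (v : σ → MvPolynomial σ R) :
    ∃ d' : MvPolynomial σ R →+ MvPolynomial σ R,
      (∀ a b, d' (a * b) = a * d' b + b * d' a) ∧
      (∀ x, d' (MvPolynomial.C x) = MvPolynomial.C (d x)) ∧
      ∀ i, d' (MvPolynomial.X i) = v i := by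
  obtain ⟨d2, h1, h2⟩ := der_ext_add (S := MvPolynomial σ R) d
  refine ⟨d2 + (MvPolynomial.mkDerivation R
    (fun i => v i - d2 (MvPolynomial.X i))).toLinearMap.toAddMonoidHom, ?_, fun x => ?_, fun i => ?_⟩
  · intro a b
    simp [h1]; ring
  · have := h2 x
    rw [MvPolynomial.algebraMap_eq] at this
    simp [this]
  · simp [MvPolynomial.mkDerivation_X]

/-- quotient derivation -/
theorem der_quot {R : Type*} [CommRing R] (d : Derivation ℤ R R) (I : Ideal R)
    (hI : ∀ x ∈ I, d x ∈ I) : ∃ d' : Derivation ℤ (R ⧸ I) (R ⧸ I),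
    ∀ x, d' (Ideal.Quotient.mk I x) = Ideal.Quotient.mk I (d x) := by
  let f : R ⧸ I →+ R ⧸ I := QuotientAddGroup.lift I.toAddSubgroup
    (((Ideal.Quotient.mk I).toAddMonoidHom).comp d.toLinearMap.toAddMonoidHom) (fun x hx => by
      simpa [Ideal.Quotient.eq_zero_iff_mem] using hI x hx)
  have hf : ∀ x, f (Ideal.Quotient.mk I x) = Ideal.Quotient.mk I (d x) := fun x => rfl
  refine ⟨mkDer f ?_, hf⟩
  intro a b
  obtain ⟨a, rfl⟩ := Ideal.Quotient.mk_surjective a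
  obtain ⟨b, rfl⟩ := Ideal.Quotient.mk_surjective b
  rw [← map_mul, hf, hf, hf]
  simp

/-- restriction of a derivation to a stable subfield -/
def restr {P : Type*} [Field P] (d : Derivation ℤ P P) (F : Subfield P)
    (h : ∀ x ∈ F, d x ∈ F) : Derivation ℤ F F :=
  mkDer (AddMonoidHom.mk' (fun x => ⟨d x, h x x.2⟩) (fun a b => by ext; simp))
    (fun a b => by ext; simp)

@[simp] theorem restr_coe {P : Type*} [Field P] (d : Derivation ℤ P P) (F : Subfield P)
    (h : ∀ x ∈ F, d x ∈ F) (x : F) : ((restr d F h x : F) : P) = d x := rfl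

theorem isAlgebraic_of_killed_aux {F P Q : Type*} [Field F] [Field P] [Algebra F P] [CharZero F]
    [Field Q] [Algebra (Polynomial F) Q] [IsFractionRing (Polynomial F) Q] [CharZero Q]
    (x : P) (h : ∀ d : Derivation F P P, d x = 0) : IsAlgebraic F x := by
  by_contra hx
  have hx : Transcendental F x := hx
  have hinj : Function.Injective (Polynomial.aeval (R := F) x) :=
    transcendental_iff_injective.1 hx
  let φ : Polynomial F →+* P := (Polynomial.aeval x : Polynomial F →ₐ[F] P).toRingHom
  let ψ : Q →+* P := IsFractionRing.lift (g := φ) hinj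
  have hψ : ∀ p, ψ (algebraMap _ _ p) = φ p := fun p => IsFractionRing.lift_algebraMap hinj p
  obtain ⟨d0, hd0, hd0'⟩ : ∃ d0 : Q →+ P, (∀ a b, d0 (a * b) = ψ a * d0 b + ψ b * d0 a) ∧
      ∀ p : Polynomial F, d0 (algebraMap _ _ p) = φ p.derivative := by
    obtain ⟨d1, hd1⟩ := der_ext_frac (R := Polynomial F) (P := Q)
      (Derivation.mk' (((algebraMap (Polynomial F) Q).toAddMonoidHom.comp
        (Polynomial.derivative (R := F)).toAddMonoidHom).toIntLinearMap) (fun a b => by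
        simp [Polynomial.derivative_mul, Algebra.smul_def]; ring))
    refine ⟨ψ.toAddMonoidHom.comp d1.toLinearMap.toAddMonoidHom, fun a b => by simp, fun p => ?_⟩
    simp [hd1, hψ]
  letI : Algebra Q P := ψ.toAlgebra
  obtain ⟨d3, hd3⟩ := der_ext_field (F := Q) (P := P)
    (Derivation.mk' d0.toIntLinearMap (fun a b => by
      simp only [Algebra.smul_def]; exact hd0 a b))
  have key : ∀ p : Polynomial F, d3 (φ p) = φ p.derivative := by
    intro p
    rw [← hψ, ← hd0']
    exact hd3 _
  let d4 : Derivation F P P := Derivation.mk'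
    { toFun := d3
      map_add' := fun a b => map_add d3 a b
      map_smul' := fun c a => by
        have h0 : d3 (algebraMap F P c) = 0 := by
          have := key (Polynomial.C c)
          simpa [φ] using this
        simp [Algebra.smul_def, h0] } (fun a b => by simp)
  have h1 : d3 x = 1 := by
    have := key Polynomial.X
    simpa [φ] using this
  have h2 := h d4
  have h3 : d4 x = d3 x := rfl
  rw [h3, h1] at h2
  exact one_ne_zero h2

/-- an element killed by all F-derivations is algebraic -/
theorem isAlgebraic_of_killed {F P : Type*} [Field F] [Field P] [Algebra F P] [CharZero F]
    (x : P) (h : ∀ d : Derivation F P P, d x = 0) : IsAlgebraic F x := by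
  haveI : CharZero (FractionRing (Polynomial F)) := charZero_of_injective_algebraMap
    (R := F) (FaithfulSMul.algebraMap_injective _ _)
  exact isAlgebraic_of_killed_aux (Q := FractionRing (Polynomial F)) x h

end PVR



namespace PVR

open TensorProduct

theorem constB_finsupp {P ι : Type*} [Field P] (S : Set (Derivation ℤ P P))
    (V : Submodule P (ι →₀ P))
    (hV : ∀ d ∈ S, ∀ v ∈ V, Finsupp.mapRange d (map_zero d) v ∈ V) :
    ∀ v ∈ V, v ∈ Submodule.span P {w | w ∈ V ∧ ∀ d ∈ S, ∀ i, d (w i) = 0} := by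
  classical
  have main : ∀ n : ℕ, ∀ v ∈ V, v.support.card = n →
      v ∈ Submodule.span P {w | w ∈ V ∧ ∀ d ∈ S, ∀ i, d (w i) = 0} := by
    intro n
    induction n using Nat.strong_induction_on with
    | _ n ih =>
      intro v hv hn
      by_cases h0 : v = 0
      · rw [h0]; exact Submodule.zero_mem _
      obtain ⟨i0, hi0⟩ := Finsupp.ne_iff.1 h0
      rw [Finsupp.zero_apply] at hi0
      set h : ι →₀ P := (v i0)⁻¹ • v with hh
      have hhV : h ∈ V := V.smul_mem _ hv
      have hsupp : h.support = v.support := by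
        rw [hh]
        exact Finsupp.support_smul_eq (inv_ne_zero hi0)
      have hi1 : h i0 = 1 := by simp [hh, hi0]
      suffices hs : h ∈ Submodule.span P {w | w ∈ V ∧ ∀ d ∈ S, ∀ i, d (w i) = 0} by
        have : v = v i0 • h := by
          rw [hh, smul_smul, mul_inv_cancel₀ hi0, one_smul]
        rw [this]
        exact Submodule.smul_mem _ _ hs
      by_cases hd : ∀ d ∈ S, ∀ i, d (h i) = 0
      · exact Submodule.subset_span ⟨hhV, hd⟩
      push Not at hd
      obtain ⟨d, hdS, j, hj⟩ := hd
      set g : ι →₀ P := Finsupp.mapRange d (map_zero d) h with hg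
      have hgV : g ∈ V := hV d hdS h hhV
      have hgj : g j = d (h j) := by simp [hg]
      have hgsupp : g.support ⊂ h.support := by
        refine (Finset.ssubset_iff_of_subset ?_).2 ⟨i0, ?_, ?_⟩
        · exact Finsupp.support_mapRange
        · simp [hi1]
        · simp [hg, hi1]
      have hjs : j ∈ h.support := hgsupp.1 (by simp [hgj, hj])
      have hg_in := ih g.support.card (by
        rw [← hn, ← hsupp]; exact Finset.card_lt_card hgsupp) g hgV rfl
      set f : ι →₀ P := h - (h j / d (h j)) • g with hf
      have hfsupp : f.support ⊂ h.support := by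
        refine (Finset.ssubset_iff_of_subset ?_).2 ⟨j, hjs, ?_⟩
        · intro t ht
          by_contra hnt
          have h1 : h t = 0 := Finsupp.notMem_support_iff.1 hnt
          have h2 : g t = 0 := by simp [hg, h1]
          simp [hf, h1, h2] at ht
        · have : f j = 0 := by
            simp [hf, hgj, hj]
          simp [this]
      have hf_in := ih f.support.card (by
        rw [← hn, ← hsupp]; exact Finset.card_lt_card hfsupp) f
          (V.sub_mem hhV (V.smul_mem _ hgV)) rfl
      have : h = f + (h j / d (h j)) • g := by rw [hf]; abel
      rw [this]
      exact Submodule.add_mem _ hf_in (Submodule.smul_mem _ _ hg_in)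
  intro v hv
  exact main _ v hv rfl

theorem constB {P ι M : Type*} [Field P] [AddCommGroup M] [Module P M] (b : Module.Basis ι P M)
    (S : Set (Derivation ℤ P P)) (V : Submodule P M)
    (hV : ∀ d ∈ S, ∀ v ∈ V, ∃ w ∈ V, ∀ i, b.repr w i = d (b.repr v i)) :
    ∀ v ∈ V, v ∈ Submodule.span P {w | w ∈ V ∧ ∀ d ∈ S, ∀ i, d (b.repr w i) = 0} := by
  intro v hv
  have h1 := constB_finsupp S (V.map b.repr.toLinearMap) (by
    rintro d hd _ ⟨x, hx, rfl⟩
    obtain ⟨w, hw, hw'⟩ := hV d hd x hx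
    exact ⟨w, hw, by ext i; simp [hw']⟩) (b.repr v) ⟨v, hv, rfl⟩
  have h2 : b.repr.symm (b.repr v) ∈ (Submodule.span P {w | w ∈ V.map b.repr.toLinearMap ∧
      ∀ d ∈ S, ∀ i, d (w i) = 0}).map b.repr.symm.toLinearMap := ⟨_, h1, rfl⟩
  rw [b.repr.symm_apply_apply, Submodule.map_span] at h2
  refine Submodule.span_mono ?_ h2
  rintro _ ⟨_, ⟨⟨w, hw, rfl⟩, h3⟩, rfl⟩
  simpa using ⟨hw, h3⟩

/-- derivations preserve nilpotents -/
theorem nil_der {R : Type*} [CommRing R] [Algebra ℚ R] (f : R →+ R)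
    (hf : ∀ a b, f (a * b) = a * f b + b * f a) (x : R) (hx : IsNilpotent x) :
    IsNilpotent (f x) := by
  obtain ⟨n, hn⟩ := hx
  have hpow : ∀ (y : R) (m : ℕ), f (y ^ (m + 1)) = (m + 1 : ℕ) * y ^ m * f y := by
    intro y m
    induction m with
    | zero => simp
    | succ m ih =>
      rw [pow_succ, hf, ih]; push_cast; ring
  have h1 : f 1 = 0 := by
    have := hf 1 1
    simp at this
    exact this
  have main : ∀ k ≤ n, x ^ (n - k) * (f x) ^ (2 * k) = 0 := by
    intro k
    induction k with
    | zero => intro _; simp [hn]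
    | succ k ih =>
      intro hk
      have h2 := ih (by omega)
      obtain ⟨m, hm⟩ : ∃ m, n - k = m + 1 := ⟨n - k - 1, by omega⟩
      have hm' : n - (k + 1) = m := by omega
      rw [hm'] ; rw [hm] at h2
      have h3 : f (x ^ (m + 1) * f x ^ (2 * k)) * f x = 0 := by rw [h2]; simp
      rw [hf, hpow] at h3
      have h4 : x ^ (m + 1) * f (f x ^ (2 * k)) * f x = 0 := by
        rcases k with _ | k
        · simp [h1]
        · have : 2 * (k + 1) = (2 * k + 1) + 1 := by ring
          rw [this, hpow]
          have h5 : x ^ (m + 1) * f x ^ (2 * k + 1 + 1) = 0 := by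
            rw [← this]; exact h2
          calc _ = (x ^ (m + 1) * f x ^ (2 * k + 1 + 1)) * (((2 * k + 1 + 1 : ℕ) : R) * f (f x)) := by
                ring
            _ = 0 := by rw [h5, zero_mul]
      have h6 : ((m + 1 : ℕ) : R) * (x ^ m * f x ^ (2 * (k + 1))) = 0 := by
        have : ((m + 1 : ℕ) : R) * (x ^ m * f x ^ (2 * (k + 1))) =
          (x ^ (m + 1) * f (f x ^ (2 * k)) + f x ^ (2 * k) * (((m + 1 : ℕ) : R) * x ^ m * f x)) * f x
            - x ^ (m + 1) * f (f x ^ (2 * k)) * f x := by ring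
        rw [this, h3, h4, sub_zero]
      have hu : IsUnit ((m + 1 : ℕ) : R) := by
        have : ((m + 1 : ℕ) : R) = algebraMap ℚ R ((m + 1 : ℕ) : ℚ) := by simp
        rw [this]
        exact (IsUnit.mk0 _ (by exact_mod_cast (Nat.succ_ne_zero m))).map _
      exact (hu.mul_right_eq_zero).1 h6
  exact ⟨2 * n, by simpa using main n le_rfl⟩

theorem isReduced_tensor_fin (F A B : Type*) [Field F] [Field A] [Field B] [CharZero F]
    [Algebra F A] [Algebra F B] [FiniteDimensional F A] : IsReduced (B ⊗[F] A) := by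
  haveI : Algebra.FormallyEtale F A := Algebra.FormallyEtale.of_isSeparable F A
  exact Algebra.FormallyUnramified.isReduced_of_field B (B ⊗[F] A)

theorem isReduced_tensor (F A B : Type*) [Field F] [Field A] [Field B] [CharZero F]
    [Algebra F A] [Algebra F B] : IsReduced (A ⊗[F] B) := by
  classical
  letI : CharZero A := charZero_of_injective_algebraMap (algebraMap F A).injective
  letI : Algebra ℚ (A ⊗[F] B) := ((algebraMap A (A ⊗[F] B)).comp (algebraMap ℚ A)).toAlgebra
  let b := Module.Basis.ofVectorSpace F B
  let bb := Algebra.TensorProduct.basis A b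
  let S : Set (Derivation ℤ A A) := {d | ∃ δ : Derivation F A A, d = δ.restrictScalars ℤ}
  let V : Submodule A (A ⊗[F] B) := (nilradical (A ⊗[F] B)).restrictScalars A
  have hVmem : ∀ x, x ∈ V ↔ IsNilpotent x := fun x => Iff.rfl
  have key := constB bb S V (by
    rintro _ ⟨δ, rfl⟩ v hv
    let f : A ⊗[F] B →ₗ[F] A ⊗[F] B := δ.toLinearMap.rTensor B
    have hleib : ∀ a b : A ⊗[F] B, f (a * b) = a * f b + b * f a := by
      intro x y
      induction x using TensorProduct.induction_on with
      | zero => simp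
      | add x1 x2 h1 h2 => simp only [add_mul, map_add, h1, h2, mul_add]; ring
      | tmul x1 x2 =>
        induction y using TensorProduct.induction_on with
        | zero => simp
        | add x1 x2 h1 h2 => simp only [add_mul, map_add, h1, h2, mul_add]; ring
        | tmul y1 y2 =>
          simp [f, add_tmul, mul_comm]
    refine ⟨f v, ?_, ?_⟩
    · rw [hVmem] at hv ⊢
      exact nil_der f.toAddMonoidHom hleib v hv
    · intro i
      clear hv
      induction v using TensorProduct.induction_on with
      | zero => simp
      | add x1 x2 h1 h2 => simp [h1, h2]
      | tmul a c =>
        simp [f, bb, Algebra.TensorProduct.basis_repr_tmul, mul_comm])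
  have hzero : ∀ w ∈ {w | w ∈ V ∧ ∀ d ∈ S, ∀ i, d (bb.repr w i) = 0}, w = 0 := by
    rintro w ⟨hw, hk⟩
    have halg : ∀ i, IsAlgebraic F (bb.repr w i) := by
      intro i
      exact isAlgebraic_of_killed _ (fun d => hk _ ⟨d, rfl⟩ i)
    let T : Finset A := (bb.repr w).support.image (bb.repr w)
    let E := IntermediateField.adjoin F (T : Set A)
    haveI : FiniteDimensional F E := by
      refine IntermediateField.finiteDimensional_adjoin (fun x hx => ?_)
      have hx' : x ∈ T := hx
      obtain ⟨i, _, rfl⟩ := Finset.mem_image.1 hx'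
      exact (halg i).isIntegral
    have hE : ∀ i, bb.repr w i ∈ E := by
      intro i
      by_cases hi : i ∈ (bb.repr w).support
      · exact IntermediateField.subset_adjoin _ _ (by
          exact Finset.mem_coe.2 (Finset.mem_image_of_mem _ hi))
      · rw [Finsupp.notMem_support_iff.1 hi]; exact zero_mem _
    let g : B ⊗[F] E →ₐ[F] A ⊗[F] B :=
      (Algebra.TensorProduct.comm F B A).toAlgHom.comp (Algebra.TensorProduct.map (AlgHom.id F B) E.val)
    have hg : Function.Injective g := by
      have h1 : Function.Injective (Algebra.TensorProduct.map (AlgHom.id F B) E.val) :=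
        Module.Flat.lTensor_preserves_injective_linearMap (M := B) E.val.toLinearMap
          Subtype.val_injective
      exact (Algebra.TensorProduct.comm F B A).injective.comp h1
    let z : B ⊗[F] E := ∑ i ∈ (bb.repr w).support, b i ⊗ₜ (⟨bb.repr w i, hE i⟩ : E)
    have hz : g z = w := by
      conv_rhs => rw [← bb.linearCombination_repr w, Finsupp.linearCombination_apply, Finsupp.sum]
      simp only [z, map_sum]
      refine Finset.sum_congr rfl (fun i _ => ?_)
      simp [g, bb, Algebra.TensorProduct.basis_apply, TensorProduct.smul_tmul']
    haveI := isReduced_tensor_fin F E B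
    have : IsNilpotent z := by
      rw [hVmem] at hw
      obtain ⟨n, hn⟩ := hw
      have h1 := map_pow g.toRingHom z n
      have h2 : g.toRingHom z = w := hz
      rw [h2, hn] at h1
      exact ⟨n, hg (h1.trans (map_zero g.toRingHom).symm)⟩
    rw [← hz, this.eq_zero, map_zero]
  constructor
  intro x hx
  have := key x hx
  rw [Submodule.span_eq_bot.2 hzero] at this
  simpa using this

end PVR



namespace PVR

open TensorProduct

theorem leib_iter {R : Type*} [CommRing R] (f : R →+ R)
    (hf : ∀ a b, f (a * b) = a * f b + b * f a) (n : ℕ) (a b : R) :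
    f^[n] (a * b) = ∑ p ∈ Finset.HasAntidiagonal.antidiagonal n, n.choose p.1 • (f^[p.1] a * f^[p.2] b) := by
  induction n with
  | zero => simp
  | succ n ih =>
    have := Finset.sum_antidiagonal_choose_succ_nsmul (fun i j => f^[i] a * f^[j] b) n
    rw [this, Function.iterate_succ_apply', ih, map_sum, ← Finset.sum_add_distrib]
    refine Finset.sum_congr rfl (fun p hp => ?_)
    have h1 : n.choose p.2 = n.choose p.1 := by
      rw [Finset.HasAntidiagonal.mem_antidiagonal] at hp
      rw [← hp, Nat.choose_symm_add]
    rw [map_nsmul, hf, h1, Function.iterate_succ_apply', Function.iterate_succ_apply', ← smul_add]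
    congr 1
    ring

/-- reduced differential Q-algebra: nonzero elements survive in some differential field -/
theorem prime_core {R : Type u} [CommRing R] (hQ : ∀ n : ℕ, n ≠ 0 → IsUnit (n : R))
    (f : R →+ R) (hf : ∀ a b, f (a * b) = a * f b + b * f a) (q : Ideal R) (hq : q.IsPrime) :
    ∃ J : Ideal R, J.IsPrime ∧ ∀ a, a ∈ J ↔ ∀ i, f^[i] a ∈ q := by
  classical
  let J : Ideal R :=
    { carrier := {a | ∀ i, f^[i] a ∈ q}
      zero_mem' := fun i => by simp [iterate_map_zero]
      add_mem' := fun {a b} ha hb i => by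
        simp only [Set.mem_setOf_eq] at ha hb
        rw [iterate_map_add]; exact q.add_mem (ha i) (hb i)
      smul_mem' := fun c {a} ha i => by
        simp only [Set.mem_setOf_eq] at ha
        rw [smul_eq_mul, leib_iter f hf]
        exact q.sum_mem (fun p _ => nsmul_mem (q.mul_mem_left _ (ha p.2)) _) }
  have hJ : ∀ a, a ∈ J ↔ ∀ i, f^[i] a ∈ q := fun a => Iff.rfl
  have hJp : J.IsPrime := by
    refine ⟨fun h => ?_, ?_⟩
    · have : (1 : R) ∈ J := by rw [h]; trivial
      exact hq.ne_top ((Ideal.eq_top_iff_one q).2 ((hJ 1).1 this 0))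
    · intro a b hab
      by_contra! h
      rw [hJ, hJ] at h
      push Not at h
      obtain ⟨ha, hb⟩ := h
      let i := Nat.find ha
      let j := Nat.find hb
      have hi : f^[i] a ∉ q := Nat.find_spec ha
      have hj : f^[j] b ∉ q := Nat.find_spec hb
      have hi' : ∀ l < i, f^[l] a ∈ q := fun l hl => by
        have := Nat.find_min ha hl; push Not at this; exact this
      have hj' : ∀ l < j, f^[l] b ∈ q := fun l hl => by
        have := Nat.find_min hb hl; push Not at this; exact this
      have h1 := (hJ _).1 hab (i + j)
      rw [leib_iter f hf, ← Finset.add_sum_erase _ _ (a := (i, j)) (by simp)] at h1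
      have h2 := (Ideal.add_mem_iff_left q (q.sum_mem (fun p hp => by
        simp only [Finset.mem_erase, Finset.HasAntidiagonal.mem_antidiagonal] at hp
        refine nsmul_mem ?_ _
        by_cases hl : p.1 < i
        · exact q.mul_mem_right _ (hi' _ hl)
        · refine q.mul_mem_left _ (hj' _ ?_)
          by_contra hl2
          exact hp.1 (Prod.ext (by omega) (by omega))))).1 h1
      rw [nsmul_eq_mul] at h2
      have hu := hQ _ (Nat.choose_pos (Nat.le_add_right i j)).ne'
      have h3 := (Ideal.unit_mul_mem_iff_mem q hu).1 h2
      rcases hq.mem_or_mem h3 with h | h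
      · exact hi h
      · exact hj h
  exact ⟨J, hJp, hJ⟩

theorem ext_of_reduced {R : Type u} [CommRing R] [IsReduced R] (hQ : ∀ n : ℕ, n ≠ 0 → IsUnit (n : R))
    (f : R →+ R) (hf : ∀ a b, f (a * b) = a * f b + b * f a) (x : R) (hx : x ≠ 0) :
    ∃ (Ω : Type u) (_ : Field Ω) (_ : CharZero Ω) (DΩ : Derivation ℤ Ω Ω) (θ : R →+* Ω),
      (∀ a, DΩ (θ a) = θ (f a)) ∧ θ x ≠ 0 := by
  classical
  obtain ⟨q, hq, hxq⟩ : ∃ q : Ideal R, q.IsPrime ∧ x ∉ q := by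
    by_contra! h
    exact hx ((nilpotent_iff_mem_prime.2 h).eq_zero)
  obtain ⟨J, hJp, hJ⟩ := prime_core hQ f hf q hq
  obtain ⟨d1, hd1⟩ := der_quot (mkDer f hf) J (fun y hy => by
    rw [hJ] at hy ⊢
    intro i
    exact hy (i + 1))
  have main : ∀ (Q : Type u) [Field Q] [Algebra (R ⧸ J) Q] [IsFractionRing (R ⧸ J) Q],
    ∃ (Ω : Type u) (_ : Field Ω) (_ : CharZero Ω) (DΩ : Derivation ℤ Ω Ω) (θ : R →+* Ω),
      (∀ a, DΩ (θ a) = θ (f a)) ∧ θ x ≠ 0 := by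
    intro Q _ _ _
    let θ : R →+* Q := (algebraMap (R ⧸ J) Q).comp (Ideal.Quotient.mk J)
    have hchar : CharZero Q := by
      refine charZero_of_inj_zero (fun n hn => ?_)
      by_contra h
      have := (hQ n h).map θ
      rw [map_natCast, hn] at this
      exact not_isUnit_zero this
    obtain ⟨d2, hd2⟩ := der_ext_frac (R := R ⧸ J) (P := Q)
      (Derivation.mk' ((algebraMap (R ⧸ J) Q).toAddMonoidHom.comp
        d1.toLinearMap.toAddMonoidHom).toIntLinearMap (fun a b => by
        simp [Algebra.smul_def]))
    refine ⟨Q, inferInstance, hchar, d2, θ, fun a => ?_, fun h => ?_⟩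
    · have := hd2 (Ideal.Quotient.mk J a)
      simp only [θ, RingHom.comp_apply, this]
      simp [hd1]
    · have h1 : Ideal.Quotient.mk J x = 0 := by
        apply IsFractionRing.injective (R ⧸ J) Q
        rw [map_zero]; exact h
      rw [Ideal.Quotient.eq_zero_iff_mem, hJ] at h1
      exact hxq (h1 0)
  exact main (FractionRing (R ⧸ J))

theorem amalgam {F N1 N2 : Type u} [Field F] [CharZero F] [Field N1] [Field N2]
    [Algebra F N1] [Algebra F N2] (D1 : Derivation ℤ N1 N1) (D2 : Derivation ℤ N2 N2)
    (hD : ∀ x : F, ∃ y : F, D1 (algebraMap F N1 x) = algebraMap F N1 y ∧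
      D2 (algebraMap F N2 x) = algebraMap F N2 y) (x : N1 ⊗[F] N2) (hx : x ≠ 0) :
    ∃ (Ω : Type u) (_ : Field Ω) (_ : CharZero Ω) (DΩ : Derivation ℤ Ω Ω) (θ : N1 ⊗[F] N2 →+* Ω),
      (∀ a, DΩ (θ (a ⊗ₜ 1)) = θ (D1 a ⊗ₜ 1)) ∧ (∀ a, DΩ (θ (1 ⊗ₜ a)) = θ (1 ⊗ₜ D2 a)) ∧ θ x ≠ 0 := by
  haveI := isReduced_tensor F N1 N2
  let f : N1 ⊗[F] N2 →+ N1 ⊗[F] N2 := TensorProduct.liftAddHom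
    (AddMonoidHom.mk' (fun a => AddMonoidHom.mk' (fun b => D1 a ⊗ₜ b + a ⊗ₜ D2 b)
      (fun b c => by simp only [tmul_add, map_add]; abel)) (fun a c => by
        ext b
        simp only [map_add, add_tmul, AddMonoidHom.mk'_apply, AddMonoidHom.add_apply]; abel))
    (fun r m n => by
      obtain ⟨y, h1, h2⟩ := hD r
      simp only [AddMonoidHom.mk'_apply, Algebra.smul_def, Derivation.leibniz, h1, h2, smul_eq_mul, Algebra.algebraMap_self, RingHom.id_apply]
      have e1 : ∀ (c : F) (a : N1), a * algebraMap F N1 c = c • a := fun c a => by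
        rw [Algebra.smul_def, mul_comm]
      have e2 : ∀ (c : F) (a : N2), a * algebraMap F N2 c = c • a := fun c a => by
        rw [Algebra.smul_def, mul_comm]
      have e3 : ∀ (c : F) (a : N1), algebraMap F N1 c * a = c • a := fun c a => by
        rw [Algebra.smul_def]
      have e4 : ∀ (c : F) (a : N2), algebraMap F N2 c * a = c • a := fun c a => by
        rw [Algebra.smul_def]
      simp only [e1, e2, e3, e4, tmul_add, add_tmul, smul_tmul]
      abel)
  have hf0 : ∀ a b, f (a ⊗ₜ b) = D1 a ⊗ₜ b + a ⊗ₜ D2 b := fun a b => rfl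
  have hleib : ∀ a b : N1 ⊗[F] N2, f (a * b) = a * f b + b * f a := by
    intro x y
    induction x using TensorProduct.induction_on with
    | zero => simp
    | add x1 x2 h1 h2 => simp only [add_mul, map_add, h1, h2, mul_add]; ring
    | tmul x1 x2 =>
      induction y using TensorProduct.induction_on with
      | zero => simp
      | add x1 x2 h1 h2 => simp only [add_mul, map_add, h1, h2, mul_add]; ring
      | tmul y1 y2 =>
        simp only [hf0, Algebra.TensorProduct.tmul_mul_tmul, Derivation.leibniz, smul_eq_mul, add_tmul, tmul_add, mul_add]
        rw [mul_comm y2 x2, mul_comm y1 x1]; abel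
  obtain ⟨Ω, i1, i2, DΩ, θ, h1, h2⟩ := ext_of_reduced (fun n hn => by
    have : (n : N1 ⊗[F] N2) = algebraMap F _ (n : F) := by simp
    rw [this]
    exact (IsUnit.mk0 _ (by exact_mod_cast hn)).map _) f hleib x hx
  refine ⟨Ω, i1, i2, DΩ, θ, fun a => ?_, fun a => ?_, h2⟩
  · rw [h1, hf0]; simp
  · rw [h1, hf0]; simp

theorem generic_aux {N : Type u} [Field N] [CharZero N] (D : Derivation ℤ N N) {ι : Type}
    [Fintype ι] [DecidableEq ι] (A : Matrix ι ι N) (Q : Type u) [Field Q]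
    [Algebra (MvPolynomial (ι × ι) N) Q] [IsFractionRing (MvPolynomial (ι × ι) N) Q] :
    ∃ (N' : Type u) (_ : Field N') (_ : CharZero N') (D' : Derivation ℤ N' N') (i : N →+* N')
      (X : Matrix ι ι N'), (∀ x, D' (i x) = i (D x)) ∧ X.det ≠ 0 ∧
      X.map D' = A.map i * X := by
  classical
  let j : MvPolynomial (ι × ι) N →+* Q := algebraMap _ _
  have hj : Function.Injective j := IsFractionRing.injective _ _
  let i : N →+* Q := j.comp MvPolynomial.C
  obtain ⟨d1, hd1, hd2, hd3⟩ := der_ext_mv (σ := ι × ι) D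
    (fun p => ∑ l, MvPolynomial.C (A p.1 l) * MvPolynomial.X (l, p.2))
  obtain ⟨d2, hd⟩ : ∃ d2 : Derivation ℤ Q Q, ∀ x, d2 (j x) = j (d1 x) := by
    obtain ⟨d2, h2⟩ := der_ext_frac (R := MvPolynomial (ι × ι) N) (P := Q)
      (Derivation.mk' (j.toAddMonoidHom.comp d1).toIntLinearMap (fun a b => by
        simp [Algebra.smul_def, hd1, j]))
    exact ⟨d2, h2⟩
  refine ⟨Q, inferInstance, charZero_of_injective_ringHom i.injective, d2, i,
    (Matrix.mvPolynomialX ι ι N).map j, fun x => ?_, ?_, ?_⟩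
  · simp [i, hd, hd2]
  · have : ((Matrix.mvPolynomialX ι ι N).map j).det = j (Matrix.mvPolynomialX ι ι N).det := by
      rw [RingHom.map_det]; rfl
    rw [this]
    intro h
    exact Matrix.det_mvPolynomialX_ne_zero ι N (hj (by rw [h, map_zero]))
  · ext a b
    simp [Matrix.mul_apply, hd, hd3, i, Matrix.mvPolynomialX_apply]

theorem generic {N : Type u} [Field N] [CharZero N] (D : Derivation ℤ N N) {ι : Type}
    [Fintype ι] [DecidableEq ι] (A : Matrix ι ι N) :
    ∃ (N' : Type u) (_ : Field N') (_ : CharZero N') (D' : Derivation ℤ N' N') (i : N →+* N')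
      (X : Matrix ι ι N'), (∀ x, D' (i x) = i (D x)) ∧ X.det ≠ 0 ∧
      X.map D' = A.map i * X :=
  generic_aux D A (FractionRing (MvPolynomial (ι × ι) N))

end PVR



namespace PVR

open TensorProduct

section basic
variable {N : Type u} [Field N]

/-- D-stable subfield -/
def DSt (D : Derivation ℤ N N) (F : Subfield N) : Prop := ∀ x ∈ F, D x ∈ F

theorem der_eval (D : Derivation ℤ N N) (p : Polynomial N) (x : N) :
    D (p.eval x) = p.sum (fun i c => D c * x ^ i) + p.derivative.eval x * D x := by
  induction p using Polynomial.induction_on' with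
  | add p q hp hq =>
    rw [Polynomial.sum_add_index _ _ _ (by simp) (by intros; simp [add_mul])]
    simp only [Polynomial.eval_add, map_add, hp, hq, Polynomial.derivative_add]; ring
  | monomial n a =>
    rw [Polynomial.sum_monomial_index _ _ (by simp)]
    simp [Polynomial.derivative_monomial]
    ring

theorem der_inv (D : Derivation ℤ N N) (x : N) : D x⁻¹ = - (x⁻¹) ^ 2 * D x := by
  simpa using D.leibniz_inv x

theorem der_alg_mem [CharZero N] (D : Derivation ℤ N N) (F M : Subfield N) (hF : DSt D F) (hM : F ≤ M)
    (x : N) (hx : IsAlgebraic F x) (hxM : x ∈ M) : D x ∈ M := by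
  let q := minpoly F x
  have hi : IsIntegral F x := hx.isIntegral
  let p : Polynomial N := q.map (algebraMap F N)
  have hp0 : p.eval x = 0 := by
    have := minpoly.aeval F x
    rwa [Polynomial.aeval_def, ← Polynomial.eval_map] at this
  have hd : p.derivative.eval x ≠ 0 := by
    intro h
    have h1 : Polynomial.aeval x q.derivative = 0 := by
      rw [Polynomial.aeval_def, ← Polynomial.eval_map, ← Polynomial.derivative_map]; exact h
    have h2 := (minpoly.irreducible hi).separable
    have h3 := h2.aeval_derivative_ne_zero (minpoly.aeval F x)
    exact h3 h1
  have hpc : ∀ i, p.coeff i ∈ F := fun i => by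
    simp only [p, Polynomial.coeff_map]; exact (q.coeff i).2
  have h := der_eval D p x
  rw [hp0, map_zero] at h
  have h4 : D x = - (p.sum (fun i c => D c * x ^ i)) / p.derivative.eval x := by
    field_simp
    linear_combination -h
  rw [h4]
  refine div_mem (neg_mem ?_) ?_
  · exact sum_mem (fun i _ => mul_mem (hM (hF _ (hpc i))) (pow_mem hxM i))
  · rw [Polynomial.eval_eq_sum]
    refine sum_mem (fun i _ => mul_mem (hM ?_) (pow_mem hxM i))
    rw [Polynomial.coeff_derivative]
    exact mul_mem (hpc _) (by exact_mod_cast natCast_mem F (i+1))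

theorem dst_closure (D : Derivation ℤ N N) (S : Set N) (h : ∀ x ∈ S, D x ∈ Subfield.closure S) :
    DSt D (Subfield.closure S) := by
  intro x hx
  induction hx using Subfield.closure_induction with
  | mem x hx => exact h x hx
  | one => simp
  | add x y _ _ hx hy => rw [map_add]; exact add_mem hx hy
  | neg x _ hx => rw [map_neg]; exact neg_mem hx
  | inv x hx0 hx => rw [der_inv]; exact mul_mem (neg_mem (pow_mem (inv_mem hx0) _)) hx
  | mul x y hx0 hy0 hx hy =>
    rw [D.leibniz]; exact add_mem (mul_mem hx0 hy) (mul_mem hy0 hx)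

theorem dst_sup (D : Derivation ℤ N N) (F M : Subfield N) (hF : DSt D F) (hM : DSt D M) :
    DSt D (F ⊔ M) := by
  have : F ⊔ M = Subfield.closure ((F : Set N) ∪ M) := by
    rw [Subfield.closure_union, Subfield.closure_eq, Subfield.closure_eq]
  rw [this]
  refine dst_closure D _ ?_
  rintro x (hx | hx)
  · exact Subfield.subset_closure (Or.inl (hF x hx))
  · exact Subfield.subset_closure (Or.inr (hM x hx))

/-- linear (D-finite) elements over F -/
def IsLin (D : Derivation ℤ N N) (F : Subfield N) (y : N) : Prop :=
  ∃ V : Submodule F N, V.FG ∧ (∀ v ∈ V, D v ∈ V) ∧ y ∈ V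

theorem span_dst (D : Derivation ℤ N N) (F : Subfield N) (hF : DSt D F) (S : Set N)
    (V : Submodule F N) (hSV : Submodule.span F S ≤ V)
    (h : ∀ s ∈ S, D s ∈ V) : ∀ v ∈ Submodule.span F S, D v ∈ V := by
  intro v hv
  induction hv using Submodule.span_induction with
  | mem x hx => exact h x hx
  | zero => simp
  | add x y _ _ hx hy => rw [map_add]; exact add_mem hx hy
  | smul c x hx0 hx =>
    rw [Subfield.smul_def, smul_eq_mul, D.leibniz, smul_eq_mul, smul_eq_mul]
    refine add_mem (V.smul_mem c hx) ?_
    rw [mul_comm]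
    exact V.smul_mem (⟨D c, hF c c.2⟩ : F) (hSV hx0)

theorem isLin_of_span (D : Derivation ℤ N N) (F : Subfield N) (hF : DSt D F) (S : Set N)
    (hS : S.Finite) (h : ∀ s ∈ S, D s ∈ Submodule.span F S) (y : N) (hy : y ∈ Submodule.span F S) :
    IsLin D F y :=
  ⟨Submodule.span F S, Submodule.fg_span hS, span_dst D F hF S _ le_rfl h, hy⟩

theorem isLin_iff_exists (D : Derivation ℤ N N) (F : Subfield N) (hF : DSt D F) (y : N) :
    IsLin D F y ↔ ∃ (n : ℕ) (w : Fin n → N) (A : Matrix (Fin n) (Fin n) N) (c : Fin n → N),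
      (∀ i j, A i j ∈ F) ∧ (∀ i, c i ∈ F) ∧ (∀ i, D (w i) = ∑ j, A i j * w j) ∧
      y = ∑ i, c i * w i := by
  constructor
  · rintro ⟨V, hV, hVD, hy⟩
    obtain ⟨n, w, hw⟩ := Submodule.fg_iff_exists_fin_generating_family.1 hV
    have hm : ∀ x ∈ V, ∃ c : Fin n → N, (∀ i, c i ∈ F) ∧ x = ∑ i, c i * w i := by
      intro x hx
      rw [← hw] at hx
      obtain ⟨c, hc⟩ := (Submodule.mem_span_range_iff_exists_fun F).1 hx
      exact ⟨fun i => c i, fun i => (c i).2, by rw [← hc]; rfl⟩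
    have hwV : ∀ i, w i ∈ V := fun i => by
      rw [← hw]; exact Submodule.subset_span ⟨i, rfl⟩
    choose A hA1 hA2 using fun i => hm _ (hVD _ (hwV i))
    obtain ⟨c, hc1, hc2⟩ := hm y hy
    exact ⟨n, w, A, c, hA1, hc1, hA2, hc2⟩
  · rintro ⟨n, w, A, c, hA, hc, hw, rfl⟩
    have hm : ∀ c : Fin n → N, (∀ i, c i ∈ F) → ∑ i, c i * w i ∈ Submodule.span F (Set.range w) :=
      fun c hc => Submodule.sum_mem _ (fun i _ =>
        Submodule.smul_mem _ (⟨c i, hc i⟩ : F) (Submodule.subset_span ⟨i, rfl⟩))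
    refine isLin_of_span D F hF _ (Set.finite_range w) ?_ _ (hm c hc)
    rintro _ ⟨i, rfl⟩
    rw [hw]
    exact hm _ (hA i)

theorem isLin_fin {ι : Type*} [Fintype ι] (D : Derivation ℤ N N) (F : Subfield N) (hF : DSt D F)
    (w : ι → N) (A : ι → ι → N) (hA : ∀ i j, A i j ∈ F) (hw : ∀ i, D (w i) = ∑ j, A i j * w j)
    (i : ι) : IsLin D F (w i) := by
  refine isLin_of_span D F hF _ (Set.finite_range w) ?_ _ (Submodule.subset_span ⟨i, rfl⟩)
  rintro _ ⟨i, rfl⟩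
  rw [hw]
  exact Submodule.sum_mem _ (fun j _ =>
        Submodule.smul_mem _ (⟨A i j, hA i j⟩ : F) (Submodule.subset_span ⟨j, rfl⟩))

/-- the subring of linear elements -/
def Lin (D : Derivation ℤ N N) (F : Subfield N) (hF : DSt D F) : Subring N where
  carrier := {y | IsLin D F y}
  mul_mem' := by
    rintro a b ⟨V, hV, hVD, ha⟩ ⟨W, hW, hWD, hb⟩
    refine ⟨V * W, hV.mul hW, ?_, Submodule.mul_mem_mul ha hb⟩
    intro v hv
    induction hv using Submodule.mul_induction_on' with
    | mem_mul_mem m hm n hn =>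
      rw [D.leibniz, smul_eq_mul, smul_eq_mul, mul_comm n]
      exact add_mem (Submodule.mul_mem_mul hm (hWD n hn)) (Submodule.mul_mem_mul (hVD m hm) hn)
    | add x _ y _ hx hy => rw [map_add]; exact add_mem hx hy
  add_mem' := by
    rintro a b ⟨V, hV, hVD, ha⟩ ⟨W, hW, hWD, hb⟩
    refine ⟨V ⊔ W, hV.sup hW, ?_, add_mem (Submodule.mem_sup_left ha) (Submodule.mem_sup_right hb)⟩
    intro v hv
    obtain ⟨x, hx, y, hy, rfl⟩ := Submodule.mem_sup.1 hv
    rw [map_add]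
    exact add_mem (Submodule.mem_sup_left (hVD x hx)) (Submodule.mem_sup_right (hWD y hy))
  neg_mem' := by
    rintro a ⟨V, hV, hVD, ha⟩
    exact ⟨V, hV, hVD, neg_mem ha⟩
  one_mem' := isLin_of_span D F hF {1} (by simp) (by simp) 1 (Submodule.subset_span rfl)
  zero_mem' := isLin_of_span D F hF {1} (by simp) (by simp) 0 (Submodule.zero_mem _)

theorem mem_Lin (D : Derivation ℤ N N) (F : Subfield N) (hF : DSt D F) (y : N) :
    y ∈ Lin D F hF ↔ IsLin D F y := Iff.rfl

theorem isLin_of_mem (D : Derivation ℤ N N) (F : Subfield N) (hF : DSt D F) (y : N) (hy : y ∈ F) :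
    IsLin D F y :=
  isLin_of_span D F hF {1} (by simp) (by simp) y
    (by
      have := Submodule.smul_mem _ (⟨y, hy⟩ : F) (Submodule.subset_span (R := F) (Set.mem_singleton (1:N)))
      rwa [Subfield.smul_def, smul_eq_mul, mul_one] at this)

theorem isLin_const (D : Derivation ℤ N N) (F : Subfield N) (hF : DSt D F) (y : N) (hy : D y = 0) :
    IsLin D F y :=
  isLin_of_span D F hF {y} (by simp) (by simp [hy]) y (Submodule.subset_span rfl)

theorem isLin_der (D : Derivation ℤ N N) (F : Subfield N) (y : N) (hy : IsLin D F y) :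
    IsLin D F (D y) := by
  obtain ⟨V, hV, hVD, ha⟩ := hy
  exact ⟨V, hV, hVD, hVD _ ha⟩

theorem isLin_mono (D : Derivation ℤ N N) (F M : Subfield N) (hF : DSt D F) (hM : DSt D M) (hFM : F ≤ M) (y : N)
    (hy : IsLin D F y) : IsLin D M y := by
  rw [isLin_iff_exists D F hF] at hy
  rw [isLin_iff_exists D M hM]
  obtain ⟨n, w, A, c, h1, h2, h3⟩ := hy
  exact ⟨n, w, A, c, fun i j => hFM (h1 i j), fun i => hFM (h2 i), h3⟩

theorem isLin_alg [CharZero N] (D : Derivation ℤ N N) (F : Subfield N) (hF : DSt D F) (y : N)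
    (hy : IsAlgebraic F y) : IsLin D F y := by
  let A := Algebra.adjoin F {y}
  have hf : (Subalgebra.toSubmodule A).FG := hy.isIntegral.fg_adjoin_singleton
  have halg : ∀ x ∈ A, IsAlgebraic F x := by
    haveI : Algebra.IsAlgebraic F A := by
      haveI : Module.Finite F A := Module.Finite.iff_fg.2 hf
      infer_instance
    intro x hx
    exact (isAlgebraic_algHom_iff A.val Subtype.val_injective).2 (Algebra.IsAlgebraic.isAlgebraic (R := F) (⟨x, hx⟩ : A))
  have hA : ∀ x, x ∈ A → x⁻¹ ∈ A := fun x hx =>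
    A.inv_mem_of_algebraic (x := (⟨x, hx⟩ : A)) (halg x hx)
  let M : Subfield N := { A.toSubring with inv_mem' := hA }
  have hM : ∀ x, x ∈ M ↔ x ∈ A := fun x => Iff.rfl
  refine ⟨Subalgebra.toSubmodule A, hf, fun v hv => ?_, Algebra.self_mem_adjoin_singleton F y⟩
  have hFM : F ≤ M := fun x hx => A.algebraMap_mem (⟨x, hx⟩ : F)
  haveI : Module.Finite F A := Module.Finite.iff_fg.2 hf
  have hv' : v ∈ A := hv
  exact der_alg_mem D F M hF hFM v (halg v hv') hv'

end basic

/-- differential hom -/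
def DHom {N N' : Type*} [Field N] [Field N'] (D : Derivation ℤ N N) (D' : Derivation ℤ N' N')
    (i : N →+* N') : Prop := ∀ x, D' (i x) = i (D x)

theorem DHom.comp {N N' N'' : Type*} [Field N] [Field N'] [Field N''] {D : Derivation ℤ N N}
    {D' : Derivation ℤ N' N'} {D'' : Derivation ℤ N'' N''} {i : N →+* N'} {j : N' →+* N''}
    (hj : DHom D' D'' j) (hi : DHom D D' i) : DHom D D'' (j.comp i) := fun x => by
  simp [hj (i x), hi x]

theorem dst_map {N N' : Type*} [Field N] [Field N'] {D : Derivation ℤ N N} {D' : Derivation ℤ N' N'}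
    {i : N →+* N'} (hi : DHom D D' i) {F : Subfield N} (hF : DSt D F) : DSt D' (F.map i) := by
  rintro _ ⟨x, hx, rfl⟩
  exact ⟨D x, hF x hx, (hi x).symm⟩

theorem isLin_map {N N' : Type u} [Field N] [Field N'] {D : Derivation ℤ N N} {D' : Derivation ℤ N' N'}
    {i : N →+* N'} (hi : DHom D D' i) {F : Subfield N} (hF : DSt D F) {y : N}
    (hy : IsLin D F y) : IsLin D' (F.map i) (i y) := by
  rw [isLin_iff_exists D F hF] at hy
  rw [isLin_iff_exists D' _ (dst_map hi hF)]
  obtain ⟨n, w, A, c, h1, h2, h3, h4⟩ := hy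
  refine ⟨n, fun l => i (w l), A.map i, fun l => i (c l), fun a b => ⟨_, h1 a b, rfl⟩, fun a => ⟨_, h2 a, rfl⟩,
    fun a => ?_, ?_⟩
  · rw [hi, h3, map_sum]; simp
  · rw [h4, map_sum]; simp

/-- field generated by linear elements -/
def Qf {N : Type u} [Field N] (D : Derivation ℤ N N) (F : Subfield N) : Subfield N :=
  Subfield.closure {y | IsLin D F y}

/-- its relative algebraic closure -/
noncomputable def Qa {N : Type u} [Field N] (D : Derivation ℤ N N) (F : Subfield N) : Subfield N :=
  (algebraicClosure (Qf D F) N).toSubfield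

section
variable {N : Type u} [Field N] [CharZero N] {D : Derivation ℤ N N} {F : Subfield N}

theorem mem_Qa {x : N} : x ∈ Qa D F ↔ IsAlgebraic (Qf D F) x := mem_algebraicClosure_iff

theorem lin_le_Qf {x : N} (h : IsLin D F x) : x ∈ Qf D F := Subfield.subset_closure h

theorem Qf_le_Qa : Qf D F ≤ Qa D F := fun x hx => mem_Qa.2 (isAlgebraic_algebraMap (⟨x, hx⟩ : Qf D F))

theorem le_Qf (hF : DSt D F) : F ≤ Qf D F := fun x hx => lin_le_Qf (isLin_of_mem D F hF x hx)

theorem le_Qa (hF : DSt D F) : F ≤ Qa D F := (le_Qf hF).trans Qf_le_Qa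

theorem dst_Qf : DSt D (Qf D F) :=
  dst_closure D _ (fun x hx => Subfield.subset_closure (isLin_der D F x hx))

theorem dst_Qa : DSt D (Qa D F) := fun x hx =>
  der_alg_mem D (Qf D F) (Qa D F) dst_Qf Qf_le_Qa x (mem_Qa.1 hx) hx

theorem Qf_mono {M : Subfield N} (hF : DSt D F) (hM : DSt D M) (h : F ≤ M) : Qf D F ≤ Qf D M :=
  Subfield.closure_mono (fun x hx => isLin_mono D F M hF hM h x hx)

theorem mem_Qf_iff (hF : DSt D F) {x : N} :
    x ∈ Qf D F ↔ ∃ u v, IsLin D F u ∧ IsLin D F v ∧ v ≠ 0 ∧ x = u / v := by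
  constructor
  · intro hx
    obtain ⟨u, hu, v, hv, rfl⟩ := Subfield.mem_closure_iff.1 hx
    have : Subring.closure {y | IsLin D F y} = Lin D F hF := Subring.closure_eq (Lin D F hF)
    rw [this] at hu hv
    by_cases h0 : v = 0
    · exact ⟨0, 1, (Lin D F hF).zero_mem, (Lin D F hF).one_mem, one_ne_zero, by simp [h0]⟩
    · exact ⟨u, v, hu, hv, h0, rfl⟩
  · rintro ⟨u, v, hu, hv, _, rfl⟩
    exact div_mem (lin_le_Qf hu) (lin_le_Qf hv)

theorem isAlgebraic_subfield_mono {N : Type*} [Field N] {F M : Subfield N} (h : F ≤ M) {x : N}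
    (hx : IsAlgebraic F x) : IsAlgebraic M x := by
  letI : Algebra F M := (Subfield.inclusion h).toAlgebra
  haveI : IsScalarTower F M N := IsScalarTower.of_algebraMap_eq (fun x => rfl)
  exact hx.tower_top M

theorem isAlgebraic_subfield_map {N N' : Type*} [Field N] [Field N'] (i : N →+* N') {F : Subfield N} {x : N}
    (hx : IsAlgebraic F x) : IsAlgebraic (F.map i) (i x) := by
  obtain ⟨p, hp, h⟩ := hx
  let j : F →+* (F.map i) := (i.comp F.subtype).codRestrict _ (fun x => ⟨x, x.2, rfl⟩)
  refine ⟨p.map j, (Polynomial.map_ne_zero_iff j.injective).2 hp, ?_⟩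
  rw [Polynomial.aeval_def, Polynomial.eval₂_map]
  have : (algebraMap (F.map i) N').comp j = i.comp (algebraMap F N) := rfl
  rw [this, ← Polynomial.hom_eval₂, ← Polynomial.aeval_def, h, map_zero]

theorem Qa_algClosed {x : N} (hx : IsAlgebraic (Qa D F) x) : x ∈ Qa D F := by
  rw [mem_Qa]
  have : IsAlgebraic (algebraicClosure (Qf D F) N) x := hx
  have h2 : IsIntegral (algebraicClosure (Qf D F) N) x := this.isIntegral
  exact (isIntegral_trans x h2).isAlgebraic

theorem Qf_map {N' : Type u} [Field N'] {D' : Derivation ℤ N' N'}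
    {i : N →+* N'} (hi : DHom D D' i) (hF : DSt D F) : (Qf D F).map i ≤ Qf D' (F.map i) := by
  rw [Subfield.map_le_iff_le_comap, Qf, Subfield.closure_le]
  intro x hx
  exact Subfield.subset_closure (isLin_map hi hF hx)

theorem Qa_map {N' : Type u} [Field N'] [CharZero N'] {D' : Derivation ℤ N' N'}
    {i : N →+* N'} (hi : DHom D D' i) (hF : DSt D F) : (Qa D F).map i ≤ Qa D' (F.map i) := by
  rintro _ ⟨x, hx, rfl⟩
  rw [mem_Qa]
  exact isAlgebraic_subfield_mono (Qf_map hi hF) (isAlgebraic_subfield_map i (mem_Qa.1 hx))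

theorem Qa_mono {M : Subfield N} (hF : DSt D F) (hM : DSt D M) (h : F ≤ M) : Qa D F ≤ Qa D M := fun x hx => by
  rw [mem_Qa] at hx ⊢
  exact isAlgebraic_subfield_mono (Qf_mono hF hM h) hx

end

/-- the property that no element of `K \ k` becomes a ratio of linear elements in any extension -/
def PP {N : Type u} [Field N] (D : Derivation ℤ N N) (K k : Subfield N) : Prop :=
  ∀ (N' : Type u) [Field N'] [CharZero N'] (D' : Derivation ℤ N' N') (i : N →+* N'),
    DHom D D' i → ∀ x ∈ K, i x ∈ Qf D' (k.map i) → x ∈ k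

theorem PP_map {N N1 : Type u} [Field N] [Field N1] {D : Derivation ℤ N N} {D1 : Derivation ℤ N1 N1}
    {K k : Subfield N} (h : PP D K k) (i : N →+* N1) (hi : DHom D D1 i) :
    PP D1 (K.map i) (k.map i) := by
  rintro N' _ _ D' j hj _ ⟨x, hx, rfl⟩ hx2
  rw [Subfield.map_map] at hx2
  exact ⟨x, h N' D' (j.comp i) (hj.comp hi) x hx hx2, rfl⟩

end PVR



namespace PVR

open TensorProduct

theorem tsum_ne_zero {F A B ι : Type*} [Field F] [Field A] [Field B] [Algebra F A] [Algebra F B] [Fintype ι]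
    (ν : ι → B) (hν : LinearIndependent F ν) (c : ι → A) (i0 : ι) (hc : c i0 ≠ 0) :
    ∑ i, c i ⊗ₜ[F] ν i ≠ 0 := by
  classical
  intro h
  obtain ⟨φ, hφ⟩ := LinearMap.exists_extend ((Finsupp.lapply i0 : (ι →₀ F) →ₗ[F] F) ∘ₗ hν.repr)
  have h1 : ∀ i, φ (ν i) = if i = i0 then 1 else 0 := by
    intro i
    have h2 := LinearMap.congr_fun hφ (⟨ν i, Submodule.subset_span ⟨i, rfl⟩⟩ : Submodule.span F (Set.range ν))
    simp only [LinearMap.comp_apply, Submodule.subtype_apply] at h2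
    rw [h2]
    have h3 := hν.repr_eq_single i ⟨ν i, Submodule.subset_span ⟨i, rfl⟩⟩ rfl
    simp [h3, Finsupp.single_apply]
  have h2 := congrArg (TensorProduct.rid F A ∘ (φ.lTensor A)) h
  simp [map_sum, h1] at h2
  exact hc h2

theorem mat_det_mem {N ι : Type*} [Field N] [Fintype ι] [DecidableEq ι] (Y : Subfield N)
    (G : Matrix ι ι N) (hG : ∀ i j, G i j ∈ Y) : G.det ∈ Y := by
  rw [Matrix.det_apply]
  refine sum_mem (fun σ _ => ?_)
  rw [Units.smul_def]
  exact zsmul_mem (prod_mem (fun i _ => hG _ _)) _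

theorem mat_inv_mem {N ι : Type*} [Field N] [Fintype ι] [DecidableEq ι] (Y : Subfield N)
    (G : Matrix ι ι N) (hG : ∀ i j, G i j ∈ Y) (i j : ι) : G⁻¹ i j ∈ Y := by
  rw [Matrix.inv_def, Matrix.smul_apply, smul_eq_mul, Ring.inverse_eq_inv']
  refine mul_mem (inv_mem (mat_det_mem Y G hG)) ?_
  rw [Matrix.adjugate_apply]
  refine mat_det_mem Y _ (fun a b => ?_)
  rw [Matrix.updateRow_apply]
  split_ifs
  · rw [Pi.single_apply]; split_ifs
    · exact one_mem _
    · exact zero_mem _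
  · exact hG _ _

theorem lemM {N : Type u} [Field N] [CharZero N] (D : Derivation ℤ N N) (K : Subfield N) (hK : DSt D K)
    (r : ℕ) (ν : Fin r → N) (hν : LinearIndependent K ν) :
    ∃ (N' : Type u) (_ : Field N') (_ : CharZero N') (D' : Derivation ℤ N' N') (i : N →+* N')
      (σ : Fin r → (N →+* N')), DHom D D' i ∧ (∀ j, DHom D D' (σ j)) ∧
      (∀ j, ∀ x ∈ K, σ j x = i x) ∧ (Matrix.of (fun j l => σ j (ν l))).det ≠ 0 := by
  induction r with
  | zero =>
    exact ⟨N, inferInstance, inferInstance, D, RingHom.id N, fun _ => RingHom.id N, fun x => rfl,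
      fun j => j.elim0, fun j => j.elim0, by simp⟩
  | succ r ih =>
    obtain ⟨N', _, _, D', i, σ, hi, hσ, hσK, hdet⟩ := ih (Fin.tail ν) (linearIndependent_finSucc.1 hν).1
    letI : Algebra K N' := (i.comp K.subtype).toAlgebra
    have hal : ∀ x : K, algebraMap K N' x = i x := fun x => rfl
    let c : Fin (r + 1) → N' := fun l =>
      (-1) ^ (l : ℕ) * (Matrix.of (fun (j : Fin r) (m : Fin r) => σ j (ν (l.succAbove m)))).det
    have hc0 : c 0 ≠ 0 := by
      simpa [c, Fin.tail] using hdet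
    obtain ⟨Ω, _, _, DΩ, θ, h1, h2, h3⟩ := amalgam (F := K) D' D (fun x =>
      ⟨⟨D x, hK x x.2⟩, by rw [hal, hal, hi], rfl⟩) _ (tsum_ne_zero ν hν c 0 hc0)
    let f1 : N' →+* Ω := θ.comp (Algebra.TensorProduct.includeLeft (R := K) (S := K) (A := N') (B := N)).toRingHom
    let f2 : N →+* Ω := θ.comp (Algebra.TensorProduct.includeRight (R := K) (A := N') (B := N)).toRingHom
    have hf1 : ∀ x, f1 x = θ (x ⊗ₜ 1) := fun x => rfl
    have hf2 : ∀ x, f2 x = θ (1 ⊗ₜ x) := fun x => rfl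
    have hf1D : DHom D' DΩ f1 := h1
    have hf2D : DHom D DΩ f2 := h2
    refine ⟨Ω, inferInstance, inferInstance, DΩ, f1.comp i, Fin.cons f2 (fun j => f1.comp (σ j)),
      hf1D.comp hi, ?_, ?_, ?_⟩
    · intro j
      refine Fin.cases ?_ (fun j => ?_) j
      · exact hf2D
      · exact hf1D.comp (hσ j)
    · intro j x hx
      refine Fin.cases ?_ (fun j => ?_) j
      · simp only [Fin.cons_zero, RingHom.comp_apply, hf1, hf2]
        congr 1
        have e1 : i x = (⟨x, hx⟩ : K) • (1 : N') := by rw [Algebra.smul_def, hal, mul_one]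
        have e2 : x = (⟨x, hx⟩ : K) • (1 : N) := by rw [Subfield.smul_def, smul_eq_mul, mul_one]
        rw [e1, smul_tmul, ← e2]
      · simp only [Fin.cons_succ, RingHom.comp_apply, hσK j x hx]
    · rw [Matrix.det_succ_row_zero]
      have : θ (∑ l, c l ⊗ₜ ν l) = ∑ l, f1 (c l) * f2 (ν l) := by
        rw [map_sum]
        refine Finset.sum_congr rfl (fun l _ => ?_)
        rw [hf1, hf2, ← map_mul]; simp
      rw [this] at h3
      convert h3 using 1
      refine Finset.sum_congr rfl (fun l _ => ?_)
      simp only [c, map_mul, map_pow, map_neg, map_one]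
      rw [RingHom.map_det]
      simp only [Matrix.of_apply, Fin.cons_zero]
      rw [mul_right_comm]
      congr 2

theorem lindis {N : Type u} [Field N] [CharZero N] (D : Derivation ℤ N N) (K k : Subfield N) (hK : DSt D K)
    (S : Set N)
    (hS : ∀ (N' : Type u) [Field N'] [CharZero N'] (D' : Derivation ℤ N' N') (i : N →+* N'), DHom D D' i →
      ∃ Y : Subfield N', (∀ x ∈ K, i x ∈ Y → x ∈ k) ∧
        ∀ σ : N →+* N', DHom D D' σ → (∀ x ∈ K, σ x = i x) → ∀ s ∈ S, σ s ∈ Y)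
    (n : ℕ) (s : Fin n → N) (hs : ∀ i, s i ∈ S) (hind : LinearIndependent k s) :
    LinearIndependent K s := by
  induction n with
  | zero => exact linearIndependent_empty_type
  | succ n ih =>
    have h1 := linearIndependent_finSucc.1 hind
    have h2 := ih (Fin.tail s) (fun i => hs _) h1.1
    refine linearIndependent_finSucc.2 ⟨h2, fun hmem => h1.2 ?_⟩
    obtain ⟨t, ht⟩ := (Submodule.mem_span_range_iff_exists_fun K).1 hmem
    obtain ⟨N', _, _, D', i, σ, hi, hσ, hσK, hdet⟩ := lemM D K hK n (Fin.tail s) h2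
    obtain ⟨Y, hY1, hY2⟩ := hS N' D' i hi
    let G : Matrix (Fin n) (Fin n) N' := Matrix.of (fun j l => σ j (Fin.tail s l))
    have hG : ∀ a b, G a b ∈ Y := fun a b => hY2 _ (hσ a) (hσK a) _ (hs _)
    let b : Fin n → N' := fun j => σ j (s 0)
    let tt : Fin n → N' := fun l => i (t l)
    have hGt : G.mulVec tt = b := by
      ext j
      simp only [Matrix.mulVec, dotProduct, G, b, Matrix.of_apply, tt]
      rw [← ht, map_sum]
      refine Finset.sum_congr rfl (fun l _ => ?_)
      rw [Subfield.smul_def, smul_eq_mul, map_mul, hσK j _ (t l).2, mul_comm]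
    have htt : tt = G⁻¹.mulVec b := by
      rw [← hGt, Matrix.mulVec_mulVec, Matrix.nonsing_inv_mul _ (IsUnit.mk0 _ hdet), Matrix.one_mulVec]
    have hk : ∀ l, (t l : N) ∈ k := by
      intro l
      refine hY1 _ (t l).2 ?_
      have : i (t l) = tt l := rfl
      rw [this, htt]
      simp only [Matrix.mulVec, dotProduct]
      exact sum_mem (fun a _ => mul_mem (mat_inv_mem Y G hG _ _) (hY2 _ (hσ a) (hσK a) _ (hs _)))
    rw [Submodule.mem_span_range_iff_exists_fun]
    refine ⟨fun l => ⟨t l, hk l⟩, ?_⟩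
    rw [← ht]
    rfl

/-- linear disjointness over k -/
def LD {N : Type u} [Field N] (k K : Subfield N) (S : Set N) : Prop :=
  ∀ (n : ℕ) (s : Fin n → N), (∀ i, s i ∈ S) → LinearIndependent k s → LinearIndependent K s

section
variable {N : Type u} [Field N] [CharZero N] {D : Derivation ℤ N N} {K k : Subfield N}

theorem map_eq_of_agree {N' : Type u} [Field N'] {σ i : N →+* N'} (hkK : k ≤ K) (h : ∀ x ∈ K, σ x = i x) :
    k.map σ = k.map i := by
  ext y
  constructor
  · rintro ⟨x, hx, rfl⟩; exact ⟨x, hx, (h x (hkK hx)).symm⟩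
  · rintro ⟨x, hx, rfl⟩; exact ⟨x, hx, (h x (hkK hx))⟩

theorem LD_Qf (hk : DSt D k) (hK : DSt D K) (hkK : k ≤ K) (hP : PP D K k) : LD k K (Qf D k) := by
  refine lindis D K k hK _ (fun N' _ _ D' i hi => ⟨Qf D' (k.map i), hP N' D' i hi, ?_⟩)
  intro σ hσ hσi s hs
  rw [← map_eq_of_agree hkK hσi]
  exact Qf_map hσ hk ⟨s, hs, rfl⟩

theorem LD_symm (hkK : k ≤ K) (Y : Subfield N) (hkY : k ≤ Y) (h : LD k K Y) : LD k Y K := by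
  classical
  intro n c hc hind
  rw [Fintype.linearIndependent_iff]
  intro y hy
  let V : Submodule k N := Submodule.span k (Set.range (fun i => (y i : N)))
  haveI : FiniteDimensional k V := FiniteDimensional.span_of_finite k (Set.finite_range _)
  let b := Module.finBasis k V
  have hVY : ∀ v ∈ V, v ∈ Y := by
    intro v hv
    induction hv using Submodule.span_induction with
    | mem x hx => obtain ⟨i, rfl⟩ := hx; exact (y i).2
    | zero => exact zero_mem _
    | add _ _ _ _ h1 h2 => exact add_mem h1 h2
    | smul a _ _ h1 => rw [Subfield.smul_def]; exact mul_mem (hkY a.2) h1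
  have hb : LinearIndependent k (fun i => (b i : N)) :=
    b.linearIndependent.map' V.subtype (Submodule.ker_subtype V)
  have hbK := h _ _ (fun i => hVY _ (b i).2) hb
  have hcV : ∀ i, (y i : N) ∈ V := fun i => Submodule.subset_span ⟨i, rfl⟩
  obtain ⟨r, hexp⟩ : ∃ r : Fin n → Fin _ → k, ∀ i, (y i : N) = ∑ j, (r i j : N) * (b j : N) := by
    refine ⟨fun i j => b.repr ⟨_, hcV i⟩ j, fun i => ?_⟩
    have := congrArg V.subtype (b.sum_repr ⟨_, hcV i⟩)
    simp only [map_sum, map_smul] at this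
    exact this.symm
  have hz : ∑ j, (∑ i, (r i j : N) * c i) * (b j : N) = 0 := by
    rw [← hy]
    simp only [Finset.sum_mul]
    rw [Finset.sum_comm]
    refine Finset.sum_congr rfl (fun i _ => ?_)
    rw [Subfield.smul_def, smul_eq_mul, hexp i, Finset.sum_mul]
    refine Finset.sum_congr rfl (fun j _ => by ring)
  have hz2 := Fintype.linearIndependent_iff.1 hbK (fun j =>
    ⟨∑ i, (r i j : N) * c i,
      sum_mem (fun i _ => mul_mem (hkK (r i j).2) (hc i))⟩) hz
  intro i
  have h3 : ∀ j, r i j = 0 := fun j => by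
    have h4 := congrArg (Subtype.val) (hz2 j)
    exact Fintype.linearIndependent_iff.1 hind (fun i => r i j) h4 i
  ext
  rw [hexp]
  simp [h3]

/-- an element of K algebraic over Y is algebraic over k if K, Y lin disjoint -/
theorem alg_of_LD (hkK : k ≤ K) (Y : Subfield N) (hkY : k ≤ Y) (h : LD k K Y) (x : N) (hx : x ∈ K)
    (hxa : IsAlgebraic Y x) : IsAlgebraic k x := by
  by_contra hna
  have htr : Transcendental k x := hna
  have hpow : LinearIndependent k (fun n : ℕ => x ^ n) := by
    have h1 := (Polynomial.basisMonomials k).linearIndependent.map' (Polynomial.aeval x).toLinearMap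
      (LinearMap.ker_eq_bot.2 (transcendental_iff_injective.1 htr))
    have e : (fun n : ℕ => x ^ n) = ⇑(Polynomial.aeval (R := k) x).toLinearMap ∘ ⇑(Polynomial.basisMonomials k) := by
      ext n
      simp
    rw [e]
    exact h1
  obtain ⟨p, hp, hpx⟩ := hxa
  have h2 := LD_symm hkK Y hkY h (p.natDegree + 1) (fun i => x ^ (i : ℕ)) (fun i => pow_mem hx _)
    (hpow.comp _ Fin.val_injective)
  rw [Polynomial.aeval_eq_sum_range, Finset.sum_range] at hpx
  have h3 := Fintype.linearIndependent_iff.1 h2 (fun i => p.coeff i) hpx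
  apply hp
  ext i
  rw [Polynomial.coeff_zero]
  by_cases hi : i < p.natDegree + 1
  · rw [h3 ⟨i, hi⟩]
  · rw [Polynomial.coeff_eq_zero_of_natDegree_lt (by omega)]

theorem Qa_inter (hk : DSt D k) (hK : DSt D K) (hkK : k ≤ K) (hP : PP D K k) (x : N) (hx : x ∈ K)
    (hxa : x ∈ Qa D k) : x ∈ k := by
  have h1 := alg_of_LD hkK (Qf D k) (le_Qf hk) (LD_Qf hk hK hkK hP) x hx (mem_Qa.1 hxa)
  have h2 := lin_le_Qf (isLin_alg D k hk x h1)
  have h3 := hP N D (RingHom.id N) (fun x => rfl) x hx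
  apply h3
  have : k.map (RingHom.id N) = k := by ext; simp
  rw [this]
  exact h2

theorem Qa_inter' (hk : DSt D k) (hK : DSt D K) (hkK : k ≤ K) (hP : PP D K k)
    {N' : Type u} [Field N'] [CharZero N'] {D' : Derivation ℤ N' N'} {i : N →+* N'} (hi : DHom D D' i)
    (x : N) (hx : x ∈ K) (hxa : i x ∈ Qa D' (k.map i)) : x ∈ k := by
  have h := Qa_inter (dst_map hi hk) (dst_map hi hK) (by rintro _ ⟨y, hy, rfl⟩; exact ⟨y, hkK hy, rfl⟩)
    (PP_map hP i hi) (i x) ⟨x, hx, rfl⟩ hxa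
  obtain ⟨y, hy, h⟩ := h
  rwa [← i.injective h]

theorem LD_Qa (hk : DSt D k) (hK : DSt D K) (hkK : k ≤ K) (hP : PP D K k) : LD k K (Qa D k) := by
  refine lindis D K k hK _ (fun N' _ _ D' i hi => ⟨Qa D' (k.map i), Qa_inter' hk hK hkK hP hi, ?_⟩)
  intro σ hσ hσi s hs
  rw [← map_eq_of_agree hkK hσi]
  exact Qa_map hσ hk ⟨s, hs, rfl⟩

end

end PVR



namespace PVR

theorem echelon {K ι : Type*} [Field K] [Fintype ι] (Z : Submodule K (ι → K)) :
    ∃ (q : ℕ) (a : Fin q → ι) (z : Fin q → ι → K), Function.Injective a ∧ (∀ l, z l ∈ Z) ∧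
      (∀ l m, z l (a m) = if l = m then 1 else 0) ∧ ∀ y ∈ Z, y = ∑ l, y (a l) • z l := by
  classical
  let φ : ι → Module.Dual K Z := fun j => (LinearMap.proj j).comp Z.subtype
  obtain ⟨κ, a0, ha0, hsp, hli⟩ := exists_linearIndependent' K φ
  haveI : Finite κ := Finite.of_injective a0 ha0
  obtain ⟨q, ⟨e⟩⟩ := Finite.exists_equiv_fin κ
  let a : Fin q → ι := a0 ∘ e.symm
  have hli' : LinearIndependent K (φ ∘ a) := hli.comp _ e.symm.injective
  have hsp' : Submodule.span K (Set.range (φ ∘ a)) = Submodule.span K (Set.range φ) := by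
    rw [← hsp]
    congr 1
    have : φ ∘ a = (φ ∘ a0) ∘ e.symm := rfl
    rw [this, e.symm.surjective.range_comp]
  have hz0 : ∀ z : Z, (∀ l, (z : ι → K) (a l) = 0) → z = 0 := by
    intro z hz
    have : ∀ f ∈ Submodule.span K (Set.range φ), f z = 0 := by
      intro f hf
      rw [← hsp'] at hf
      induction hf using Submodule.span_induction with
      | mem x hx => obtain ⟨l, rfl⟩ := hx; exact hz l
      | zero => rfl
      | add _ _ _ _ h1 h2 => rw [LinearMap.add_apply, h1, h2, add_zero]
      | smul c _ _ h1 => rw [LinearMap.smul_apply, h1, smul_zero]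
    ext j
    exact this _ (Submodule.subset_span ⟨j, rfl⟩)
  have htop : Submodule.span K (Set.range (φ ∘ a)) = ⊤ := by
    rw [hsp']
    rw [← Subspace.dualCoannihilator_dualAnnihilator_eq (W := Submodule.span K (Set.range φ)),
      ← Submodule.dualAnnihilator_bot]
    congr 1
    rw [eq_bot_iff]
    intro z hz
    rw [Submodule.mem_dualCoannihilator] at hz
    rw [Submodule.mem_bot]
    ext j
    exact hz _ (Submodule.subset_span ⟨j, rfl⟩)
  let T : Z →ₗ[K] (Fin q → K) := LinearMap.pi (φ ∘ a)
  have hTinj : Function.Injective T := by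
    rw [← LinearMap.ker_eq_bot, LinearMap.ker_eq_bot']
    intro z hz
    exact hz0 z (fun l => congrFun hz l)
  have hfr : Module.finrank K Z = Module.finrank K (Fin q → K) := by
    rw [← Subspace.dual_finrank_eq, Module.finrank_eq_card_basis (Module.Basis.mk hli' htop.ge)]
    simp
  have hTs : Function.Surjective T := (LinearMap.injective_iff_surjective_of_finrank_eq_finrank hfr).1 hTinj
  choose z hz using fun l : Fin q => hTs (Pi.single l 1)
  have hza : ∀ l m, (z l : ι → K) (a m) = if l = m then 1 else 0 := by
    intro l m
    have := congrFun (hz l) m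
    have h2 : T (z l) m = (z l : ι → K) (a m) := rfl
    rw [h2, Pi.single_apply] at this
    rw [this]
    simp [eq_comm]
  refine ⟨q, a, fun l => z l, ha0.comp e.symm.injective, fun l => (z l).2, hza, fun y hy => ?_⟩
  have h3 := hz0 (⟨y, hy⟩ - ∑ l, y (a l) • z l) (fun m => by
    simp [hza])
  have h4 := congrArg Subtype.val h3
  simp at h4
  exact sub_eq_zero.1 h4

theorem mat_der_mul {N l m n : Type*} [CommRing N] [Fintype m] (D : Derivation ℤ N N)
    (A : Matrix l m N) (B : Matrix m n N) :
    (A * B).map D = A.map D * B + A * B.map D := by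
  ext i j
  simp only [Matrix.map_apply, Matrix.mul_apply, map_sum, Matrix.add_apply, D.leibniz, smul_eq_mul,
    Finset.sum_add_distrib]
  rw [add_comm]
  congr 1
  exact Finset.sum_congr rfl (fun _ _ => mul_comm _ _)

section
variable {N : Type u} [Field N] [CharZero N] {D : Derivation ℤ N N} {K k : Subfield N}

theorem starstar (hk : DSt D k) (hkK : k ≤ K) (hP : PP D K k) {ι : Type*} [Fintype ι]
    (M : ι → ι → N) (hM : ∀ i j, M i j ∈ k) (Z : Submodule K (ι → K))
    (hZ : ∀ z ∈ Z, ∃ z2 ∈ Z, ∀ i, (z2 i : N) = D (z i) + ∑ j, M i j * z j)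
    (hZ0 : Z ≠ ⊥) : ∃ z ∈ Z, z ≠ 0 ∧ ∀ i, (z i : N) ∈ k := by
  classical
  obtain ⟨q, a, z, ha, hzZ, hza, hexp⟩ := echelon Z
  choose z2 hz2Z hz2 using fun l => hZ (z l) (hzZ l)
  let b : Matrix (Fin q) (Fin q) N := Matrix.of (fun l m => (z2 l (a m) : N))
  obtain ⟨N', _, _, D', i, X0, hi, hdet, hX0⟩ := generic D (-b.transpose)
  let X := X0.transpose
  have hXdet : X.det ≠ 0 := by rwa [Matrix.det_transpose]
  let Zm : Matrix (Fin q) ι N' := Matrix.of (fun l j => i (z l j))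
  have hX : X.map D' = - (X * b.map i) := by
    have := congrArg Matrix.transpose hX0
    rw [Matrix.transpose_mul] at this
    have e : X.map D' = (X0.map D').transpose := rfl
    rw [e, this]
    ext l m
    simp [Matrix.mul_apply, X]
  have hZm : ∀ l j, D' (Zm l j) = ∑ m, i (b l m) * Zm m j - ∑ j', i (M j j') * Zm l j' := by
    intro l j
    have h1 : D (z l j) = ∑ m, b l m * z m j - ∑ j', M j j' * z l j' := by
      rw [eq_sub_iff_add_eq, ← hz2]
      have := congrFun (hexp (z2 l) (hz2Z l)) j
      have := congrArg Subtype.val this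
      rw [this]
      simp [b]
    simp only [Zm, Matrix.of_apply, hi _, h1, map_sub, map_sum, map_mul]
  let Y := X * Zm
  have hkm := dst_map (D' := D') hi hk
  have hYder : ∀ l j, D' (Y l j) = ∑ j', (- i (M j j')) * Y l j' := by
    intro l j
    have h1 := congrFun (congrFun (mat_der_mul D' X Zm) l) j
    rw [hX] at h1
    have e : Zm.map D' = b.map i * Zm - Matrix.of (fun l j => ∑ j', i (M j j') * Zm l j') := by
      ext l j
      simp [Matrix.mul_apply, hZm]
    rw [e, Matrix.mul_sub, ← Matrix.mul_assoc, Matrix.neg_mul, add_sub_assoc', neg_add_cancel, zero_sub] at h1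
    have h2 : D' (Y l j) = ((X * Zm).map D') l j := rfl
    rw [h2, h1]
    simp only [Matrix.neg_apply, Matrix.mul_apply, Matrix.of_apply, Y, neg_mul, Finset.sum_neg_distrib,
      Finset.mul_sum]
    rw [Finset.sum_comm]
    congr 1
    refine Finset.sum_congr rfl (fun _ _ => Finset.sum_congr rfl (fun _ _ => by ring))
  have hYlin : ∀ l j, IsLin D' (k.map i) (Y l j) := fun l j =>
    isLin_fin D' _ hkm (fun j => Y l j) (fun j j' => - i (M j j'))
      (fun j j' => neg_mem ⟨_, hM j j', rfl⟩) (hYder l) j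
  have hXY : ∀ l m, X l m = Y l (a m) := by
    intro l m
    simp only [Y, Matrix.mul_apply, Zm, Matrix.of_apply, hza]
    rw [Finset.sum_eq_single m]
    · simp
    · intro m' _ hm'; simp [hm']
    · simp
  have hZmQ : ∀ l j, Zm l j ∈ Qf D' (k.map i) := by
    intro l j
    have : Zm = X⁻¹ * Y := by
      rw [← Matrix.mul_assoc, Matrix.nonsing_inv_mul _ (IsUnit.mk0 _ hXdet), Matrix.one_mul]
    rw [this, Matrix.mul_apply]
    refine sum_mem (fun m _ => mul_mem (mat_inv_mem _ _ (fun c d => ?_) _ _) (lin_le_Qf (hYlin _ _)))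
    rw [hXY]
    exact lin_le_Qf (hYlin _ _)
  have hzk : ∀ l j, (z l j : N) ∈ k := fun l j => hP N' D' i hi _ (z l j).2 (hZmQ l j)
  obtain ⟨y, hy, hy0⟩ := Submodule.exists_mem_ne_zero_of_ne_bot hZ0
  have hq : ∃ l : Fin q, True := by
    by_contra h
    push Not at h
    apply hy0
    rw [hexp y hy]
    exact Finset.sum_eq_zero (fun l _ => (h l).elim)
  obtain ⟨l, _⟩ := hq
  refine ⟨z l, hzZ l, fun h => ?_, hzk l⟩
  have := hza l l
  rw [h] at this
  simp at this

end
end PVR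



namespace PVR

theorem extract {k M ι : Type*} [Field k] [AddCommGroup M] [Module k M] [Finite ι] (x : ι → M) :
    ∃ (q : ℕ) (a : Fin q → ι) (r : ι → Fin q → k), LinearIndependent k (x ∘ a) ∧
      (∀ i, x i = ∑ m, r i m • x (a m)) ∧ ∀ m m', r (a m) m' = if m = m' then 1 else 0 := by
  classical
  obtain ⟨κ, a0, ha0, hsp, hli⟩ := exists_linearIndependent' k x
  haveI : Finite κ := Finite.of_injective a0 ha0
  obtain ⟨q, ⟨e⟩⟩ := Finite.exists_equiv_fin κ
  let a : Fin q → ι := a0 ∘ e.symm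
  have hli' : LinearIndependent k (x ∘ a) := hli.comp _ e.symm.injective
  have hsp' : Submodule.span k (Set.range (x ∘ a)) = Submodule.span k (Set.range x) := by
    rw [← hsp]
    congr 1
    have : x ∘ a = (x ∘ a0) ∘ e.symm := rfl
    rw [this, e.symm.surjective.range_comp]
  have h1 : ∀ i, ∃ r : Fin q → k, ∑ m, r m • (x ∘ a) m = x i := fun i =>
    (Submodule.mem_span_range_iff_exists_fun k).1 (by rw [hsp']; exact Submodule.subset_span ⟨i, rfl⟩)
  choose r hr using h1
  refine ⟨q, a, r, hli', fun i => (hr i).symm, fun m m' => ?_⟩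
  have h2 : ∑ l, (r (a m) l - if m = l then 1 else 0) • (x ∘ a) l = 0 := by
    simp only [sub_smul, Finset.sum_sub_distrib, hr]
    simp
  exact sub_eq_zero.1 (Fintype.linearIndependent_iff.1 hli' _ h2 m')

section
variable {N : Type u} [Field N] [CharZero N] {D : Derivation ℤ N N} {K k L : Subfield N}

theorem LD_functional (hkK : k ≤ K) (hLD : LD k K L) {ι α : Type*} [Fintype α] (lam : α → N)
    (hl : ∀ a, lam a ∈ L) (x : α → ι → N) (hx : ∀ a i, x a i ∈ K)
    (h : ∀ i, ∑ a, lam a * x a i = 0) (f : (ι → N) →ₗ[k] k) : ∑ a, lam a * (f (x a) : N) = 0 := by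
  obtain ⟨q, a, r, hli, hex, -⟩ := extract (k := k) lam
  have hK := Fintype.linearIndependent_iff.1 (hLD q _ (fun i => hl (a i)) hli)
  have h1 : ∀ m, ∑ c, r c m • x c = 0 := by
    intro m
    ext i
    have h2 : ∑ m, (⟨∑ c, (r c m : N) * x c i, sum_mem (fun c _ => mul_mem (hkK (r c m).2) (hx c i))⟩ : K) •
        (lam ∘ a) m = 0 := by
      rw [← h i]
      simp only [Subfield.smul_def, smul_eq_mul, Finset.sum_mul]
      rw [Finset.sum_comm]
      refine Finset.sum_congr rfl (fun c _ => ?_)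
      conv_rhs => rw [hex c]
      rw [Finset.sum_mul]
      refine Finset.sum_congr rfl (fun m _ => ?_)
      rw [Subfield.smul_def, smul_eq_mul, Function.comp_apply]; ring
    have h3 := congrArg Subtype.val (hK _ h2 m)
    simp only [Finset.sum_apply, Pi.smul_apply, Subfield.smul_def, smul_eq_mul]
    exact h3
  have h2 : ∀ m, ∑ c, (r c m : N) * (f (x c) : N) = 0 := by
    intro m
    have := congrArg (fun y : k => (y : N)) (congrArg f (h1 m))
    simpa using this
  have h3 : ∑ c, lam c * (f (x c) : N) = ∑ m, lam (a m) * ∑ c, (r c m : N) * (f (x c) : N) := by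
    simp only [Finset.mul_sum]
    rw [Finset.sum_comm]
    refine Finset.sum_congr rfl (fun c _ => ?_)
    conv_lhs => rw [hex c]
    rw [Finset.sum_mul]
    refine Finset.sum_congr rfl (fun m _ => ?_)
    rw [Subfield.smul_def, smul_eq_mul]; ring
  rw [h3]
  simp [h2]

/-- starstar, with N-valued vectors: k-independent families of vectors over K, stable under ∇, are K-independent -/
theorem indep_of_stable (hk : DSt D k) (hK : DSt D K) (hkK : k ≤ K) (hP : PP D K k) {ι : Type*} [Fintype ι] (G : ι → ι → N)
    (p : ℕ) (e : Fin p → ι → N) (he : ∀ m i, e m i ∈ K) (hind : LinearIndependent k e)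
    (c : Fin p → Fin p → N) (hc : ∀ m l, c m l ∈ k)
    (hD : ∀ m i, D (e m i) - ∑ j, G i j * e m j = ∑ l, c m l * e l i) : LinearIndependent K e := by
  by_contra hni
  let Z : Submodule K (Fin p → K) := LinearMap.ker (Fintype.linearCombination K e)
  have hmem : ∀ z : Fin p → K, z ∈ Z ↔ ∀ i, ∑ m, (z m : N) * e m i = 0 := by
    intro z
    rw [LinearMap.mem_ker, Fintype.linearCombination_apply, funext_iff]
    simp [Subfield.smul_def]
  have hZ0 : Z ≠ ⊥ := by
    intro h
    apply hni
    rw [Fintype.linearIndependent_iff]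
    intro g hg
    have : g ∈ Z := by rw [LinearMap.mem_ker, Fintype.linearCombination_apply, hg]
    rw [h, Submodule.mem_bot] at this
    intro i; rw [this]; rfl
  obtain ⟨z, hz, hz0, hzk⟩ := starstar hk hkK hP (fun l m => c m l) (fun l m => hc m l) Z (by
    intro z hz
    refine ⟨fun l => ⟨D (z l) + ∑ m, c m l * z m,
      add_mem (hK _ (z l).2) (sum_mem (fun m _ => mul_mem (hkK (hc m l)) (z m).2))⟩, ?_, fun l => rfl⟩
    rw [hmem] at hz ⊢
    intro i
    have h1 := congrArg D (hz i)
    rw [map_sum, map_zero] at h1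
    simp only [D.leibniz, smul_eq_mul, Finset.sum_add_distrib] at h1
    have h2 : ∀ m, D (e m i) = ∑ j, G i j * e m j + ∑ l, c m l * e l i := fun m => by rw [← hD]; ring
    simp only [h2, mul_add, Finset.sum_add_distrib] at h1
    have h3 : ∑ m, (z m : N) * ∑ j, G i j * e m j = 0 := by
      have : ∑ m, (z m : N) * ∑ j, G i j * e m j = ∑ j, G i j * ∑ m, (z m : N) * e m j := by
        simp only [Finset.mul_sum]
        rw [Finset.sum_comm]
        exact Finset.sum_congr rfl (fun _ _ => Finset.sum_congr rfl (fun _ _ => by ring))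
      rw [this]; simp [hz]
    rw [h3, zero_add] at h1
    rw [← h1]
    simp only [add_mul, Finset.sum_add_distrib, Finset.sum_mul, Finset.mul_sum]
    rw [add_comm]
    congr 1
    · rw [Finset.sum_comm]
      exact Finset.sum_congr rfl (fun _ _ => Finset.sum_congr rfl (fun _ _ => by ring))
    · exact Finset.sum_congr rfl (fun _ _ => by ring)) hZ0
  apply hz0
  rw [hmem] at hz
  ext m
  have h4 := Fintype.linearIndependent_iff.1 hind (fun m => ⟨z m, hzk m⟩) (by
    ext i
    simpa [Subfield.smul_def] using hz i) m
  simpa using congrArg Subtype.val h4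

/-- linear independence of vectors passes to larger field -/
theorem indep_up {ι : Type*} [Fintype ι] {κ : Type*} [Finite κ] (F : Subfield N) (e : κ → ι → N)
    (he : ∀ m i, e m i ∈ F) (h : LinearIndependent F e) : LinearIndependent N e := by
  classical
  let e' : κ → ι → F := fun m i => ⟨e m i, he m i⟩
  have h1 : LinearIndependent F e' := by
    refine LinearIndependent.of_comp ((Algebra.linearMap F N).compLeft ι) ?_
    exact h
  exact (linearIndependent_algebraMap_comp_iff (R := F) (S := N) (v := e')).2 h1

theorem jl_core (hk : DSt D k) (hK : DSt D K) (hL : DSt D L) (hkK : k ≤ K) (hkL : k ≤ L) (hP : PP D K k) (hLD : LD k K L)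
    {ι : Type*} [Fintype ι] (G : ι → ι → N) (hG : ∀ i j, G i j ∈ K)
    {σ : Type*} [Fintype σ] (v : σ → ι → N) (hv : ∀ s, v s ∈ Submodule.span L {e : ι → N | ∀ i, e i ∈ K})
    (hind : LinearIndependent L v) (A : σ → σ → N) (hA : ∀ s t, A s t ∈ L)
    (hD : ∀ s i, D (v s i) - ∑ j, G i j * v s j = ∑ t, A s t * v t i) : LinearIndependent N v := by
  classical
  obtain ⟨p0, e0, l0, he0, hl0, hv0⟩ : ∃ (p : ℕ) (e : Fin p → ι → N) (l : σ → Fin p → N), (∀ m i, e m i ∈ K) ∧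
      (∀ s m, l s m ∈ L) ∧ ∀ s i, v s i = ∑ m, l s m * e m i := by
    have h1 : ∀ s, ∃ T : Finset (ι → N), (T : Set (ι → N)) ⊆ {e | ∀ i, e i ∈ K} ∧ v s ∈ Submodule.span L (T : Set (ι → N)) :=
      fun s => Submodule.mem_span_finite_of_mem_span (hv s)
    choose T hT hvT using h1
    let U : Finset (ι → N) := Finset.univ.biUnion T
    have h2 : ∀ s, ∃ f : (ι → N) → L, ∑ a ∈ U, f a • a = v s := fun s => by
      have : v s ∈ Submodule.span L (U : Set (ι → N)) :=
        Submodule.span_mono (by exact_mod_cast Finset.subset_biUnion_of_mem T (Finset.mem_univ s)) (hvT s)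
      obtain ⟨f, -, hf⟩ := Submodule.mem_span_finset.1 this
      exact ⟨f, hf⟩
    choose f hf using h2
    let E := U.equivFin
    refine ⟨U.card, fun m => (E.symm m : ι → N), fun s m => f s (E.symm m), fun m i => ?_, fun s m => (f s _).2, fun s i => ?_⟩
    · have := (E.symm m).2
      obtain ⟨s, -, hs⟩ := Finset.mem_biUnion.1 this
      exact hT s hs i
    · rw [← hf s, ← Finset.sum_coe_sort, Finset.sum_apply]
      rw [← E.symm.sum_comp]
      rfl
  -- make e independent
  obtain ⟨p1, a1, r1, hli1, hex1, -⟩ := extract (k := k) e0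
  let e1 : Fin p1 → ι → N := e0 ∘ a1
  let l1 : σ → Fin p1 → N := fun s m => ∑ j, l0 s j * r1 j m
  have hl1 : ∀ s m, l1 s m ∈ L := fun s m => sum_mem (fun j _ => mul_mem (hl0 s j) (hkL (r1 j m).2))
  have hv1 : ∀ s i, v s i = ∑ m, l1 s m * e1 m i := by
    intro s i
    rw [hv0]
    simp only [l1, Finset.sum_mul]
    rw [Finset.sum_comm]
    refine Finset.sum_congr rfl (fun j _ => ?_)
    have := congrFun (hex1 j) i
    rw [this, Finset.sum_apply, Finset.mul_sum]
    refine Finset.sum_congr rfl (fun m _ => ?_)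
    simp only [Pi.smul_apply, Subfield.smul_def, smul_eq_mul, e1, Function.comp_apply]; ring
  -- make columns independent
  obtain ⟨p, a, r, hli, hex, hra⟩ := extract (k := k) (fun m : Fin p1 => fun s => l1 s m)
  let l : σ → Fin p → N := fun s m => l1 s (a m)
  let e : Fin p → ι → N := fun m i => ∑ j, r j m * e1 j i
  have he : ∀ m i, e m i ∈ K := fun m i => sum_mem (fun j _ => mul_mem (hkK (r j m).2) (he0 _ _))
  have hvl : ∀ s i, v s i = ∑ m, l s m * e m i := by
    intro s i
    rw [hv1]
    simp only [e, Finset.mul_sum]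
    rw [Finset.sum_comm]
    refine Finset.sum_congr rfl (fun j _ => ?_)
    have := congrFun (hex j) s
    rw [this, Finset.sum_apply, Finset.sum_mul]
    refine Finset.sum_congr rfl (fun m _ => ?_)
    simp only [Pi.smul_apply, Subfield.smul_def, smul_eq_mul, l]; ring
  have hlL : ∀ s m, l s m ∈ L := fun s m => hl1 s _
  have hcol : ∀ c : Fin p → k, (∀ s, ∑ m, (c m : N) * l s m = 0) → ∀ m, c m = 0 := by
    intro c hc
    refine Fintype.linearIndependent_iff.1 hli c ?_
    ext s
    simpa [Subfield.smul_def] using hc s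
  have hek : LinearIndependent k e := by
    rw [Fintype.linearIndependent_iff]
    intro g hg m
    have h1 := Fintype.linearIndependent_iff.1 hli1 (fun j => ∑ m, g m * r j m) (by
      rw [← hg]
      ext i
      simp only [Finset.sum_apply, Pi.smul_apply, Subfield.smul_def, smul_eq_mul, e, Finset.mul_sum]
      rw [Finset.sum_comm]
      refine Finset.sum_congr rfl (fun j _ => ?_)
      push_cast
      rw [Finset.sum_mul]
      exact Finset.sum_congr rfl (fun _ _ => by simp only [e1, Function.comp_apply]; ring)) (a m)
    simp only [hra] at h1
    simpa using h1
  -- nabla e in span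
  let ne : Fin p → ι → N := fun m i => D (e m i) - ∑ j, G i j * e m j
  have hneK : ∀ m i, ne m i ∈ K := fun m i => sub_mem (hK _ (he m i)) (sum_mem (fun j _ => mul_mem (hG i j) (he m j)))
  have hne : ∀ m, ne m ∈ Submodule.span k (Set.range e) := by
    by_contra hcon
    push Not at hcon
    obtain ⟨m0, hm0⟩ := hcon
    obtain ⟨f, hf, hfe⟩ := Submodule.exists_le_ker_of_notMem hm0
    have hfe' : ∀ m, f (e m) = 0 := fun m => hfe (Submodule.subset_span ⟨m, rfl⟩)
    have key : ∀ s, ∑ m, l s m * (f (ne m) : N) = 0 := by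
      intro s
      have h := LD_functional hkK hLD (α := Fin p ⊕ Fin p) (Sum.elim (l s) (fun m => D (l s m) - ∑ t, A s t * l t m))
        (by
          rintro (m | m)
          · exact hlL s m
          · exact sub_mem (hL _ (hlL s m)) (sum_mem (fun t _ => mul_mem (hA s t) (hlL t m))))
        (Sum.elim ne e) (by rintro (m | m) i; exacts [hneK m i, he m i]) (by
          intro i
          simp only [Fintype.sum_sum_type, Sum.elim_inl, Sum.elim_inr]
          have h1 := hD s i
          simp only [hvl, map_sum, D.leibniz, smul_eq_mul] at h1
          simp only [ne, mul_sub, sub_mul, Finset.sum_sub_distrib]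
          rw [Finset.sum_add_distrib] at h1
          have h2 : ∑ m, l s m * ∑ j, G i j * e m j = ∑ j, G i j * ∑ m, l s m * e m j := by
            simp only [Finset.mul_sum]
            rw [Finset.sum_comm]
            exact Finset.sum_congr rfl (fun _ _ => Finset.sum_congr rfl (fun _ _ => by ring))
          have h3 : ∑ m, (∑ t, A s t * l t m) * e m i = ∑ t, A s t * ∑ m, l t m * e m i := by
            simp only [Finset.mul_sum, Finset.sum_mul]
            rw [Finset.sum_comm]
            exact Finset.sum_congr rfl (fun _ _ => Finset.sum_congr rfl (fun _ _ => by ring))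
          rw [h2, h3, ← h1]
          have h4 : ∑ m, D (l s m) * e m i = ∑ m, e m i * D (l s m) :=
            Finset.sum_congr rfl (fun _ _ => by ring)
          rw [h4]; ring) f
      simpa [Fintype.sum_sum_type, hfe'] using h
    apply hf
    exact hcol (fun m => f (ne m)) (fun s => by rw [← key s]; exact Finset.sum_congr rfl (fun _ _ => mul_comm _ _)) m0
  have hne2 : ∀ m, ∃ c : Fin p → k, ∑ l, c l • e l = ne m := fun m =>
    (Submodule.mem_span_range_iff_exists_fun k).1 (hne m)
  choose c hc using hne2
  have heK : LinearIndependent K e := indep_of_stable hk hK hkK hP G p e he hek (fun m l => c m l) (fun m l => (c m l).2)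
    (by
      intro m i
      have := congrFun (hc m) i
      rw [Finset.sum_apply] at this
      exact this.symm)
  have heN := Fintype.linearIndependent_iff.1 (indep_up K e he heK)
  have hlind : LinearIndependent L l := by
    rw [Fintype.linearIndependent_iff] at hind ⊢
    intro g hg
    refine hind g ?_
    ext i
    simp only [Finset.sum_apply, Pi.smul_apply, Subfield.smul_def, smul_eq_mul, hvl, Finset.mul_sum]
    rw [Finset.sum_comm]
    refine Finset.sum_eq_zero (fun m _ => ?_)
    have := congrFun hg m
    simp only [Finset.sum_apply, Pi.smul_apply, Subfield.smul_def, smul_eq_mul, Pi.zero_apply] at this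
    calc _ = (∑ s, (g s : N) * l s m) * e m i := by
          rw [Finset.sum_mul]; exact Finset.sum_congr rfl (fun _ _ => by ring)
      _ = 0 := by rw [this, zero_mul]
  have hlN := Fintype.linearIndependent_iff.1 (indep_up L l hlL hlind)
  rw [Fintype.linearIndependent_iff]
  intro g hg
  refine hlN g ?_
  ext m
  rw [Finset.sum_apply]
  refine heN (fun m => ∑ s, (g s • l s) m) ?_ m
  rw [← hg]
  ext i
  simp only [Finset.sum_apply, Pi.smul_apply, smul_eq_mul, hvl, Finset.mul_sum, Finset.sum_mul]
  rw [Finset.sum_comm]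
  exact Finset.sum_congr rfl (fun _ _ => Finset.sum_congr rfl (fun _ _ => by ring))

end
end PVR



namespace PVR

section
variable {N : Type u} [Field N] [CharZero N] {D : Derivation ℤ N N} {K k L : Subfield N}

theorem adjoin_le_span (S : Submonoid N) (F : Subfield N) (x : N) (hx : x ∈ Algebra.adjoin F (S : Set N)) :
    x ∈ Submodule.span F (S : Set N) := by
  have := Algebra.adjoin_eq_span F (S : Set N)
  rw [Submonoid.closure_eq] at this
  rw [← this]; exact hx

theorem sup_frac (K L : Subfield N) (x : N) (hx : x ∈ K ⊔ L) :
    ∃ w ∈ Algebra.adjoin L (K : Set N), w ≠ 0 ∧ w * x ∈ Algebra.adjoin L (K : Set N) := by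
  have h1 : K ⊔ L = Subfield.closure ((K : Set N) ∪ L) := by
    rw [Subfield.closure_union, Subfield.closure_eq, Subfield.closure_eq]
  rw [h1] at hx
  obtain ⟨u, hu, v, hv, rfl⟩ := Subfield.mem_closure_iff.1 hx
  have h2 : Subring.closure ((K : Set N) ∪ L) ≤ (Algebra.adjoin L (K : Set N)).toSubring := by
    rw [Subring.closure_le]
    rintro y (hy | hy)
    · exact Algebra.subset_adjoin hy
    · exact (Algebra.adjoin L (K : Set N)).algebraMap_mem ⟨y, hy⟩
  by_cases h0 : v = 0
  · exact ⟨1, one_mem _, one_ne_zero, by simp [h0]⟩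
  · exact ⟨v, h2 hv, h0, by rw [mul_div_cancel₀ _ h0]; exact h2 hu⟩

theorem dst_adjoin (hK : DSt D K) (hL : DSt D L) (x : N) (hx : x ∈ Algebra.adjoin L (K : Set N)) :
    D x ∈ Algebra.adjoin L (K : Set N) := by
  induction hx using Algebra.adjoin_induction with
  | mem x hx => exact Algebra.subset_adjoin (hK x hx)
  | algebraMap r => exact (Algebra.adjoin L (K : Set N)).algebraMap_mem ⟨_, hL r r.2⟩
  | add x y _ _ h1 h2 => rw [map_add]; exact add_mem h1 h2
  | mul x y hx hy h1 h2 =>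
    rw [D.leibniz]; exact add_mem (mul_mem hx h2) (mul_mem hy h1)

open IntermediateField.algebraAdjoinAdjoin in
theorem mult_in_KR (hk : DSt D k) (hkK : k ≤ K) (ρ : N) (h0 : ρ ≠ 0)
    (hρ : ρ ∈ Algebra.adjoin (Qa D k) (K : Set N)) :
    ∃ t ∈ Algebra.adjoin (Qa D k) (K : Set N), ρ * t ≠ 0 ∧ ρ * t ∈ Submodule.span K {y | IsLin D k y} := by
  let Ls := {y | IsLin D k y}
  let F1 := IntermediateField.adjoin K Ls
  let R1 := Algebra.adjoin K Ls
  have hF1 : Qf D k ≤ F1.toSubfield := by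
    unfold Qf
    rw [Subfield.closure_le]
    exact fun y hy => IntermediateField.subset_adjoin K Ls hy
  have hKF : K ≤ F1.toSubfield := fun y hy => F1.algebraMap_mem ⟨y, hy⟩
  have halg : IsAlgebraic F1 ρ := by
    rw [← mem_algebraicClosure_iff]
    induction hρ using Algebra.adjoin_induction with
    | mem x hx => exact (algebraicClosure F1 N).algebraMap_mem ⟨x, hKF hx⟩
    | algebraMap r =>
      rw [mem_algebraicClosure_iff]
      exact isAlgebraic_subfield_mono hF1 (mem_Qa.1 r.2)
    | add x y hx hy h1 h2 =>
      by_cases hx0 : x = 0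
      · subst hx0
        rw [zero_add] at h0 ⊢; exact h2 h0
      by_cases hy0 : y = 0
      · subst hy0
        rw [add_zero] at h0 ⊢; exact h1 h0
      exact add_mem (h1 hx0) (h2 hy0)
    | mul x y _ _ h1 h2 => exact mul_mem (h1 (left_ne_zero_of_mul h0)) (h2 (right_ne_zero_of_mul h0))
  have halg2 : IsAlgebraic R1 ρ := (IsFractionRing.isAlgebraic_iff R1 F1 N).2 halg
  obtain ⟨q, hq0, hq⟩ := halg2.exists_nonzero_coeff_and_aeval_eq_zero (mem_nonZeroDivisors_of_ne_zero h0)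
  have hLR : ∀ y, y ∈ R1 → y ∈ Algebra.adjoin (Qa D k) (K : Set N) := by
    intro y hy
    induction hy using Algebra.adjoin_induction with
    | mem x hx => exact (Algebra.adjoin (Qa D k) (K : Set N)).algebraMap_mem ⟨x, Qf_le_Qa (lin_le_Qf hx)⟩
    | algebraMap r => exact Algebra.subset_adjoin r.2
    | add x y _ _ h1 h2 => exact add_mem h1 h2
    | mul x y _ _ h1 h2 => exact mul_mem h1 h2
  have he : ρ * (- Polynomial.aeval ρ q.divX) = (q.coeff 0 : N) := by
    have h1 := congrArg (Polynomial.aeval ρ) (Polynomial.divX_mul_X_add q)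
    rw [hq, map_add, map_mul, Polynomial.aeval_X, Polynomial.aeval_C] at h1
    have h2 : algebraMap R1 N (q.coeff 0) = (q.coeff 0 : N) := rfl
    rw [h2] at h1
    linear_combination -h1
  refine ⟨- Polynomial.aeval ρ q.divX, neg_mem ?_, ?_, ?_⟩
  · rw [Polynomial.aeval_eq_sum_range]
    refine sum_mem (fun i _ => ?_)
    rw [Algebra.smul_def]
    exact mul_mem (hLR _ (q.divX.coeff i).2) (pow_mem hρ _)
  · rw [he]
    intro h
    exact hq0 (Subtype.ext h)
  · rw [he]
    exact adjoin_le_span (Lin D k hk).toSubmonoid K _ (q.coeff 0).2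

theorem fd_of_span (ρ : N) (hρ : ρ ∈ Submodule.span K {y | IsLin D k y}) :
    ∃ W : Submodule k N, W.FG ∧ (∀ w ∈ W, D w ∈ W) ∧ ρ ∈ Submodule.span K (W : Set N) := by
  induction hρ using Submodule.span_induction with
  | mem x hx => obtain ⟨V, h1, h2, h3⟩ := hx; exact ⟨V, h1, h2, Submodule.subset_span h3⟩
  | zero => exact ⟨⊥, Submodule.fg_bot, by simp, zero_mem _⟩
  | add x y _ _ h1 h2 =>
    obtain ⟨V1, a1, b1, c1⟩ := h1
    obtain ⟨V2, a2, b2, c2⟩ := h2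
    refine ⟨V1 ⊔ V2, a1.sup a2, ?_, add_mem ?_ ?_⟩
    · intro w hw
      obtain ⟨y, hy, z, hz, rfl⟩ := Submodule.mem_sup.1 hw
      rw [map_add]
      exact add_mem (Submodule.mem_sup_left (b1 y hy)) (Submodule.mem_sup_right (b2 z hz))
    · exact Submodule.span_mono (fun z hz => Submodule.mem_sup_left hz) c1
    · exact Submodule.span_mono (fun z hz => Submodule.mem_sup_right hz) c2
  | smul a x _ h1 =>
    obtain ⟨V1, a1, b1, c1⟩ := h1
    exact ⟨V1, a1, b1, Submodule.smul_mem _ _ c1⟩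

theorem JL (hk : DSt D k) (hK : DSt D K) (hkK : k ≤ K) (hP : PP D K k)
    {ι : Type*} [Fintype ι] (G : ι → ι → N) (hG : ∀ i j, G i j ∈ K)
    {σ : Type*} [Fintype σ] (v : σ → ι → N) (hv : ∀ s i, v s i ∈ K ⊔ Qa D k)
    (hind : LinearIndependent (Qa D k) v) (A : σ → σ → N) (hA : ∀ s t, A s t ∈ Qa D k)
    (hD : ∀ s i, D (v s i) - ∑ j, G i j * v s j = ∑ t, A s t * v t i) : LinearIndependent N v := by
  classical
  let L := Qa D k
  have hkL : k ≤ L := le_Qa hk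
  have hL : DSt D L := dst_Qa
  have hLD : LD k K L := LD_Qa hk hK hkK hP
  refine jl_core hk hK hL hkK hkL hP hLD G hG v ?_ hind A hA hD
  let S := Algebra.adjoin L (K : Set N)
  have hSK : ∀ x ∈ K, x ∈ S := fun x hx => Algebra.subset_adjoin hx
  have hSL : ∀ x ∈ L, x ∈ S := fun x hx => S.algebraMap_mem ⟨x, hx⟩
  suffices h : ∀ s i, v s i ∈ S by
    intro s
    have : v s = ∑ i, Pi.single i (v s i) := (Finset.univ_sum_single (v s)).symm
    rw [this]
    refine sum_mem (fun i _ => ?_)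
    have h1 := adjoin_le_span K.toSubmonoid L _ (h s i)
    have h2 := Submodule.mem_map_of_mem (f := LinearMap.single L (fun _ : ι => N) i) h1
    rw [Submodule.map_span] at h2
    refine Submodule.span_mono ?_ h2
    rintro _ ⟨x, hx, rfl⟩ j
    simp only [LinearMap.single_apply, Pi.single_apply]
    split_ifs
    · exact hx
    · exact zero_mem _
  -- common denominators
  choose w0 hw0 hw00 hw0v using fun (c : σ × ι) => sup_frac K L (v c.1 c.2) (hv c.1 c.2)
  let ρ0 : N := ∏ c, w0 c
  have hρ0 : ρ0 ≠ 0 := Finset.prod_ne_zero_iff.2 (fun c _ => hw00 c)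
  have hρ0S : ρ0 ∈ S := prod_mem (fun c _ => hw0 c)
  have hρ0v : ∀ s i, ρ0 * v s i ∈ S := by
    intro s i
    have : ρ0 = (∏ c ∈ Finset.univ.erase (s, i), w0 c) * w0 (s, i) := (Finset.prod_erase_mul _ _ (Finset.mem_univ _)).symm
    rw [this, mul_assoc]
    exact mul_mem (prod_mem (fun c _ => hw0 c)) (hw0v (s, i))
  obtain ⟨t, htS, hne, hsp⟩ := mult_in_KR hk hkK ρ0 hρ0 hρ0S
  obtain ⟨W, hWfg, hWD, hW⟩ := fd_of_span _ hsp
  haveI : FiniteDimensional k W := Module.Finite.iff_fg.2 hWfg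
  let b := Module.finBasis k W
  let w : Fin (Module.finrank k W) → N := fun i => b i
  have hwexp : ∀ x ∈ W, ∃ c : Fin (Module.finrank k W) → k, x = ∑ i, (c i : N) * w i := by
    intro x hx
    refine ⟨fun i => b.repr ⟨x, hx⟩ i, ?_⟩
    have := congrArg W.subtype (b.sum_repr ⟨x, hx⟩)
    simp only [map_sum, map_smul] at this
    exact this.symm
  choose M hM using fun i => hwexp (D (w i)) (hWD _ (b i).2)
  have hwlin : ∀ i, IsLin D k (w i) := fun i => ⟨W, hWfg, hWD, (b i).2⟩
  have hwind : LinearIndependent k w := b.linearIndependent.map' W.subtype (Submodule.ker_subtype W)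
  have hspan : ρ0 * t ∈ Submodule.span K (Set.range w) := by
    refine Submodule.span_le.2 ?_ hW
    intro x hx
    obtain ⟨c, hc⟩ := hwexp x hx
    rw [hc]
    refine sum_mem (fun i _ => ?_)
    exact Submodule.smul_mem _ (⟨c i, hkK (c i).2⟩ : K) (Submodule.subset_span ⟨i, rfl⟩)
  let Z : Submodule K (Fin (Module.finrank k W) → K) :=
    { carrier := {z | ∀ s i, (∑ m, (z m : N) * w m) * v s i ∈ S}
      zero_mem' := by intro s i; simp
      add_mem' := by
        intro a b ha hb s i
        have : (∑ m, ((a + b) m : N) * w m) * v s i = (∑ m, (a m : N) * w m) * v s i + (∑ m, (b m : N) * w m) * v s i := by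
          simp [add_mul, Finset.sum_add_distrib]
        rw [this]; exact add_mem (ha s i) (hb s i)
      smul_mem' := by
        intro c a ha s i
        have : (∑ m, ((c • a) m : N) * w m) * v s i = c * ((∑ m, (a m : N) * w m) * v s i) := by
          simp [Finset.mul_sum, mul_assoc, Finset.sum_mul]
        rw [this]; exact mul_mem (hSK _ c.2) (ha s i) }
  obtain ⟨z, hzZ, hz0, hzk⟩ := starstar hk hkK hP (fun i j => (M j i : N)) (fun i j => (M j i).2) Z (by
    intro z hz
    refine ⟨fun i => ⟨D (z i) + ∑ j, (M j i : N) * z j, add_mem (hK _ (z i).2)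
      (sum_mem (fun j _ => mul_mem (hkK (M j i).2) (z j).2))⟩, ?_, fun i => rfl⟩
    intro s i
    set x := ∑ m, (z m : N) * w m with hx
    have h1 : ∑ m, (D (z m) + ∑ j, (M j m : N) * z j) * w m = D x := by
      rw [hx, map_sum]
      simp only [D.leibniz, smul_eq_mul, add_mul, Finset.sum_add_distrib]
      rw [add_comm]
      congr 1
      · simp only [hM, Finset.mul_sum, Finset.sum_mul]
        rw [Finset.sum_comm]
        exact Finset.sum_congr rfl (fun _ _ => Finset.sum_congr rfl (fun _ _ => by ring))
      · exact Finset.sum_congr rfl (fun _ _ => by ring)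
    show (∑ m, (D (z m) + ∑ j, (M j m : N) * z j) * w m) * v s i ∈ S
    rw [h1]
    have h2 : D x * v s i = D (x * v s i) - (∑ j, G i j * (x * v s j) + ∑ t, A s t * (x * v t i)) := by
      have h3 := hD s i
      have h4 : ∑ j, G i j * (x * v s j) = x * ∑ j, G i j * v s j := by
        rw [Finset.mul_sum]; exact Finset.sum_congr rfl (fun _ _ => by ring)
      have h5 : ∑ t, A s t * (x * v t i) = x * ∑ t, A s t * v t i := by
        rw [Finset.mul_sum]; exact Finset.sum_congr rfl (fun _ _ => by ring)
      rw [h4, h5, D.leibniz, smul_eq_mul, smul_eq_mul, ← h3]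
      ring
    rw [h2]
    refine sub_mem (dst_adjoin hK hL _ (hz s i)) (add_mem (sum_mem (fun j _ => ?_)) (sum_mem (fun j _ => ?_)))
    · exact mul_mem (hSK _ (hG i j)) (hz s j)
    · exact mul_mem (hSL _ (hA s j)) (hz j i)) (by
    intro hbot
    obtain ⟨c, hc⟩ := (Submodule.mem_span_range_iff_exists_fun K).1 hspan
    have : c ∈ Z := by
      intro s i
      have e : ∑ m, (c m : N) * w m = ρ0 * t := hc
      rw [e]
      have : ρ0 * t * v s i = t * (ρ0 * v s i) := by ring
      rw [this]
      exact mul_mem htS (hρ0v s i)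
    rw [hbot, Submodule.mem_bot] at this
    apply hne
    rw [← hc, this]
    simp)
  set r0 := ∑ m, (z m : N) * w m with hr0
  have hr0L : r0 ∈ L := sum_mem (fun m _ => mul_mem (hkL (hzk m)) (Qf_le_Qa (lin_le_Qf (hwlin m))))
  have hr00 : r0 ≠ 0 := by
    intro h
    apply hz0
    ext m
    have := Fintype.linearIndependent_iff.1 hwind (fun m => ⟨z m, hzk m⟩) h m
    simpa using congrArg Subtype.val this
  intro s i
  have : v s i = r0⁻¹ * (r0 * v s i) := by field_simp
  rw [this]
  exact mul_mem (hSL _ (inv_mem hr0L)) (hzZ s i)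

/-- scalar version -/
theorem JLs (hk : DSt D k) (hK : DSt D K) (hkK : k ≤ K) (hP : PP D K k) (f : N) (hf : f ∈ K ⊔ Qa D k)
    (hfl : IsLin D (Qa D k) f) : f ∈ Qa D k := by
  by_contra hfn
  obtain ⟨V0, hfg, hVD, hfV⟩ := hfl
  let L := Qa D k
  have hL : DSt D L := dst_Qa
  let V1 : Submodule L N := V0 ⊔ Submodule.span L {1}
  let M : Submodule L N :=
    { carrier := ((K ⊔ L : Subfield N) : Set N)
      zero_mem' := zero_mem _
      add_mem' := fun h1 h2 => add_mem h1 h2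
      smul_mem' := fun c x hx => mul_mem ((le_sup_right : L ≤ K ⊔ L) c.2) hx }
  let V := V1 ⊓ M
  have hV1fg : V1.FG := hfg.sup (Submodule.fg_span (Set.finite_singleton 1))
  haveI : FiniteDimensional L V1 := Module.Finite.iff_fg.2 hV1fg
  haveI : FiniteDimensional L V := Submodule.finiteDimensional_of_le (inf_le_left : V ≤ V1)
  have hVst : ∀ x ∈ V, D x ∈ V := by
    rintro x ⟨hx1, hx2⟩
    refine ⟨?_, dst_sup D _ _ hK hL x hx2⟩
    obtain ⟨y, hy, z, hz, rfl⟩ := Submodule.mem_sup.1 hx1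
    rw [map_add]
    refine add_mem (Submodule.mem_sup_left (hVD y hy)) (Submodule.mem_sup_right ?_)
    obtain ⟨c, rfl⟩ := Submodule.mem_span_singleton.1 hz
    rw [Subfield.smul_def, smul_eq_mul, mul_one]
    exact Submodule.mem_span_singleton.2 ⟨⟨D c, hL c c.2⟩, by rw [Subfield.smul_def, smul_eq_mul, mul_one]⟩
  let b := Module.finBasis L V
  let v : Fin (Module.finrank L V) → Unit → N := fun m _ => b m
  have hbind : LinearIndependent L (fun m => (b m : N)) := b.linearIndependent.map' V.subtype (Submodule.ker_subtype V)
  have hwexp : ∀ x ∈ V, ∃ c : Fin (Module.finrank L V) → L, x = ∑ i, (c i : N) * b i := by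
    intro x hx
    refine ⟨fun i => b.repr ⟨x, hx⟩ i, ?_⟩
    have := congrArg V.subtype (b.sum_repr ⟨x, hx⟩)
    simp only [map_sum, map_smul] at this
    exact this.symm
  choose A hA using fun m => hwexp (D (b m)) (hVst _ (b m).2)
  have h := JL hk hK hkK hP (ι := Unit) (fun _ _ => 0) (fun _ _ => zero_mem _) v (fun s _ => (b s).2.2)
    (by
      rw [Fintype.linearIndependent_iff] at hbind ⊢
      intro g hg
      refine hbind g ?_
      have := congrFun hg ()
      simpa [v] using this) (fun s t => A s t) (fun s t => (A s t).2) (by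
      intro s _
      simp only [zero_mul, Finset.sum_const_zero, sub_zero]
      exact hA s)
  have hcard := h.fintype_card_le_finrank
  simp only [Fintype.card_fin, Module.finrank_fintype_fun_eq_card, Fintype.card_unit] at hcard
  have h1V : (1 : N) ∈ V := ⟨Submodule.mem_sup_right (Submodule.mem_span_singleton_self 1), one_mem (K ⊔ L)⟩
  have hfV' : f ∈ V := ⟨Submodule.mem_sup_left hfV, hf⟩
  obtain ⟨c, hc⟩ := (finrank_le_one_iff (K := L) (V := V)).1 hcard
  obtain ⟨c1, hc1⟩ := hc ⟨1, h1V⟩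
  obtain ⟨c2, hc2⟩ := hc ⟨f, hfV'⟩
  have e1 : (c1 : N) * c = 1 := congrArg Subtype.val hc1
  have e2 : (c2 : N) * c = f := congrArg Subtype.val hc2
  apply hfn
  have : f = c2 * (c1 : N)⁻¹ := by
    have : (c1 : N) ≠ 0 := left_ne_zero_of_mul_eq_one e1
    rw [← e2]
    field_simp
    rw [mul_assoc, mul_comm (c : N), e1, mul_one]
  rw [this]
  exact mul_mem c2.2 (inv_mem c1.2)

end
end PVR



namespace PVR

section
variable {N : Type u} [Field N] [CharZero N] {D : Derivation ℤ N N} {K k L : Subfield N}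

theorem isLin_inter (L F : Subfield N) (hLF : L ≤ F) (hF : DSt D F) (f : N) (hf : IsLin D L f) (hfF : f ∈ F) :
    ∃ (n : ℕ) (w : Fin n → N) (A : Fin n → Fin n → N) (c : Fin n → N), (∀ i, w i ∈ F) ∧ (∀ i j, A i j ∈ L) ∧
      (∀ i, c i ∈ L) ∧ (∀ i, D (w i) = ∑ j, A i j * w j) ∧ f = ∑ i, c i * w i := by
  obtain ⟨V0, hfg, hVD, hfV⟩ := hf
  let M : Submodule L N :=
    { carrier := (F : Set N)
      zero_mem' := zero_mem _
      add_mem' := fun h1 h2 => add_mem h1 h2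
      smul_mem' := fun c x hx => mul_mem (hLF c.2) hx }
  let V := V0 ⊓ M
  haveI : FiniteDimensional L V0 := Module.Finite.iff_fg.2 hfg
  haveI : FiniteDimensional L V := Submodule.finiteDimensional_of_le (inf_le_left : V ≤ V0)
  let b := Module.finBasis L V
  have hwexp : ∀ x ∈ V, ∃ c : Fin (Module.finrank L V) → L, x = ∑ i, (c i : N) * b i := by
    intro x hx
    refine ⟨fun i => b.repr ⟨x, hx⟩ i, ?_⟩
    have := congrArg V.subtype (b.sum_repr ⟨x, hx⟩)
    simp only [map_sum, map_smul] at this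
    exact this.symm
  choose A hA using fun m => hwexp (D (b m)) ⟨hVD _ (b m).2.1, hF _ (b m).2.2⟩
  obtain ⟨c, hc⟩ := hwexp f ⟨hfV, hfF⟩
  exact ⟨_, fun i => b i, fun i j => A i j, fun i => c i, fun i => (b i).2.2, fun i j => (A i j).2,
    fun i => (c i).2, hA, hc⟩

theorem trace_der (F : Subfield N) (hF : DSt D F) (M : IntermediateField F N) [FiniteDimensional F M]
    (hM : ∀ x ∈ M, D x ∈ M) (x : M) :
    D (Algebra.trace F M x : F) = (Algebra.trace F M ⟨D x, hM x x.2⟩ : F) := by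
  classical
  let b := Module.finBasis F M
  let d : M → M := fun x => ⟨D x, hM x x.2⟩
  let r : M → Fin (Module.finrank F M) → F := fun y i => b.repr y i
  have hr : ∀ y : M, (y : N) = ∑ i, (r y i : N) * b i := by
    intro y
    have := congrArg M.val (b.sum_repr y)
    simp only [map_sum, map_smul] at this
    exact this.symm
  have huniq : ∀ (y : M) (c : Fin (Module.finrank F M) → F), (y : N) = ∑ i, (c i : N) * b i → ∀ i, r y i = c i := by
    intro y c h i
    have : y = ∑ i, c i • b i := by
      apply Subtype.ext
      rw [h]
      have := map_sum M.val (fun i => c i • b i) Finset.univ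
      rw [IntermediateField.coe_val] at this
      rw [this]
      rfl
    simp only [r]
    rw [this, b.repr_sum_self]
  have hadd : ∀ y z : M, ∀ i, r (y + z) i = r y i + r z i := fun y z i => by simp [r]
  have hder : ∀ (y : M) i, (r (d y) i : N) = D (r y i) + ∑ m, (r y m : N) * r (d (b m)) i := by
    intro y i
    have := huniq (d y) (fun i => ⟨D (r y i), hF _ (r y i).2⟩ + ∑ m, r y m * r (d (b m)) i) (by
      show D y = _
      rw [hr y, map_sum]
      simp only [D.leibniz, smul_eq_mul, Finset.sum_add_distrib]
      have h1 : ∀ m, D (b m) = ∑ i, (r (d (b m)) i : N) * b i := fun m => hr (d (b m))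
      simp only [h1]
      push_cast
      simp only [add_mul, Finset.sum_add_distrib, Finset.sum_mul, Finset.mul_sum]
      rw [add_comm]
      congr 1
      · exact Finset.sum_congr rfl (fun _ _ => mul_comm _ _)
      · rw [Finset.sum_comm]
        exact Finset.sum_congr rfl (fun _ _ => Finset.sum_congr rfl (fun _ _ => by ring))) i
    rw [this]
    push_cast
    rfl
  have htr : ∀ y : M, Algebra.trace F M y = ∑ j, r (y * b j) j := by
    intro y
    rw [Algebra.trace_eq_matrix_trace b, Matrix.trace]
    exact Finset.sum_congr rfl (fun j _ => Algebra.leftMulMatrix_eq_repr_mul b y j j)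
  show D (Algebra.trace F M x : F) = (Algebra.trace F M (d x) : F)
  rw [htr, htr]
  push_cast
  rw [map_sum]
  have hmul : ∀ (y : M) i, (r (x * y) i : N) = ∑ m, (r y m : N) * r (x * b m) i := by
    intro y i
    have : r (x * y) i = ∑ m, r y m * r (x * b m) i := by
      simp only [r]
      conv_lhs => rw [← b.sum_repr y, Finset.mul_sum]
      simp [Finset.sum_apply]
    rw [this]; push_cast; rfl
  have hj : ∀ j, D (r (x * b j) j) = r (d x * b j) j + ∑ m, (r (d (b j)) m : N) * r (x * b m) j
      - ∑ m, (r (x * b j) m : N) * r (d (b m)) j := by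
    intro j
    have h1 := hder (x * b j) j
    have h2 : d (x * b j) = d x * b j + x * d (b j) := by
      apply Subtype.ext
      show D (x * b j) = D x * b j + x * D (b j)
      rw [D.leibniz, smul_eq_mul, smul_eq_mul]; ring
    rw [h2, hadd] at h1
    push_cast at h1
    rw [hmul (d (b j)) j] at h1
    linear_combination -h1
  rw [Finset.sum_congr rfl (fun j _ => hj j), Finset.sum_sub_distrib, Finset.sum_add_distrib]
  rw [Finset.sum_comm (f := fun j m => (r (x * b j) m : N) * r (d (b m)) j)]
  have : ∑ x_1, ∑ m, (r (d (b x_1)) m : N) * r (x * b m) x_1 = ∑ y, ∑ x_1, (r (x * b x_1) y : N) * r (d (b y)) x_1 :=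
    Finset.sum_congr rfl (fun _ _ => Finset.sum_congr rfl (fun _ _ => mul_comm _ _))
  rw [this]; ring

theorem five (hk : DSt D k) (hK : DSt D K) (hkK : k ≤ K) (hP : PP D K k) (f : N)
    (hfl : IsLin D (Qa D k) f) (hfa : IsAlgebraic (K ⊔ Qa D k : Subfield N) f) : f ∈ Qa D k := by
  let L := Qa D k
  let F : Subfield N := K ⊔ L
  have hL : DSt D L := dst_Qa
  have hLF : L ≤ F := le_sup_right
  have hF : DSt D F := dst_sup D _ _ hK hL
  let M : IntermediateField F N := IntermediateField.adjoin F {f}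
  have hint : IsIntegral F f := hfa.isIntegral
  haveI : FiniteDimensional F M := IntermediateField.adjoin.finiteDimensional hint
  have hfM : f ∈ M := IntermediateField.mem_adjoin_simple_self F f
  have hFM : F ≤ M.toSubfield := fun x hx => M.algebraMap_mem ⟨x, hx⟩
  have hM : ∀ x ∈ M, D x ∈ M := by
    intro x hx
    have : IsAlgebraic F (⟨x, hx⟩ : M) := Algebra.IsAlgebraic.isAlgebraic _
    have h2 : IsAlgebraic F x := (isAlgebraic_algebraMap_iff (A := N) (FaithfulSMul.algebraMap_injective M N)).2 this
    exact der_alg_mem D F M.toSubfield hF hFM x h2 hx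
  have htr : ∀ x : M, IsLin D L x → (Algebra.trace F M x : N) ∈ L := by
    intro x hx
    refine JLs hk hK hkK hP _ (Algebra.trace F M x).2 ?_
    obtain ⟨n, w, A, c, hw, hA, hc, hD, hf⟩ := isLin_inter (D := D) L M.toSubfield (hLF.trans hFM) hM x hx x.2
    rw [isLin_iff_exists D L hL]
    let w' : Fin n → M := fun i => ⟨w i, hw i⟩
    have hlin : ∀ (c : Fin n → N) (hc : ∀ i, c i ∈ L) (y : M), (y : N) = ∑ i, c i * w i →
        (Algebra.trace F M y : N) = ∑ i, c i * (Algebra.trace F M (w' i) : N) := by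
      intro c hc y hy
      have : y = ∑ i, (⟨c i, hLF (hc i)⟩ : F) • w' i := by
        apply Subtype.ext
        rw [hy]
        have := map_sum M.val (fun i => (⟨c i, hLF (hc i)⟩ : F) • w' i) Finset.univ
        rw [IntermediateField.coe_val] at this
        rw [this]
        rfl
      rw [this, map_sum]
      simp
    refine ⟨n, fun i => (Algebra.trace F M (w' i) : N), Matrix.of A, c, hA, hc, fun i => ?_, hlin c hc x hf⟩
    rw [trace_der F hF M hM (w' i)]
    exact hlin (A i) (hA i) _ (hD i)
  let g : M := ⟨f, hfM⟩
  have hgl : ∀ n : ℕ, (Algebra.trace F M (g ^ n) : N) ∈ L := fun n =>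
    htr _ ((Lin D L hL).pow_mem (show f ∈ Lin D L hL from hfl) n)
  let pb : PowerBasis F M := IntermediateField.adjoin.powerBasis hint
  have hgen : pb.gen = g := IntermediateField.adjoin.powerBasis_gen hint
  have hdet : (Algebra.traceMatrix F pb.basis).det ≠ 0 := det_traceMatrix_ne_zero' pb
  -- relation
  obtain ⟨c, hc⟩ : ∃ c : Fin pb.dim → F, g ^ pb.dim = ∑ j, c j • g ^ (j : ℕ) := by
    refine ⟨fun j => pb.basis.repr (g ^ pb.dim) j, ?_⟩
    conv_lhs => rw [← pb.basis.sum_repr (g ^ pb.dim)]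
    simp [hgen]
  let T : Matrix (Fin pb.dim) (Fin pb.dim) F := Algebra.traceMatrix F pb.basis
  have hT : ∀ i j, T i j = Algebra.trace F M (g ^ ((i : ℕ) + j)) := by
    intro i j
    simp [T, Algebra.traceMatrix_apply, Algebra.traceForm_apply, hgen, pow_add]
  let TN := T.map F.subtype
  have hTN : TN.det ≠ 0 := by
    have : TN.det = F.subtype T.det := (RingHom.map_det F.subtype T).symm
    rw [this]
    exact fun h => hdet (F.subtype.injective (h.trans (map_zero _).symm))
  have hTL : ∀ i j, TN i j ∈ L := fun i j => by
    show (T i j : N) ∈ L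
    rw [hT]; exact hgl _
  have hrel : TN.mulVec (fun j => (c j : N)) = fun i : Fin pb.dim => (Algebra.trace F M (g ^ (pb.dim + (i : ℕ))) : N) := by
    ext i
    have h1 : Algebra.trace F M (g ^ (pb.dim + (i : ℕ))) = ∑ j, c j * Algebra.trace F M (g ^ ((i : ℕ) + j)) := by
      rw [pow_add, hc, Finset.sum_mul, map_sum]
      refine Finset.sum_congr rfl (fun j _ => ?_)
      rw [smul_mul_assoc, map_smul, smul_eq_mul, ← pow_add, add_comm (j : ℕ)]
    rw [h1]
    simp only [Matrix.mulVec, dotProduct]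
    push_cast
    refine Finset.sum_congr rfl (fun j _ => ?_)
    show (T i j : N) * c j = _
    rw [hT]; ring
  have hcL : ∀ j, (c j : N) ∈ L := by
    intro j
    have : (fun j => (c j : N)) = TN⁻¹.mulVec (fun i : Fin pb.dim => (Algebra.trace F M (g ^ (pb.dim + (i : ℕ))) : N)) := by
      rw [← hrel, Matrix.mulVec_mulVec, Matrix.nonsing_inv_mul _ (IsUnit.mk0 _ hTN), Matrix.one_mulVec]
    have h2 := congrFun this j
    rw [h2]
    simp only [Matrix.mulVec, dotProduct]
    exact sum_mem (fun i _ => mul_mem (mat_inv_mem L TN hTL _ _) (hgl _))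
  apply Qa_algClosed
  have hfN : f ^ pb.dim = ∑ j, (c j : N) * f ^ (j : ℕ) := by
    have := congrArg M.val hc
    simp only [map_sum, map_smul, map_pow] at this
    exact this
  let p : Polynomial L := Polynomial.X ^ pb.dim - ∑ j : Fin pb.dim, Polynomial.C ⟨c j, hcL j⟩ * Polynomial.X ^ (j : ℕ)
  refine ⟨p, ?_, ?_⟩
  · refine (Polynomial.Monic.ne_zero (Polynomial.monic_X_pow_sub ?_))
    refine lt_of_le_of_lt (Polynomial.degree_sum_le _ _) ?_
    rw [Finset.sup_lt_iff (WithBot.bot_lt_coe _)]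
    intro j _
    exact lt_of_le_of_lt (Polynomial.degree_C_mul_X_pow_le _ _) (by exact_mod_cast j.2)
  · simp only [p, map_sub, map_pow, map_sum, map_mul, Polynomial.aeval_X, Polynomial.aeval_C]
    rw [sub_eq_zero]
    exact hfN

end
end PVR
namespace PVR
open scoped TensorProduct

def Kil {P : Type*} [Field P] (F : Set P) (δ : Derivation ℤ P P) : Prop := ∀ x ∈ F, δ x = 0

section
variable {P : Type u} [Field P] [CharZero P] {ι : Type} [Fintype ι] [DecidableEq ι]

structure Tor (D : Derivation ℤ P P) (L : Subfield P) (Φ A : Matrix ι ι P) : Prop where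
  hL : DSt D L
  hc : ∀ x, D x = 0 → x ∈ L
  hcl : ∀ x, IsAlgebraic L x → x ∈ L
  hdet : Φ.det ≠ 0
  hA : ∀ i j, A i j ∈ L
  hD : Φ.map D = A * Φ
  hgen : ∀ F : Subfield P, L ≤ F → (∀ i j, Φ i j ∈ F) → ∀ x, x ∈ F

def IsR (D : Derivation ℤ P P) (L : Subfield P) (Φ : Matrix ι ι P) (δ : Derivation ℤ P P) : Prop :=
  Kil L δ ∧ ∃ B : Matrix ι ι P, B.map D = 0 ∧ Φ.map δ = Φ * B

def IsG (L : Subfield P) (Φ : Matrix ι ι P) (δ : Derivation ℤ P P) : Prop :=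
  Kil L δ ∧ ∃ B : Matrix ι ι P, (∀ i j, B i j ∈ L) ∧ Φ.map δ = B * Φ

def kerSub (δ : Derivation ℤ P P) : Subfield P where
  carrier := {x | δ x = 0}
  mul_mem' := by intro a b ha hb; simp only [Set.mem_setOf_eq] at *; simp [ha, hb]
  one_mem' := by simp
  add_mem' := by intro a b ha hb; simp only [Set.mem_setOf_eq] at *; simp [ha, hb]
  zero_mem' := by simp
  neg_mem' := by intro a ha; simp only [Set.mem_setOf_eq] at *; simp [ha]
  inv_mem' := by intro a ha; simp only [Set.mem_setOf_eq] at *; simp [der_inv, ha]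

theorem mem_kerSub {δ : Derivation ℤ P P} {x : P} : x ∈ kerSub δ ↔ δ x = 0 := Iff.rfl

theorem kil_sub (F : Set P) (V : Subfield P) (δ : Derivation ℤ P P) (h : Kil F δ) :
    Kil (Subfield.closure F : Subfield P) δ := by
  have : Subfield.closure F ≤ kerSub δ := Subfield.closure_le.2 h
  exact this

/-- derivations killing a set, as a submodule -/
def kilSub (F : Set P) : Submodule P (Derivation ℤ P P) where
  carrier := {δ | Kil F δ}
  add_mem' := by intro a b ha hb x hx; simp [ha x hx, hb x hx]
  zero_mem' := by intro x hx; simp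
  smul_mem' := by intro c a ha x hx; simp [ha x hx]

theorem mem_kilSub {F : Set P} {δ : Derivation ℤ P P} : δ ∈ kilSub F ↔ Kil F δ := Iff.rfl

theorem alg_of_kil (L : Subfield P) (x : P) (h : ∀ δ : Derivation ℤ P P, Kil L δ → δ x = 0) :
    IsAlgebraic L x := by
  apply isAlgebraic_of_killed
  intro d
  have := h (d.restrictScalars ℤ) (by intro y hy; exact d.map_algebraMap ⟨y, hy⟩)
  exact this

theorem map_zero_of_kil {L : Subfield P} {δ : Derivation ℤ P P} (h : Kil L δ) {B : Matrix ι ι P}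
    (hB : ∀ i j, B i j ∈ L) : B.map δ = 0 := by
  ext i j; exact h _ (hB i j)

theorem map_lie (D δ : Derivation ℤ P P) (B : Matrix ι ι P) :
    B.map (⁅D, δ⁆ : Derivation ℤ P P) = (B.map δ).map D - (B.map D).map δ := by
  ext i j; simp [Derivation.commutator_apply]

theorem map_smul_der (c : P) (δ : Derivation ℤ P P) (B : Matrix ι ι P) :
    B.map (c • δ) = c • B.map δ := by
  ext i j; simp

theorem map_add_der (δ δ' : Derivation ℤ P P) (B : Matrix ι ι P) :
    B.map (δ + δ') = B.map δ + B.map δ' := by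
  ext i j; simp

theorem kil_lie {L : Subfield P} {D δ : Derivation ℤ P P} (hL : DSt D L) (h : Kil L δ) : Kil L ⁅D, δ⁆ := by
  intro x hx
  simp [Derivation.commutator_apply, h x hx, h _ (hL x hx)]

theorem kil_lie2 {L : Subfield P} {D δ : Derivation ℤ P P} (hL : Kil L D) (h : Kil L δ) : Kil L ⁅D, δ⁆ := by
  intro x hx
  simp [Derivation.commutator_apply, h x hx, hL x hx]

variable {D : Derivation ℤ P P} {L : Subfield P} {Φ A : Matrix ι ι P}

theorem Tor.ext (T : Tor D L Φ A) {δ : Derivation ℤ P P} (h1 : Kil L δ) (h2 : Φ.map δ = 0) : δ = 0 := by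
  ext x
  exact T.hgen (kerSub δ) h1 (fun i j => congrFun (congrFun h2 i) j) x

theorem Tor.u (T : Tor D L Φ A) : IsUnit Φ.det := isUnit_iff_ne_zero.2 T.hdet

noncomputable def TR (Φ : Matrix ι ι P) : Derivation ℤ P P →ₗ[P] Matrix ι ι P where
  toFun δ := Φ⁻¹ * Φ.map δ
  map_add' := by intro a b; rw [map_add_der, Matrix.mul_add]
  map_smul' := by intro a b; rw [map_smul_der, Matrix.mul_smul]; rfl

noncomputable def TG (Φ : Matrix ι ι P) : Derivation ℤ P P →ₗ[P] Matrix ι ι P where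
  toFun δ := Φ.map δ * Φ⁻¹
  map_add' := by intro a b; rw [map_add_der, Matrix.add_mul]
  map_smul' := by intro a b; rw [map_smul_der, Matrix.smul_mul]; rfl

theorem TR_apply (δ : Derivation ℤ P P) : TR Φ δ = Φ⁻¹ * Φ.map δ := rfl
theorem TG_apply (δ : Derivation ℤ P P) : TG Φ δ = Φ.map δ * Φ⁻¹ := rfl

theorem Tor.TR_spec (T : Tor D L Φ A) (δ : Derivation ℤ P P) : Φ.map δ = Φ * TR Φ δ := by
  rw [TR_apply, ← Matrix.mul_assoc, Matrix.mul_nonsing_inv _ T.u, Matrix.one_mul]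

theorem Tor.TG_spec (T : Tor D L Φ A) (δ : Derivation ℤ P P) : Φ.map δ = TG Φ δ * Φ := by
  rw [TG_apply, Matrix.mul_assoc, Matrix.nonsing_inv_mul _ T.u, Matrix.mul_one]

theorem Tor.TR_lie (T : Tor D L Φ A) (δ : Derivation ℤ P P) (h : Kil L δ) :
    TR Φ ⁅D, δ⁆ = (TR Φ δ).map D := by
  have e := T.TR_spec δ
  rw [TR_apply ⁅D, δ⁆, map_lie, T.hD, mat_der_mul δ, map_zero_of_kil h T.hA, Matrix.zero_mul, zero_add]
  generalize TR Φ δ = C at *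
  rw [e, mat_der_mul, T.hD, Matrix.mul_assoc A, add_sub_cancel_left, ← Matrix.mul_assoc, Matrix.nonsing_inv_mul _ T.u, Matrix.one_mul]

theorem Tor.R_B (T : Tor D L Φ A) {ρ : Derivation ℤ P P} (h : IsR D L Φ ρ) :
    (∀ i j, TR Φ ρ i j ∈ L) ∧ (TR Φ ρ).map D = 0 := by
  obtain ⟨h1, B, hB, hρ⟩ := h
  have : TR Φ ρ = B := by
    rw [TR_apply, hρ, ← Matrix.mul_assoc, Matrix.nonsing_inv_mul _ T.u, Matrix.one_mul]
  rw [this]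
  exact ⟨fun i j => T.hc _ (congrFun (congrFun hB i) j), hB⟩

theorem Tor.G_B (T : Tor D L Φ A) {ρ : Derivation ℤ P P} (h : IsG L Φ ρ) :
    (∀ i j, TG Φ ρ i j ∈ L) := by
  obtain ⟨h1, B, hB, hρ⟩ := h
  have : TG Φ ρ = B := by
    rw [TG_apply, hρ, Matrix.mul_assoc, Matrix.mul_nonsing_inv _ T.u, Matrix.mul_one]
  rwa [this]

theorem Tor.TG_lie (T : Tor D L Φ A) (ρ δ : Derivation ℤ P P) (hρ : IsR D L Φ ρ) (h : Kil L δ) :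
    TG Φ ⁅ρ, δ⁆ = (TG Φ δ).map ρ := by
  have hB := T.R_B hρ
  have e := T.TR_spec ρ
  have e2 := T.TG_spec δ
  rw [TG_apply ⁅ρ, δ⁆, map_lie]
  generalize TR Φ ρ = C at *
  generalize TG Φ δ = B at *
  rw [e, mat_der_mul δ, map_zero_of_kil h hB.1, Matrix.mul_zero, add_zero]
  rw [e2, mat_der_mul ρ, e, Matrix.mul_assoc B Φ, add_sub_cancel_right, Matrix.mul_assoc, Matrix.mul_nonsing_inv _ T.u, Matrix.mul_one]

theorem Tor.spanR (T : Tor D L Φ A) {δ : Derivation ℤ P P} (h : Kil L δ) :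
    δ ∈ Submodule.span P {ρ | IsR D L Φ ρ} := by
  have h1 := constB (Matrix.stdBasis P ι ι) {D} ((kilSub (L : Set P)).map (TR Φ)) (by
    rintro d rfl _ ⟨δ, hδ, rfl⟩
    refine ⟨TR Φ ⁅d, δ⁆, ⟨_, kil_lie T.hL hδ, rfl⟩, ?_⟩
    rintro ⟨i, j⟩
    rw [T.TR_lie δ hδ]
    simp [Matrix.stdBasis]) (TR Φ δ) ⟨δ, h, rfl⟩
  have h2 : Submodule.span P {w | w ∈ ((kilSub (L : Set P)).map (TR Φ)) ∧ ∀ d ∈ ({D} : Set (Derivation ℤ P P)), ∀ i, d ((Matrix.stdBasis P ι ι).repr w i) = 0} ≤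
      (Submodule.span P {ρ | IsR D L Φ ρ}).map (TR Φ) := by
    rw [Submodule.span_le]
    rintro _ ⟨⟨ρ, hρ, rfl⟩, hw⟩
    refine ⟨ρ, Submodule.subset_span ⟨hρ, TR Φ ρ, ?_, T.TR_spec ρ⟩, rfl⟩
    ext i j
    exact hw D rfl (i, j)
  obtain ⟨δ', hδ', he⟩ := h2 h1
  have hk' : δ' ∈ kilSub (L : Set P) := by
    refine (Submodule.span_le.2 ?_) hδ'
    intro ρ hρ; exact hρ.1
  have : δ - δ' = 0 := T.ext ((kilSub (L : Set P)).sub_mem h hk') (by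
    rw [T.TR_spec, map_sub, he, sub_self, Matrix.mul_zero])
  rw [sub_eq_zero.1 this]; exact hδ'

theorem Tor.inL (T : Tor D L Φ A) (x : P) (h : ∀ ρ, IsR D L Φ ρ → ρ x = 0) : x ∈ L := by
  apply T.hcl
  apply alg_of_kil
  intro δ hδ
  have h3 : Submodule.span P {ρ | IsR D L Φ ρ} ≤ kilSub {x} := by
    rw [Submodule.span_le]
    intro ρ hρ y hy
    rw [hy]; exact h ρ hρ
  exact h3 (T.spanR hδ) x rfl

theorem Tor.spanG (T : Tor D L Φ A) {δ : Derivation ℤ P P} (h : Kil L δ) :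
    δ ∈ Submodule.span P {ε | IsG L Φ ε} := by
  have h1 := constB (Matrix.stdBasis P ι ι) {ρ | IsR D L Φ ρ} ((kilSub (L : Set P)).map (TG Φ)) (by
    rintro ρ hρ _ ⟨δ, hδ, rfl⟩
    refine ⟨TG Φ ⁅ρ, δ⁆, ⟨_, kil_lie2 hρ.1 hδ, rfl⟩, ?_⟩
    rintro ⟨i, j⟩
    rw [T.TG_lie ρ δ hρ hδ]
    simp [Matrix.stdBasis]) (TG Φ δ) ⟨δ, h, rfl⟩
  have h2 : Submodule.span P {w | w ∈ ((kilSub (L : Set P)).map (TG Φ)) ∧ ∀ d ∈ {ρ | IsR D L Φ ρ}, ∀ i, d ((Matrix.stdBasis P ι ι).repr w i) = 0} ≤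
      (Submodule.span P {ρ | IsG L Φ ρ}).map (TG Φ) := by
    rw [Submodule.span_le]
    rintro _ ⟨⟨ρ, hρ, rfl⟩, hw⟩
    refine ⟨ρ, Submodule.subset_span ⟨hρ, TG Φ ρ, ?_, T.TG_spec ρ⟩, rfl⟩
    intro i j
    exact T.inL _ fun d hd => hw d hd (i, j)
  obtain ⟨δ', hδ', he⟩ := h2 h1
  have hk' : δ' ∈ kilSub (L : Set P) := by
    refine (Submodule.span_le.2 ?_) hδ'
    intro ρ hρ; exact hρ.1
  have : δ - δ' = 0 := T.ext ((kilSub (L : Set P)).sub_mem h hk') (by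
    rw [T.TG_spec, map_sub, he, sub_self, Matrix.zero_mul])
  rw [sub_eq_zero.1 this]; exact hδ'

theorem Tor.isG_iff (T : Tor D L Φ A) (δ : Derivation ℤ P P) :
    IsG L Φ δ ↔ Kil L δ ∧ ∀ i j, TG Φ δ i j ∈ L :=
  ⟨fun h => ⟨h.1, T.G_B h⟩, fun h => ⟨h.1, TG Φ δ, h.2, T.TG_spec δ⟩⟩

theorem Tor.comm_RD (T : Tor D L Φ A) {ρ : Derivation ℤ P P} (h : IsR D L Φ ρ) (x : P) : D (ρ x) = ρ (D x) := by
  have : ⁅D, ρ⁆ = 0 := T.ext (kil_lie T.hL h.1) (by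
    rw [T.TR_spec, T.TR_lie ρ h.1, (T.R_B h).2, Matrix.mul_zero])
  have h2 := congrArg (fun d : Derivation ℤ P P => d x) this
  simpa [Derivation.commutator_apply, sub_eq_zero] using h2

theorem Tor.comm_RG (T : Tor D L Φ A) {ρ ε : Derivation ℤ P P} (h : IsR D L Φ ρ) (hε : IsG L Φ ε) (x : P) :
    ρ (ε x) = ε (ρ x) := by
  have : ⁅ρ, ε⁆ = 0 := T.ext (kil_lie2 h.1 hε.1) (by
    rw [T.TG_spec, T.TG_lie ρ ε h hε.1, map_zero_of_kil h.1 (T.G_B hε), Matrix.zero_mul])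
  have h2 := congrArg (fun d : Derivation ℤ P P => d x) this
  simpa [Derivation.commutator_apply, sub_eq_zero] using h2

theorem mat_mul_mem (L : Subfield P) {l m n : Type*} [Fintype m] {B : Matrix l m P} {C : Matrix m n P}
    (hB : ∀ i j, B i j ∈ L) (hC : ∀ i j, C i j ∈ L) (i : l) (j : n) : (B * C) i j ∈ L := by
  rw [Matrix.mul_apply]; exact sum_mem fun t _ => mul_mem (hB _ _) (hC _ _)

theorem Tor.lieG (T : Tor D L Φ A) {ε : Derivation ℤ P P} (hε : IsG L Φ ε) : IsG L Φ ⁅D, ε⁆ := by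
  refine ⟨kil_lie T.hL hε.1, (TG Φ ε).map D + TG Φ ε * A - A * TG Φ ε, ?_, ?_⟩
  · intro i j
    have h := T.G_B hε
    exact sub_mem (add_mem (T.hL _ (h i j)) (mat_mul_mem L h T.hA i j)) (mat_mul_mem L T.hA h i j)
  · rw [map_lie, T.hD, mat_der_mul ε, map_zero_of_kil hε.1 T.hA, Matrix.zero_mul, zero_add, T.TG_spec ε,
      mat_der_mul D, T.hD]
    simp only [Matrix.add_mul, Matrix.sub_mul, Matrix.mul_assoc]

theorem Tor.G_add (T : Tor D L Φ A) {ε ε' : Derivation ℤ P P} (h : IsG L Φ ε) (h' : IsG L Φ ε') :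
    IsG L Φ (ε + ε') := by
  rw [T.isG_iff] at *
  refine ⟨(kilSub (L : Set P)).add_mem h.1 h'.1, fun i j => ?_⟩
  rw [map_add]; exact add_mem (h.2 i j) (h'.2 i j)

theorem Tor.G_smul (T : Tor D L Φ A) {ε : Derivation ℤ P P} (h : IsG L Φ ε) {c : P} (hc : c ∈ L) :
    IsG L Φ (c • ε) := by
  rw [T.isG_iff] at *
  refine ⟨(kilSub (L : Set P)).smul_mem c h.1, fun i j => ?_⟩
  rw [map_smul]; exact mul_mem hc (h.2 i j)

theorem Tor.G_zero (T : Tor D L Φ A) : IsG L Φ 0 := by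
  rw [T.isG_iff] at *
  refine ⟨(kilSub (L : Set P)).zero_mem, fun i j => ?_⟩
  rw [map_zero]; exact zero_mem _

theorem Tor.G_sum (T : Tor D L Φ A) {σ : Type*} [Fintype σ] (ε : σ → Derivation ℤ P P)
    (h : ∀ s, IsG L Φ (ε s)) (c : σ → P) (hc : ∀ s, c s ∈ L) : IsG L Φ (∑ s, c s • ε s) := by
  have : ∀ S : Finset σ, IsG L Φ (∑ s ∈ S, c s • ε s) := by
    classical
    intro S
    induction S using Finset.induction with
    | empty => simpa using T.G_zero
    | insert a S ha ih => rw [Finset.sum_insert ha]; exact T.G_add (T.G_smul (h a) (hc a)) ih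
  exact this _

theorem Tor.G_fin (T : Tor D L Φ A) : ∃ (n : ℕ) (ε : Fin n → Derivation ℤ P P), (∀ s, IsG L Φ (ε s)) ∧
    ∀ δ, IsG L Φ δ → ∃ c : Fin n → P, (∀ s, c s ∈ L) ∧ δ = ∑ s, c s • ε s := by
  let V : Submodule L (Matrix ι ι L) :=
    { carrier := {B | ∃ δ, Kil L δ ∧ TG Φ δ = B.map (fun x => (x : P))}
      zero_mem' := ⟨0, T.G_zero.1, by rw [map_zero]; ext; simp⟩
      add_mem' := by
        rintro a b ⟨δ, h1, h2⟩ ⟨δ', h3, h4⟩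
        refine ⟨δ + δ', (kilSub (L : Set P)).add_mem h1 h3, ?_⟩
        rw [map_add, h2, h4]; ext; simp
      smul_mem' := by
        rintro c a ⟨δ, h1, h2⟩
        refine ⟨(c : P) • δ, (kilSub (L : Set P)).smul_mem (c : P) h1, ?_⟩
        rw [map_smul, h2]; ext; simp }
  have hb := Module.finBasis L V
  choose ε hε1 hε2 using fun s => (hb s).2
  have hG : ∀ s, IsG L Φ (ε s) := fun s => by
    rw [T.isG_iff]; refine ⟨hε1 s, fun i j => ?_⟩
    rw [hε2 s]; exact SetLike.coe_mem _
  refine ⟨_, ε, hG, ?_⟩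
  intro δ hδ
  let B : Matrix ι ι L := fun i j => ⟨TG Φ δ i j, T.G_B hδ i j⟩
  have hB : B ∈ V := ⟨δ, hδ.1, rfl⟩
  have hr := hb.sum_repr ⟨B, hB⟩
  refine ⟨fun s => hb.repr ⟨B, hB⟩ s, fun s => SetLike.coe_mem _, ?_⟩
  rw [← sub_eq_zero]
  apply T.ext
  · exact (kilSub (L : Set P)).sub_mem hδ.1 (T.G_sum ε hG _ fun s => SetLike.coe_mem _).1
  · rw [T.TG_spec, map_sub, map_sum]
    have : TG Φ δ - ∑ s, TG Φ (((hb.repr ⟨B, hB⟩ s : L) : P) • ε s) = 0 := by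
      rw [sub_eq_zero]
      have h5 := congrArg (fun (v : V) => (v : Matrix ι ι L)) hr
      simp only [Submodule.coe_sum, Submodule.coe_smul] at h5
      ext i j
      have h6 := congrArg (fun (v : Matrix ι ι L) => (v i j : P)) h5
      simp only [Matrix.sum_apply, Matrix.smul_apply, map_smul, hε2] at h6 ⊢
      refine (h6.symm.trans ?_ : ((B i j : L) : P) = _)
      simp
    rw [this, Matrix.zero_mul]
end
end PVR
namespace PVR
open scoped TensorProduct

theorem mvder {R : Type*} [CommRing R] {σ : Type*} (d : Derivation ℤ R R) :
    ∃ d' : MvPolynomial σ R →+ MvPolynomial σ R,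
      (∀ a b, d' (a * b) = a * d' b + b * d' a) ∧
      (∀ x, d' (MvPolynomial.C x) = MvPolynomial.C (d x)) ∧
      (∀ i, d' (MvPolynomial.X i) = 0) ∧ ∀ m g, MvPolynomial.coeff m (d' g) = d (MvPolynomial.coeff m g) := by
  classical
  obtain ⟨d', h1, h2, h3⟩ := der_ext_mv d (fun _ : σ => (0 : MvPolynomial σ R))
  refine ⟨d', h1, h2, h3, ?_⟩
  intro m g
  induction g using MvPolynomial.induction_on generalizing m with
  | C a => rw [h2, MvPolynomial.coeff_C, MvPolynomial.coeff_C]; split_ifs <;> simp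
  | add p q hp hq => simp [hp, hq]
  | mul_X p i hp =>
    rw [h1, h3, mul_zero, zero_add, mul_comm, MvPolynomial.coeff_mul_X', MvPolynomial.coeff_mul_X']
    split_ifs <;> simp [hp]

section
variable {P : Type u} [Field P] [CharZero P] {ι : Type} [Fintype ι] [DecidableEq ι]
variable {D : Derivation ℤ P P} {L : Subfield P} {Φ A : Matrix ι ι P}

theorem two_embed (F : Subfield P) (hF : DSt D F) (y : P) (hy : y ∉ F) :
    ∃ (Ω : Type u) (_ : Field Ω) (_ : CharZero Ω) (DΩ : Derivation ℤ Ω Ω) (τ σ : P →+* Ω),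
      DHom D DΩ τ ∧ DHom D DΩ σ ∧ (∀ x ∈ F, τ x = σ x) ∧ τ y ≠ σ y := by
  have hne : (y ⊗ₜ[F] (1 : P) + (-1 : P) ⊗ₜ[F] y) ≠ 0 := by
    have := tsum_ne_zero (F := F) (A := P) (B := P) ![1, y] (by
      rw [LinearIndependent.pair_iff]
      intro s t h
      have ht : t = 0 := by
        by_contra ht
        apply hy
        have ht' : (t : P) ≠ 0 := by simpa using ht
        have : y = -(s : P) / t := by
          rw [eq_div_iff ht']; simp [Subfield.smul_def] at h; linear_combination h
        rw [this]; exact div_mem (neg_mem s.2) t.2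
      subst ht
      simp [Subfield.smul_def] at h
      exact ⟨h, rfl⟩) ![y, -1] 1 (by simp)
    simpa using this
  obtain ⟨Ω, i1, i2, DΩ, θ, h1, h2, h3⟩ := amalgam (F := F) D D (fun x => ⟨⟨D x, hF x x.2⟩, rfl, rfl⟩) _ hne
  refine ⟨Ω, i1, i2, DΩ, θ.comp Algebra.TensorProduct.includeLeftRingHom,
    θ.comp (Algebra.TensorProduct.includeRight (R := F) (A := P) (B := P)).toRingHom, fun x => h1 x, fun x => h2 x, ?_, ?_⟩
  · intro x hx
    simp
    congr 1
    have : x = (⟨x, hx⟩ : F) • (1 : P) := by simp [Subfield.smul_def]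
    rw [this, TensorProduct.smul_tmul]
  · intro h
    apply h3
    rw [map_add, TensorProduct.neg_tmul, map_neg, ← sub_eq_add_neg, sub_eq_zero]
    exact h

theorem Tor.F3 (T : Tor D L Φ A) (F : Subfield P) (hF : DSt D F) (hLF : L ≤ F) {ε : Derivation ℤ P P}
    (hε : IsG L Φ ε) (x : P) (hx : x ∈ F) : ε x ∈ F := by
  by_contra hy
  obtain ⟨Ω, _, _, DΩ, τ, σ, hτ, hσ, hag, hne⟩ := two_embed F hF _ hy
  -- the constant matrix
  obtain ⟨c, hc0, hc⟩ : ∃ c : Matrix ι ι Ω, c.map DΩ = 0 ∧ Φ.map σ = Φ.map τ * c := by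
    have hu : IsUnit (Φ.map τ).det := by
      rw [← RingHom.mapMatrix_apply, ← RingHom.map_det]; exact isUnit_iff_ne_zero.2 (by simpa using T.hdet)
    have hs : ∀ ρ : P →+* Ω, DHom D DΩ ρ → (Φ.map ρ).map DΩ = A.map ρ * Φ.map ρ := by
      intro ρ hρ
      have : (Φ.map ρ).map DΩ = (Φ.map D).map ρ := by ext i j; exact hρ _
      rw [this, T.hD, Matrix.map_mul]
    have e2 : Φ.map σ = Φ.map τ * ((Φ.map τ)⁻¹ * Φ.map σ) := by
      rw [← Matrix.mul_assoc, Matrix.mul_nonsing_inv _ hu, Matrix.one_mul]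
    refine ⟨(Φ.map τ)⁻¹ * Φ.map σ, ?_, e2⟩
    have h1 := congrArg (fun M : Matrix ι ι Ω => M.map DΩ) e2
    generalize (Φ.map τ)⁻¹ * Φ.map σ = c at *
    rw [mat_der_mul, hs σ hσ, hs τ hτ, e2] at h1
    have hA : A.map σ = A.map τ := by ext i j; exact (hag _ (hLF (T.hA i j))).symm
    rw [hA, Matrix.mul_assoc, left_eq_add] at h1
    have := congrArg (fun M => (Φ.map τ)⁻¹ * M) h1
    simpa [← Matrix.mul_assoc, Matrix.nonsing_inv_mul _ hu] using this
  obtain ⟨Dh, D1, D2, D3, D4⟩ := mvder (σ := ι × ι) D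
  obtain ⟨eh, e1, e2, e3, e4⟩ := mvder (σ := ι × ι) ε
  let θ : MvPolynomial (ι × ι) P →+* Ω := MvPolynomial.eval₂Hom τ (fun p => c p.1 p.2)
  have hθC : ∀ x, θ (MvPolynomial.C x) = τ x := fun x => by simp [θ]
  have hθX : ∀ p, θ (MvPolynomial.X p) = c p.1 p.2 := fun x => by simp [θ]
  have hθD : ∀ g, θ (Dh g) = DΩ (θ g) := by
    intro g
    induction g using MvPolynomial.induction_on with
    | C a => rw [D2, hθC, hθC, hτ]
    | add p q hp hq => simp [hp, hq]
    | mul_X p i hp =>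
      have : DΩ (c i.1 i.2) = 0 := congrFun (congrFun hc0 i.1) i.2
      rw [D1, D3, mul_zero, zero_add, map_mul, hθX, hp, map_mul, hθX, DΩ.leibniz, this]
      simp
  -- kernel stability
  have hker : ∀ g, θ g = 0 → θ (eh g) = 0 := by
    let V : Submodule P (MvPolynomial (ι × ι) P) :=
      { carrier := {g | θ g = 0}
        zero_mem' := map_zero θ
        add_mem' := by intro a b ha hb; simp only [Set.mem_setOf_eq] at *; rw [map_add, ha, hb, add_zero]
        smul_mem' := by
          intro a b hb; simp only [Set.mem_setOf_eq] at *; rw [MvPolynomial.smul_eq_C_mul, map_mul, hb, mul_zero] }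
    let W : Submodule P (MvPolynomial (ι × ι) P) :=
      { carrier := {g | θ g = 0 ∧ θ (eh g) = 0}
        zero_mem' := by simp
        add_mem' := by
          intro a b ha hb; simp only [Set.mem_setOf_eq] at *; simp [ha, hb]
        smul_mem' := by
          intro a b hb; simp only [Set.mem_setOf_eq] at *; simp [MvPolynomial.smul_eq_C_mul, e1, hb] }
    intro g hg
    have h1 := constB (MvPolynomial.basisMonomials (ι × ι) P) {D} V (by
      rintro d rfl v hv
      refine ⟨Dh v, ?_, fun m => D4 m v⟩
      change θ (Dh v) = 0
      rw [hθD, show θ v = 0 from hv, map_zero]) g hg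
    have h2 : Submodule.span P {w | w ∈ V ∧ ∀ d ∈ ({D} : Set (Derivation ℤ P P)), ∀ i, d ((MvPolynomial.basisMonomials (ι × ι) P).repr w i) = 0} ≤ W := by
      rw [Submodule.span_le]
      rintro w ⟨hw, hw2⟩
      refine ⟨hw, ?_⟩
      have : eh w = 0 := by
        ext m
        rw [e4, MvPolynomial.coeff_zero]
        exact hε.1 _ (T.hc _ (hw2 D rfl m))
      rw [this, map_zero]
    exact (h2 h1).2
  let Q0 : Subring P :=
    { carrier := {q | ∃ g, θ g = σ q ∧ θ (eh g) = σ (ε q)}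
      zero_mem' := ⟨0, by simp⟩
      one_mem' := ⟨MvPolynomial.C 1, by rw [e2, hθC, hθC]; simp⟩
      add_mem' := by
        rintro a b ⟨g, h1, h2⟩ ⟨g', h3, h4⟩
        exact ⟨g + g', by simp [h1, h3], by simp [h2, h4]⟩
      neg_mem' := by
        rintro a ⟨g, h1, h2⟩
        exact ⟨-g, by simp [h1], by simp [h2]⟩
      mul_mem' := by
        rintro a b ⟨g, h1, h2⟩ ⟨g', h3, h4⟩
        exact ⟨g * g', by simp [h1, h3], by simp [e1, h1, h2, h3, h4]⟩ }
  have hLQ : ∀ l ∈ L, l ∈ Q0 := by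
    intro l hl
    refine ⟨MvPolynomial.C l, ?_, ?_⟩
    · rw [hθC, hag _ (hLF hl)]
    · rw [e2, hε.1 l hl]; simp
  have hΦQ : ∀ i j, Φ i j ∈ Q0 := by
    intro i j
    refine ⟨∑ t, MvPolynomial.C (Φ i t) * MvPolynomial.X (t, j), ?_, ?_⟩
    · have := congrFun (congrFun hc i) j
      simp only [Matrix.map_apply, Matrix.mul_apply] at this
      rw [this, map_sum]
      simp only [map_mul, hθC, hθX]
    · simp only [map_sum, e1, e3, e2, mul_zero, zero_add, map_mul, hθX, hθC]
      have h5 : (Φ.map ε).map σ = (Φ.map ε).map τ * c := by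
        rw [T.TG_spec, Matrix.map_mul, Matrix.map_mul, hc, Matrix.mul_assoc]
        congr 1
        ext i j; exact (hag _ (hLF (T.G_B hε i j))).symm
      have := congrFun (congrFun h5 i) j
      simp only [Matrix.map_apply, Matrix.mul_apply] at this
      rw [this]
      exact Finset.sum_congr rfl fun t _ => mul_comm _ _
  have hxx : x ∈ Subfield.closure (Q0 : Set P) :=
    T.hgen _ (fun l hl => Subfield.subset_closure (hLQ l hl)) (fun i j => Subfield.subset_closure (hΦQ i j)) x
  rw [Subfield.mem_closure_iff, Subring.closure_eq] at hxx
  obtain ⟨p, ⟨gp, p1, p2⟩, q, ⟨gq, q1, q2⟩, hpq⟩ := hxx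
  have hq : q ≠ 0 := by
    rintro rfl
    rw [div_zero] at hpq
    subst hpq; apply hy; simpa using zero_mem F
  have hp : p = x * q := by rw [← hpq]; field_simp
  have hx' := hag x hx
  have hk := hker (MvPolynomial.C x * gq - gp) (by
    rw [map_sub, map_mul, hθC, q1, p1, hp, map_mul, hx', sub_self])
  rw [map_sub, e1, e2, map_sub, map_add, map_mul, map_mul, hθC, hθC, q1, q2, p2, hp, hx'] at hk
  rw [ε.leibniz, smul_eq_mul, smul_eq_mul, map_add, map_mul, map_mul] at hk
  have : σ q * (τ (ε x) - σ (ε x)) = 0 := by linear_combination hk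
  rcases mul_eq_zero.1 this with h | h
  · exact hq (by simpa using h)
  · exact hne (sub_eq_zero.1 h)
end
end PVR
namespace PVR

section
variable {P : Type u} [Field P] [CharZero P]
variable {D : Derivation ℤ P P} {L K k : Subfield P}

theorem LD_inf (h : LD k K L) {β : Type*} (b : β → P) (hb : ∀ i, b i ∈ L) (hi : LinearIndependent k b) :
    LinearIndependent K b := by
  rw [linearIndependent_iff_finset_linearIndependent] at *
  intro s
  have h1 := hi s
  have h2 := h _ (b ∘ Subtype.val ∘ s.equivFin.symm) (fun i => hb _)
    (by rw [← Function.comp_assoc, linearIndependent_equiv]; exact h1)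
  rw [← Function.comp_assoc, linearIndependent_equiv] at h2
  exact h2

theorem alg_tower (hLD : LD k K L) (hkL : k ≤ L) (F0 : Subfield P) (hkF : k ≤ F0) (hFK : F0 ≤ K) (x : P) (hx : x ∈ K)
    (hxa : IsAlgebraic (F0 ⊔ L : Subfield P) x) : IsAlgebraic F0 x := by
  classical
  -- a basis of L over k
  obtain ⟨β, b, hbL, hbi, hbs⟩ : ∃ (β : Type u) (b : β → P), (∀ i, b i ∈ L) ∧ LinearIndependent k b ∧
      ∀ l ∈ L, l ∈ Submodule.span k (Set.range b) := by
    let W : Submodule k P :=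
      { carrier := L, zero_mem' := zero_mem _, add_mem' := fun h1 h2 => add_mem h1 h2
        smul_mem' := fun c y hy => mul_mem (hkL c.2) hy }
    let B := Module.Basis.ofVectorSpace k W
    refine ⟨_, fun i => (B i : P), fun i => (B i).2, ?_, ?_⟩
    · have := B.linearIndependent.map' W.subtype (by simp)
      exact this
    · intro l hl
      have h1 := B.mem_span (⟨l, hl⟩ : W)
      have h2 := Submodule.mem_map_of_mem (f := W.subtype) h1
      rw [Submodule.map_span, ← Set.range_comp] at h2
      exact h2
  have hspan : ∀ y ∈ Algebra.adjoin F0 (L : Set P), ∃ g : β →₀ F0, g.sum (fun i c => c • b i) = y := by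
    intro y hy
    have h1 := adjoin_le_span L.toSubmonoid F0 y hy
    rw [← Finsupp.mem_span_range_iff_exists_finsupp]
    refine (Submodule.span_le.2 ?_) h1
    intro l hl
    have h2 := hbs l hl
    clear hl
    induction h2 using Submodule.span_induction with
    | mem x hx => exact Submodule.subset_span hx
    | zero => exact zero_mem _
    | add x y _ _ h1 h2 => exact add_mem h1 h2
    | smul c x _ h => exact Submodule.smul_mem _ (⟨c, hkF c.2⟩ : F0) h
  have hbK := LD_inf hLD b hbL hbi
  -- relation
  have hrel : ∃ (n : ℕ) (y : ℕ → P), (∀ j, y j ∈ Algebra.adjoin F0 (L : Set P)) ∧ (∃ j < n, y j ≠ 0) ∧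
      ∑ j ∈ Finset.range n, y j * x ^ j = 0 := by
    obtain ⟨p, hp0, hp⟩ := hxa
    have hden : ∀ s : Finset ℕ, ∃ w ∈ Algebra.adjoin F0 (L : Set P), w ≠ 0 ∧
        ∀ j ∈ s, w * (p.coeff j : P) ∈ Algebra.adjoin F0 (L : Set P) := by
      intro s
      induction s using Finset.induction with
      | empty => exact ⟨1, one_mem _, one_ne_zero, by simp⟩
      | insert j s hj ih =>
        obtain ⟨w, h1, h2, h3⟩ := ih
        obtain ⟨w', h4, h5, h6⟩ := sup_frac L F0 (p.coeff j : P) (by rw [sup_comm]; exact (p.coeff j).2)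
        refine ⟨w * w', mul_mem h1 h4, mul_ne_zero h2 h5, ?_⟩
        intro t ht
        rcases Finset.mem_insert.1 ht with rfl | ht
        · rw [mul_assoc]; exact mul_mem h1 h6
        · rw [mul_right_comm]; exact mul_mem (h3 t ht) h4
    obtain ⟨w, h1, h2, h3⟩ := hden (Finset.range (p.natDegree + 1))
    refine ⟨p.natDegree + 1, fun j => if j < p.natDegree + 1 then w * p.coeff j else 0, ?_, ⟨p.natDegree, by simp, ?_⟩, ?_⟩
    · intro j
      dsimp only
      split_ifs with h
      · exact h3 j (Finset.mem_range.2 h)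
      · exact zero_mem _
    · simp only [Nat.lt_succ_self, if_true]
      simpa [h2] using hp0
    · rw [Polynomial.aeval_eq_sum_range] at hp
      have : ∑ j ∈ Finset.range (p.natDegree + 1), w * ((p.coeff j : P) * x ^ j) = 0 := by
        rw [← Finset.mul_sum]
        rw [show ∑ j ∈ Finset.range (p.natDegree + 1), ((p.coeff j : P) * x ^ j) = 0 from hp, mul_zero]
      refine Eq.trans (Finset.sum_congr rfl ?_) this
      intro j hj
      dsimp only
      rw [if_pos (Finset.mem_range.1 hj), mul_assoc]
  obtain ⟨n, y, hy, ⟨j0, hj0, hyj⟩, hsum⟩ := hrel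
  choose g hg using fun j => hspan (y j) (hy j)
  obtain ⟨t, ht⟩ : ∃ t, g j0 t ≠ 0 := by
    by_contra hcon
    push Not at hcon
    apply hyj
    rw [← hg j0, show g j0 = 0 from Finsupp.ext hcon]; simp
  -- regroup
  have hz : ∑ j ∈ Finset.range n, (g j t : P) * x ^ j = 0 := by
    let G : β →₀ K := ∑ j ∈ Finset.range n, (⟨x, hx⟩ : K) ^ j • (g j).mapRange (Subfield.inclusion hFK) (map_zero _)
    have hG : Finsupp.linearCombination K b G = 0 := by
      simp only [G, map_sum, map_smul]
      rw [← hsum]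
      apply Finset.sum_congr rfl
      intro j _
      have : Finsupp.linearCombination K b ((g j).mapRange (Subfield.inclusion hFK) (map_zero _)) = y j := by
        rw [Finsupp.linearCombination_apply, Finsupp.sum_mapRange_index (by simp), ← hg j]
        rfl
      rw [this, mul_comm]; rfl
    have := (linearIndependent_iff.1 hbK) G hG
    have h2 := congrArg (fun f : β →₀ K => ((f t : K) : P)) this
    simp [G] at h2
    rw [← h2]
    apply Finset.sum_congr rfl
    intro j _; rw [mul_comm]; rfl
  refine ⟨∑ j ∈ Finset.range n, Polynomial.monomial j (g j t), ?_, ?_⟩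
  · intro h
    have := congrArg (fun p : Polynomial F0 => p.coeff j0) h
    simp [Polynomial.coeff_monomial, hj0] at this
    exact ht this
  · simp only [map_sum, Polynomial.aeval_monomial]
    exact hz

/-- elements whose derivatives are K-combinations of those of the a_i -/
def Qder (K k : Subfield P) {m : ℕ} (a : Fin m → P) : Subfield P where
  carrier := {x | x ∈ K ∧ ∃ G : Fin m → P, (∀ i, G i ∈ K) ∧ ∀ δ : Derivation ℤ P P, Kil k δ → δ x = ∑ i, G i * δ (a i)}
  zero_mem' := ⟨zero_mem _, 0, fun i => zero_mem _, by simp⟩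
  one_mem' := ⟨one_mem _, 0, fun i => zero_mem _, by simp⟩
  add_mem' := by
    rintro x y ⟨hx, G, hG, h⟩ ⟨hy, G', hG', h'⟩
    refine ⟨add_mem hx hy, G + G', fun i => add_mem (hG i) (hG' i), fun δ hδ => ?_⟩
    simp [h δ hδ, h' δ hδ, add_mul, Finset.sum_add_distrib]
  neg_mem' := by
    rintro x ⟨hx, G, hG, h⟩
    refine ⟨neg_mem hx, -G, fun i => neg_mem (hG i), fun δ hδ => ?_⟩
    simp [h δ hδ]
  mul_mem' := by
    rintro x y ⟨hx, G, hG, h⟩ ⟨hy, G', hG', h'⟩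
    refine ⟨mul_mem hx hy, fun i => x * G' i + y * G i, fun i => add_mem (mul_mem hx (hG' i)) (mul_mem hy (hG i)), fun δ hδ => ?_⟩
    simp [h δ hδ, h' δ hδ, add_mul, Finset.sum_add_distrib, Finset.mul_sum, mul_assoc]
  inv_mem' := by
    rintro x ⟨hx, G, hG, h⟩
    refine ⟨inv_mem hx, fun i => - (x⁻¹) ^ 2 * G i, fun i => mul_mem (neg_mem (pow_mem (inv_mem hx) 2)) (hG i), fun δ hδ => ?_⟩
    rw [der_inv, h δ hδ, Finset.mul_sum]
    exact Finset.sum_congr rfl fun i _ => by ring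

theorem Qder_alg {m : ℕ} (a : Fin m → P) (F0 : Subfield P) (hF : F0 ≤ Qder K k a) (c : P) (hc : c ∈ K)
    (hca : IsAlgebraic F0 c) : c ∈ Qder K k a := by
  have hint := hca.isIntegral
  set p := minpoly F0 c with hp
  let p' : Polynomial P := p.map (algebraMap F0 P)
  have hsep : p'.derivative.eval c ≠ 0 := by
    have h1 : (minpoly F0 c).Separable := (minpoly.irreducible hint).separable
    have h2 := h1.aeval_derivative_ne_zero (minpoly.aeval F0 c)
    rwa [Polynomial.aeval_def, Polynomial.eval₂_eq_eval_map, ← Polynomial.derivative_map] at h2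
  have hp0 : p'.eval c = 0 := by
    have := minpoly.aeval F0 c
    rwa [Polynomial.aeval_def, Polynomial.eval₂_eq_eval_map] at this
  choose hK G hG hGd using fun j => hF (p.coeff j).2
  have hcK : ∀ j, (p.coeff j : P) ∈ K := hK
  have hd : p'.derivative.eval c ∈ K := by
    rw [Polynomial.eval_eq_sum_range]
    refine sum_mem fun j _ => mul_mem ?_ (pow_mem hc _)
    rw [Polynomial.coeff_derivative, Polynomial.coeff_map]
    exact mul_mem (hcK _) (by exact_mod_cast natCast_mem K (j + 1))
  refine ⟨hc, fun i => - (p'.derivative.eval c)⁻¹ * ∑ j ∈ p'.support, G j i * c ^ j, fun i => ?_, ?_⟩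
  · exact mul_mem (neg_mem (inv_mem hd)) (sum_mem fun j _ => mul_mem (hG j i) (pow_mem hc _))
  · intro δ hδ
    have h1 := der_eval δ p' c
    rw [hp0, map_zero, Polynomial.sum_def] at h1
    have h2 : ∑ j ∈ p'.support, δ (p'.coeff j) * c ^ j = ∑ i, (∑ j ∈ p'.support, G j i * c ^ j) * δ (a i) := by
      simp only [Finset.sum_mul]
      rw [Finset.sum_comm]
      refine Finset.sum_congr rfl fun j _ => ?_
      rw [Polynomial.coeff_map]
      have := hGd j δ hδ
      rw [show δ (algebraMap F0 P (p.coeff j)) = _ from this, Finset.sum_mul]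
      exact Finset.sum_congr rfl fun i _ => by ring
    rw [h2] at h1
    simp only [mul_assoc]
    rw [← Finset.mul_sum]
    field_simp
    linear_combination -h1

theorem Qder_dst (hk : DSt D k) (hK : DSt D K) {m : ℕ} (a : Fin m → P) (ha : ∀ i, D (a i) ∈ Qder K k a) :
    DSt D (Qder K k a) := by
  rintro x ⟨hx, G, hG, h⟩
  choose _ H hH hHd using ha
  refine ⟨hK x hx, fun i => D (G i) + ∑ j, G j * H j i, fun i => add_mem (hK _ (hG i)) (sum_mem fun j _ => mul_mem (hG j) (hH j i)), ?_⟩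
  intro δ hδ
  have h1 := h _ (kil_lie (L := k) hk hδ)
  rw [Derivation.commutator_apply, h δ hδ] at h1
  simp only [Derivation.commutator_apply, map_sum, D.leibniz, smul_eq_mul, hHd _ δ hδ] at h1
  simp only [add_mul, Finset.sum_add_distrib, Finset.sum_mul]
  rw [Finset.sum_comm]
  have e : ∑ y, ∑ x, G y * H y x * δ (a x) = ∑ y, G y * ∑ x, H y x * δ (a x) := by
    simp only [Finset.mul_sum, mul_assoc]
  rw [e]
  have e2 : ∑ i, D (G i) * δ (a i) = ∑ i, δ (a i) * D (G i) := Finset.sum_congr rfl fun i _ => mul_comm _ _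
  rw [e2]
  simp only [mul_sub, Finset.sum_sub_distrib, Finset.sum_add_distrib] at h1
  linear_combination -h1
end
end PVR
namespace PVR

section
variable {P : Type u} [Field P] [CharZero P] {ι : Type} [Fintype ι] [DecidableEq ι]
variable {D : Derivation ℤ P P} {k K L : Subfield P} {Φ A : Matrix ι ι P}

theorem der_sum {σ : Type*} [Fintype σ] (c : σ → P) (ε : σ → Derivation ℤ P P) (x : P) :
    (∑ s, c s • ε s) x = ∑ s, c s * ε s x := by
  let e : Derivation ℤ P P →ₗ[P] P := { toFun := fun δ => δ x, map_add' := fun _ _ => rfl, map_smul' := fun _ _ => rfl }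
  exact (map_sum e (fun s => c s • ε s) Finset.univ)

theorem Tor.stab (T : Tor D L Φ A) (a : ℕ → P) : ∃ m, ∀ δ : Derivation ℤ P P, Kil L δ → (∀ i < m, δ (a i) = 0) →
    δ (a m) = 0 := by
  let S : ℕ → Set P := fun m => (L : Set P) ∪ {x | ∃ i < m, x = a i}
  let U : ℕ →o (Submodule P (Matrix ι ι P))ᵒᵈ :=
    { toFun := fun m => OrderDual.toDual ((kilSub (S m)).map (TR Φ))
      monotone' := by
        intro m n hmn
        change (kilSub (S n)).map (TR Φ) ≤ (kilSub (S m)).map (TR Φ)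
        apply Submodule.map_mono
        intro δ hδ x hx
        apply hδ
        rcases hx with hx | ⟨i, hi, rfl⟩
        · exact Or.inl hx
        · exact Or.inr ⟨i, by omega, rfl⟩ }
  obtain ⟨m, hm⟩ := IsArtinian.monotone_stabilizes U
  refine ⟨m, fun δ h1 h2 => ?_⟩
  have h3 : (kilSub (S m)).map (TR Φ) = (kilSub (S (m+1))).map (TR Φ) := hm (m+1) (by omega)
  have h4 : TR Φ δ ∈ (kilSub (S m)).map (TR Φ) := ⟨δ, by
    rintro x (hx | ⟨i, hi, rfl⟩)
    · exact h1 x hx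
    · exact h2 i hi, rfl⟩
  rw [h3] at h4
  obtain ⟨δ', h5, h6⟩ := h4
  have : δ - δ' = 0 := T.ext ((kilSub (L : Set P)).sub_mem h1 (fun x hx => h5 x (Or.inl hx))) (by
    rw [T.TR_spec, map_sub, h6, sub_self, Matrix.mul_zero])
  rw [sub_eq_zero.1 this]
  exact h5 _ (Or.inr ⟨m, by omega, rfl⟩)

/-- finitely many elements of K control derivations -/
theorem Tor.coords (hk : DSt D k) (hK : DSt D K) (hkK : k ≤ K) (hP : PP D K k) (T : Tor D (Qa D k) Φ A)
    (a : P) (ha : a ∈ K) (hgen : ∀ F : Subfield P, DSt D F → k ≤ F → a ∈ F → K ≤ F) :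
    ∃ (m : ℕ) (b : Fin m → P), (∀ i, b i ∈ K) ∧ K ≤ Qder K k b := by
  obtain ⟨m, hm⟩ := T.stab (fun i => D^[i] a)
  have haK : ∀ i, D^[i] a ∈ K := by
    intro i
    induction i with
    | zero => exact ha
    | succ i ih => rw [Function.iterate_succ_apply']; exact hK _ ih
  let b : Fin m → P := fun i => D^[i] a
  let F0 : Subfield P := Subfield.closure ((k : Set P) ∪ Set.range b)
  have hkF : k ≤ F0 := fun x hx => Subfield.subset_closure (Or.inl hx)
  have hbF : ∀ i, b i ∈ F0 := fun i => Subfield.subset_closure (Or.inr ⟨i, rfl⟩)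
  have hF0K : F0 ≤ K := by
    rw [Subfield.closure_le]
    rintro x (hx | ⟨i, rfl⟩)
    · exact hkK hx
    · exact haK _
  have halg : IsAlgebraic F0 (D^[m] a) := by
    apply alg_tower (LD_Qa hk hK hkK hP) (le_Qa hk) F0 hkF hF0K _ (haK m)
    apply alg_of_kil
    intro δ hδ
    apply hm δ (fun x hx => hδ x (le_sup_right (a := F0) hx))
    intro i hi
    exact hδ _ (le_sup_left (a := F0) (hbF ⟨i, hi⟩))
  have hkQ : k ≤ Qder K k b := fun x hx => ⟨hkK hx, 0, fun i => zero_mem _, fun δ hδ => by simp [hδ x hx]⟩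
  have hbQ : ∀ i, b i ∈ Qder K k b := fun i =>
    ⟨haK _, Pi.single i 1, fun j => by
      by_cases h : j = i
      · subst h; simp
      · rw [Pi.single_eq_of_ne h]; exact zero_mem _, fun δ hδ => by simp [Pi.single_apply]⟩
  have hFQ : F0 ≤ Qder K k b := by
    rw [Subfield.closure_le]
    rintro x (hx | ⟨i, rfl⟩)
    · exact hkQ hx
    · exact hbQ i
  have hmQ : D^[m] a ∈ Qder K k b := Qder_alg b F0 hFQ _ (haK m) halg
  refine ⟨m, b, fun i => haK i, hgen _ (Qder_dst hk hK b ?_) hkQ ?_⟩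
  · intro i
    have e : D (b i) = D^[(i : ℕ) + 1] a := (Function.iterate_succ_apply' _ _ _).symm
    rw [e]
    rcases Nat.lt_or_ge ((i : ℕ) + 1) m with h | h
    · exact hbQ ⟨_, h⟩
    · have : (i : ℕ) + 1 = m := by omega
      rw [this]; exact hmQ
  · rcases Nat.eq_zero_or_pos m with h | h
    · subst h; exact hmQ
    · exact hbQ ⟨0, h⟩

/-- step (N) -/
theorem Tor.stepN (hk : DSt D k) (hK : DSt D K) (hkK : k ≤ K) (hP : PP D K k) (T : Tor D (Qa D k) Φ A)
    (a : P) (ha : a ∈ K) (hgen : ∀ F : Subfield P, DSt D F → k ≤ F → a ∈ F → K ≤ F)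
    (x : P) (hx : ∀ ε, IsG (Qa D k) Φ ε → Kil K ε → ε x = 0) : IsAlgebraic (K ⊔ Qa D k : Subfield P) x := by
  obtain ⟨m, b, hb, hQ⟩ := T.coords hk hK hkK hP a ha hgen
  have hkL : k ≤ Qa D k := le_Qa hk
  have hkil : ∀ δ : Derivation ℤ P P, Kil (Qa D k) δ → Kil k δ := fun δ h x hx => h x (hkL hx)
  have hvK : ∀ δ : Derivation ℤ P P, Kil k δ → (∀ i, δ (b i) = 0) → Kil K δ := by
    intro δ h1 h2 y hy
    obtain ⟨_, G, hG, h⟩ := hQ hy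
    rw [h δ h1]; simp [h2]
  choose _ G hG hGd using fun i => hQ (hK _ (hb i))
  obtain ⟨n, ε, hε, hspan⟩ := T.G_fin
  let v : Derivation ℤ P P →ₗ[P] (Fin m → P) :=
    { toFun := fun δ i => δ (b i), map_add' := fun _ _ => rfl, map_smul' := fun _ _ => rfl }
  have hv : ∀ δ i, v δ i = δ (b i) := fun _ _ => rfl
  obtain ⟨q, s, r, hind, hr, hrs⟩ := extract (k := Qa D k) (fun t => v (ε t))
  have hvr : ∀ t, v (ε t) = ∑ l, (r t l : P) • v (ε (s l)) := hr
  have hJ : LinearIndependent P (fun l => v (ε (s l))) := by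
    choose c hc hce using fun l => hspan _ (T.lieG (hε (s l)))
    refine JL hk hK hkK hP G hG _ ?_ hind (fun l l' => ∑ t, c l t * r t l') ?_ ?_
    · intro l i
      exact T.F3 (K ⊔ Qa D k) (dst_sup D _ _ hK dst_Qa) le_sup_right (hε _) _ (le_sup_left (b := Qa D k) (hb i))
    · intro l l'
      exact sum_mem fun t _ => mul_mem (hc _ _) (SetLike.coe_mem _)
    · intro l i
      have h1 : v ⁅D, ε (s l)⁆ i = ∑ l', (∑ t, c l t * r t l') * v (ε (s l')) i := by
        rw [hce l, map_sum]
        simp only [map_smul, Finset.sum_apply, Pi.smul_apply, smul_eq_mul, Finset.sum_mul]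
        rw [Finset.sum_comm]
        apply Finset.sum_congr rfl
        intro t _
        have := congrFun (hvr t) i
        rw [this]
        simp [Finset.mul_sum, mul_assoc]
      rw [← h1, hv ⁅D, ε (s l)⁆, Derivation.commutator_apply, hGd i _ (hkil _ (hε _).1)]
      rfl
  apply alg_of_kil
  intro δ hδ
  have hδL : Kil (Qa D k) δ := fun x hx => hδ x (le_sup_right (a := K) hx)
  have hδK : Kil K δ := fun x hx => hδ x (le_sup_left (b := Qa D k) hx)
  have h1 : δ ∈ Submodule.span P (Set.range ε) := by
    refine (Submodule.span_le.2 ?_) (T.spanG hδL)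
    intro ε' hε'
    obtain ⟨c, _, rfl⟩ := hspan ε' hε'
    exact sum_mem fun t _ => Submodule.smul_mem _ _ (Submodule.subset_span ⟨t, rfl⟩)
  rw [Submodule.mem_span_range_iff_exists_fun] at h1
  obtain ⟨p, hp⟩ := h1
  have h2 : ∀ l, ∑ t, p t * r t l = 0 := by
    apply Fintype.linearIndependent_iff.1 hJ
    have : v δ = 0 := by ext i; exact hδK _ (hb i)
    rw [← this, ← hp, map_sum]
    simp only [map_smul, Finset.sum_smul]
    rw [Finset.sum_comm]
    apply Finset.sum_congr rfl
    intro t _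
    rw [hvr t, Finset.smul_sum]
    simp only [smul_smul]
  have h3 : ∀ t, ε t x = ∑ l, (r t l : P) * ε (s l) x := by
    intro t
    have hG1 : IsG (Qa D k) Φ (ε t + (-1 : P) • ∑ l, (r t l : P) • ε (s l)) :=
      T.G_add (hε t) (T.G_smul (T.G_sum _ (fun l => hε _) _ fun l => SetLike.coe_mem _) (neg_mem (one_mem _)))
    have := hx _ hG1 (hvK _ (hkil _ hG1.1) (by
      intro i
      rw [← hv, map_add, map_smul, map_sum, hvr t]
      simp only [map_smul]
      simp))
    rw [Derivation.add_apply, Derivation.smul_apply, der_sum, smul_eq_mul] at this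
    linear_combination this
  rw [← hp]
  rw [der_sum]
  rw [Finset.sum_congr rfl fun t _ => by rw [h3 t, Finset.mul_sum]]
  rw [Finset.sum_comm]
  apply Finset.sum_eq_zero
  intro l _
  rw [← zero_mul (ε (s l) x), ← h2 l, Finset.sum_mul]
  exact Finset.sum_congr rfl fun t _ => by ring
end
end PVR
namespace PVR

/-- dual number hom of a derivation -/
def dualHom {P : Type*} [CommRing P] (δ : Derivation ℤ P P) : P →+* TrivSqZeroExt P P where
  toFun x := TrivSqZeroExt.inl x + TrivSqZeroExt.inr (δ x)
  map_one' := by ext <;> simp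
  map_zero' := by ext <;> simp
  map_mul' := by intro x y; ext <;> simp [mul_comm, add_comm]
  map_add' := by intro x y; ext <;> simp

theorem det_der {P ι : Type*} [CommRing P] [Fintype ι] [DecidableEq ι] (δ : Derivation ℤ P P)
    (Y M : Matrix ι ι P) (h : Y.map δ = Y * M) : δ Y.det = M.trace * Y.det := by
  let r : TrivSqZeroExt P P := TrivSqZeroExt.inr 1
  let e : P →+* TrivSqZeroExt P P := TrivSqZeroExt.inlHom P P
  have h1 : Y.map (dualHom δ) = Y.map e * (1 + r • M.map e) := by
    have h2 : Y.map (dualHom δ) = Y.map e + r • (Y * M).map e := by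
      rw [← h]
      ext i j
      · simp [dualHom, e, r]
      · simp [dualHom, e, r]
    rw [h2, Matrix.map_mul, Matrix.mul_add, Matrix.mul_one, Matrix.mul_smul]
  have h3 := congrArg Matrix.det h1
  rw [Matrix.det_mul, Matrix.det_one_add_smul] at h3
  have h4 : r ^ 2 = 0 := by ext <;> simp [r, pow_two]
  rw [h4, mul_zero, add_zero] at h3
  have h5 : (Y.map (dualHom δ)).det = dualHom δ Y.det := (RingHom.map_det (dualHom δ) Y).symm
  have h6 : (Y.map e).det = e Y.det := (RingHom.map_det e Y).symm
  have h7 : (M.map e).trace = e M.trace := (AddMonoidHom.map_trace e.toAddMonoidHom M).symm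
  rw [h5, h6, h7] at h3
  have h8 := congrArg TrivSqZeroExt.snd h3
  simp [dualHom, e, r] at h8
  rw [h8, mul_comm]

section
variable {P : Type u} [Field P] [CharZero P] {ι : Type} [Fintype ι] [DecidableEq ι]
variable {D : Derivation ℤ P P} {k K L : Subfield P} {Φ A : Matrix ι ι P}

inductive IsU (D : Derivation ℤ P P) (L : Subfield P) (Φ : Matrix ι ι P) : (P → P) → Prop
  | id : IsU D L Φ (fun x => x)
  | comp (ρ : Derivation ℤ P P) (f : P → P) : IsR D L Φ ρ → IsU D L Φ f → IsU D L Φ (fun x => ρ (f x))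

theorem IsU.add {f : P → P} (h : IsU D L Φ f) (x y : P) : f (x + y) = f x + f y := by
  induction h with
  | id => rfl
  | comp ρ f _ _ ih => simp [ih]

theorem IsU.mul {f : P → P} (h : IsU D L Φ f) (c x : P) (hc : c ∈ L) : f (c * x) = c * f x := by
  induction h with
  | id => rfl
  | comp ρ f hρ _ ih => simp [ih, hρ.1 c hc]

theorem IsU.zero {f : P → P} (h : IsU D L Φ f) : f 0 = 0 := by
  induction h with
  | id => rfl
  | comp ρ f _ _ ih => simp [ih]

theorem IsU.sum {σ : Type*} [Fintype σ] {f : P → P} (h : IsU D L Φ f) (c : σ → P) (hc : ∀ i, c i ∈ L) (x : σ → P) :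
    f (∑ i, c i * x i) = ∑ i, c i * f (x i) := by
  let g : P →+ P := { toFun := f, map_zero' := h.zero, map_add' := h.add }
  have : g (∑ i, c i * x i) = ∑ i, g (c i * x i) := map_sum g _ _
  rw [show f (∑ i, c i * x i) = g (∑ i, c i * x i) from rfl, this]
  exact Finset.sum_congr rfl fun i _ => h.mul _ _ (hc i)

theorem IsU.commD (T : Tor D L Φ A) {f : P → P} (h : IsU D L Φ f) (x : P) : D (f x) = f (D x) := by
  induction h with
  | id => rfl
  | comp ρ f hρ _ ih => simp [T.comm_RD hρ, ih]

theorem IsU.commG (T : Tor D L Φ A) {ε : Derivation ℤ P P} (hε : IsG L Φ ε) {f : P → P} (h : IsU D L Φ f) (x : P) :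
    ε (f x) = f (ε x) := by
  induction h with
  | id => rfl
  | comp ρ f hρ _ ih => simp [← T.comm_RG hρ hε, ih]

theorem IsU.lin (T : Tor D L Φ A) {f : P → P} (h : IsU D L Φ f) {y : P} (hy : IsLin D L y) : IsLin D L (f y) := by
  obtain ⟨V, hV, hVD, hyV⟩ := hy
  let g : P →ₗ[L] P := { toFun := f, map_add' := h.add, map_smul' := fun c x => h.mul c x c.2 }
  refine ⟨V.map g, hV.map g, ?_, ⟨y, hyV, rfl⟩⟩
  rintro _ ⟨v, hv, rfl⟩
  exact ⟨D v, hVD v hv, (h.commD T v).symm⟩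

/-- Wronskian lemma -/
theorem Tor.wronsk (T : Tor D L Φ A) {d : ℕ} (y : Fin d → P) (hy : LinearIndependent L y) (hd : 0 < d) :
    ∃ u : Fin d → P → P, (∀ i, IsU D L Φ (u i)) ∧ (Matrix.of fun i j => u i (y j)).det ≠ 0 ∧
      ∃ i0, u i0 = fun x => x := by
  let row : (P → P) → (Fin d → P) := fun f j => f (y j)
  let R : Set (Fin d → P) := row '' {f | IsU D L Φ f}
  let V : Submodule P (Fin d → P) :=
    { carrier := {v | ∀ f, IsU D L Φ f → ∑ j, v j * f (y j) = 0}
      add_mem' := by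
        intro a b ha hb f hf
        simp [add_mul, Finset.sum_add_distrib, ha f hf, hb f hf]
      zero_mem' := by intro f hf; simp
      smul_mem' := by
        intro c a ha f hf
        simp [mul_assoc, ← Finset.mul_sum, ha f hf] }
  have hV : V = ⊥ := by
    rw [eq_bot_iff]
    intro v hv
    have h1 := constB (Pi.basisFun P (Fin d)) {ρ | IsR D L Φ ρ} V (by
      intro ρ hρ v hv
      refine ⟨fun j => ρ (v j), ?_, ?_⟩
      · intro f hf
        have e1 := congrArg ρ (hv f hf)
        rw [map_zero, map_sum] at e1
        simp only [Derivation.leibniz, smul_eq_mul, Finset.sum_add_distrib] at e1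
        rw [hv _ (IsU.comp ρ f hρ hf), zero_add] at e1
        rw [← e1]
        exact Finset.sum_congr rfl fun j _ => mul_comm _ _
      · intro i; simp) v hv
    have h2 : {w | w ∈ V ∧ ∀ ρ ∈ {ρ | IsR D L Φ ρ}, ∀ i, ρ ((Pi.basisFun P (Fin d)).repr w i) = 0} ⊆ {0} := by
      rintro w ⟨hw, hw2⟩
      have hwL : ∀ i, w i ∈ L := fun i => T.inL _ fun ρ hρ => by simpa using hw2 ρ hρ i
      have := Fintype.linearIndependent_iff.1 hy (fun i => ⟨w i, hwL i⟩) (hw _ IsU.id)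
      ext i
      exact congrArg Subtype.val (this i)
    have := Submodule.span_mono (R := P) h2 h1
    simpa using this
  have hR : Submodule.span P R = ⊤ := by
    by_contra hne
    obtain ⟨φ, hφ0, hφ⟩ := Submodule.exists_le_ker_of_lt_top _ (lt_top_iff_ne_top.2 hne)
    apply hφ0
    have hv : (fun j => φ (Pi.single j 1)) ∈ V := by
      intro f hf
      have : row f ∈ LinearMap.ker φ := hφ (Submodule.subset_span ⟨f, hf, rfl⟩)
      rw [LinearMap.mem_ker, LinearMap.pi_apply_eq_sum_univ φ] at this
      rw [← this]
      exact Finset.sum_congr rfl fun j _ => by rw [smul_eq_mul, mul_comm]; congr 1; exact congrArg φ (funext fun l => by simp [Pi.single_apply, eq_comm])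
    rw [hV, Submodule.mem_bot] at hv
    ext j
    simpa using congrFun hv j
  have hrow0 : row (fun x => x) ≠ 0 := by
    intro h
    exact hy.ne_zero ⟨0, hd⟩ (congrFun h ⟨0, hd⟩)
  obtain ⟨b, hb1, hb2, hb3, hb4⟩ := exists_linearIndepOn_extension (K := P) (v := id) (s := {row (fun x => x)}) (t := R)
    (by rw [linearIndepOn_singleton_iff]; exact hrow0) (by rintro _ rfl; exact ⟨_, IsU.id, rfl⟩)
  have hbs : Submodule.span P b = ⊤ := by
    rw [eq_top_iff, ← hR]
    apply Submodule.span_le.2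
    simpa using hb3
  have hli : LinearIndependent P (Subtype.val : b → (Fin d → P)) := hb4
  let bas : Module.Basis b P (Fin d → P) := Module.Basis.mk hli (by simp [hbs])
  haveI : Finite b := Module.Finite.finite_basis bas
  haveI := Fintype.ofFinite b
  have hcard : Fintype.card b = d := by
    rw [← Module.finrank_eq_card_basis bas]; simp
  let e : Fin d ≃ b := (Fintype.equivFinOfCardEq hcard).symm
  choose u hu hur using fun i => hb1 (e i).2
  let i0 := e.symm ⟨_, hb2 rfl⟩
  classical
  let u' : Fin d → P → P := fun i => if i = i0 then fun x => x else u i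
  have hu' : ∀ i, row (u' i) = (e i).1 := by
    intro i
    by_cases h : i = i0
    · simp only [u', h, if_true]; simp [i0]
    · simp only [u', h, if_false]; exact hur i
  refine ⟨u', ?_, ?_, i0, by simp [u']⟩
  · intro i
    by_cases h : i = i0
    · simp only [u', h, if_true]; exact IsU.id
    · simp only [u', h, if_false]; exact hu i
  · have h1 : LinearIndependent P (Matrix.of fun i j => u' i (y j)).row := by
      have : (Matrix.of fun i j => u' i (y j)).row = (Subtype.val : b → (Fin d → P)) ∘ e := by
        funext i; exact hu' i
      rw [this]
      exact hli.comp _ e.injective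
    rw [Matrix.linearIndependent_rows_iff_isUnit, Matrix.isUnit_iff_isUnit_det] at h1
    exact h1.ne_zero
end
end PVR
namespace PVR
section
variable {P : Type u} [Field P] [CharZero P] {ι : Type} [Fintype ι] [DecidableEq ι]
variable {D : Derivation ℤ P P} {k K L : Subfield P} {Φ A : Matrix ι ι P}

theorem subring_det_mem {R σ : Type*} [CommRing R] [Fintype σ] [DecidableEq σ] (S : Subring R) (G : Matrix σ σ R)
    (hG : ∀ i j, G i j ∈ S) : G.det ∈ S := by
  rw [Matrix.det_apply]
  refine sum_mem (fun τ _ => ?_)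
  rw [Units.smul_def]
  exact zsmul_mem (prod_mem fun i _ => hG _ _) _

theorem span_coef {σ : Type*} [Fintype σ] (b : σ → P) (p : σ → Prop) (v : P)
    (hv : v ∈ Submodule.span L {x | ∃ i, p i ∧ x = b i}) :
    ∃ c : σ → P, (∀ i, c i ∈ L) ∧ (∀ i, ¬ p i → c i = 0) ∧ v = ∑ i, c i * b i := by
  classical
  induction hv using Submodule.span_induction with
  | mem x hx =>
    obtain ⟨i, hi, rfl⟩ := hx
    refine ⟨Pi.single i 1, ?_, ?_, ?_⟩
    · intro j
      by_cases h : j = i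
      · subst h; simp
      · rw [Pi.single_eq_of_ne h]; exact zero_mem _
    · intro j hj
      rw [Pi.single_eq_of_ne]
      rintro rfl; exact hj hi
    · simp [Pi.single_apply]
  | zero => exact ⟨0, fun _ => zero_mem _, fun _ _ => rfl, by simp⟩
  | add x y _ _ hx hy =>
    obtain ⟨c, h1, h2, h3⟩ := hx
    obtain ⟨c', h1', h2', h3'⟩ := hy
    refine ⟨c + c', fun i => add_mem (h1 i) (h1' i), fun i hi => ?_, ?_⟩
    · simp [h2 i hi, h2' i hi]
    · simp [h3, h3', add_mul, Finset.sum_add_distrib]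
  | smul a x _ hx =>
    obtain ⟨c, h1, h2, h3⟩ := hx
    refine ⟨fun i => a * c i, fun i => mul_mem a.2 (h1 i), fun i hi => ?_, ?_⟩
    · simp [h2 i hi]
    · rw [h3, Subfield.smul_def, smul_eq_mul, Finset.mul_sum]
      exact Finset.sum_congr rfl fun i _ => (mul_assoc _ _ _).symm

theorem detU {d : ℕ} (u : Fin d → P → P) (hu : ∀ i, IsU D L Φ (u i)) (δ : Derivation ℤ P P)
    (hδ : ∀ f, IsU D L Φ f → ∀ x, δ (f x) = f (δ x)) (y : Fin d → P) (M : Matrix (Fin d) (Fin d) P)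
    (hM : ∀ i j, M i j ∈ L) (h : ∀ j, δ (y j) = ∑ l, M l j * y l) :
    δ (Matrix.of fun i j => u i (y j)).det = M.trace * (Matrix.of fun i j => u i (y j)).det := by
  apply det_der
  ext i j
  rw [Matrix.mul_apply, Matrix.map_apply, Matrix.of_apply, hδ _ (hu i), h j, (hu i).sum _ (fun l => hM l j)]
  exact Finset.sum_congr rfl fun l _ => mul_comm _ _

theorem lin_order (V : Submodule L P) (hV : V.FG) (hVD : ∀ v ∈ V, D v ∈ V) (y : P) (hy : y ∈ V) :
    ∃ m, D^[m] y ∈ Submodule.span L {x | ∃ i < m, x = D^[i] y} := by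
  haveI : Module.Finite L V := Module.Finite.iff_fg.2 hV
  have hyV : ∀ i, D^[i] y ∈ V := by
    intro i
    induction i with
    | zero => exact hy
    | succ i ih => rw [Function.iterate_succ_apply']; exact hVD _ ih
  let U : ℕ →o Submodule L V :=
    { toFun := fun m => (Submodule.span L {x | ∃ i < m, x = D^[i] y}).comap V.subtype
      monotone' := by
        intro m n hmn
        apply Submodule.comap_mono
        apply Submodule.span_mono
        rintro x ⟨i, hi, rfl⟩
        exact ⟨i, by omega, rfl⟩ }
  obtain ⟨m, hm⟩ := monotone_stabilizes_iff_noetherian.2 inferInstance U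
  refine ⟨m, ?_⟩
  have h1 : (⟨_, hyV m⟩ : V) ∈ U (m+1) := Submodule.subset_span ⟨m, by omega, rfl⟩
  rw [← hm (m+1) (by omega)] at h1
  exact h1

theorem lin_order_min (y : P) (hy : IsLin D L y) :
    ∃ m, D^[m] y ∈ Submodule.span L {x | ∃ i < m, x = D^[i] y} ∧
      LinearIndependent L (fun i : Fin m => D^[i] y) := by
  classical
  obtain ⟨V, hV, hVD, hyV⟩ := hy
  have hex := lin_order V hV hVD y hyV
  refine ⟨Nat.find hex, Nat.find_spec hex, ?_⟩
  have : ∀ j ≤ Nat.find hex, LinearIndependent L (fun i : Fin j => D^[i] y) := by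
    intro j
    induction j with
    | zero => intro _; exact linearIndependent_empty_type
    | succ j ih =>
      intro hj
      rw [linearIndependent_fin_succ']
      refine ⟨ih (by omega), ?_⟩
      have := Nat.find_min hex (m := j) (by omega)
      have e : Set.range (Fin.init fun i : Fin (j+1) => D^[i] y) = {x | ∃ i < j, x = D^[i] y} := by
       ext x
       constructor
       · rintro ⟨i, rfl⟩; exact ⟨i, i.2, rfl⟩
       · rintro ⟨i, hi, rfl⟩; exact ⟨⟨i, hi⟩, rfl⟩
      rw [e]
      exact this
  exact this _ le_rfl

theorem nu_filter (hL : DSt D L) (Nn : Set (Derivation ℤ P P)) (hNL : ∀ ν ∈ Nn, Kil L ν) (hN : ∀ ν ∈ Nn, ⁅D, ν⁆ ∈ Nn) (y : P)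
    (hy : ∀ ν ∈ Nn, ∃ χ ∈ L, ν y = χ * y) (j : ℕ) :
    ∀ ν ∈ Nn, ∀ χ ∈ L, ν y = χ * y → ν (D^[j] y) - χ * D^[j] y ∈ Submodule.span L {x | ∃ i < j, x = D^[i] y} := by
  have hS : ∀ (j : ℕ), ∀ c ∈ L, c * D^[j] y ∈ Submodule.span L {x | ∃ i < j+1, x = D^[i] y} := fun j c hc =>
    Submodule.smul_mem _ (⟨c, hc⟩ : L) (Submodule.subset_span ⟨j, by omega, rfl⟩)
  have hle : ∀ (j : ℕ), Submodule.span L {x | ∃ i < j, x = D^[i] y} ≤ Submodule.span L {x | ∃ i < j+1, x = D^[i] y} := by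
    intro j
    apply Submodule.span_mono
    rintro x ⟨i, hi, rfl⟩
    exact ⟨i, by omega, rfl⟩
  have hDS : ∀ (j : ℕ), ∀ v ∈ Submodule.span L {x | ∃ i < j, x = D^[i] y}, D v ∈ Submodule.span L {x | ∃ i < j+1, x = D^[i] y} := by
    intro j v hv
    induction hv using Submodule.span_induction with
    | mem x hx =>
      obtain ⟨i, hi, rfl⟩ := hx
      exact Submodule.subset_span ⟨i+1, by omega, (Function.iterate_succ_apply' _ _ _).symm⟩
    | zero => rw [map_zero]; exact zero_mem _
    | add x y _ _ hx hy => rw [map_add]; exact add_mem hx hy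
    | smul a x h1 hx =>
      rw [Subfield.smul_def, smul_eq_mul, D.leibniz, smul_eq_mul, smul_eq_mul, mul_comm x]
      exact add_mem (Submodule.smul_mem _ a hx) (Submodule.smul_mem _ (⟨_, hL _ a.2⟩ : L) (hle j h1))
  induction j with
  | zero => intro ν hν χ hχ h; simp [h]
  | succ j ih =>
    intro ν hν χ hχ h
    obtain ⟨χ', hχ', h'⟩ := hy _ (hN ν hν)
    have e1 := ih _ (hN ν hν) χ' hχ' h'
    have e2 := hDS j _ (ih ν hν χ hχ h)
    rw [Derivation.commutator_apply] at e1
    rw [map_sub, D.leibniz, smul_eq_mul, smul_eq_mul] at e2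
    rw [Function.iterate_succ_apply']
    have e3 := hS j _ hχ'
    have e4 := hS j _ (hL _ hχ)
    have := sub_mem (add_mem e2 e4) (add_mem (hle j e1) e3)
    convert this using 1
    ring

theorem Tor.endC0 (hk : DSt D k) (hK : DSt D K) (hkK : k ≤ K) (hP : PP D K k) (T : Tor D (Qa D k) Φ A)
    (a : P) (ha : a ∈ K) (hgen : ∀ F : Subfield P, DSt D F → k ≤ F → a ∈ F → K ≤ F)
    (W : Submodule (Qa D k) P) (hW : W.FG) (hWD : ∀ v ∈ W, D v ∈ W)
    (hWG : ∀ ε, IsG (Qa D k) Φ ε → ∀ v ∈ W, ε v ∈ W) (y0 : P) (hy0 : y0 ≠ 0) (hy0W : y0 ∈ W) (hay0 : a * y0 ∈ W) :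
    a ∈ k := by
  have hLD : DSt D (Qa D k) := dst_Qa
  have hWL : ∀ v ∈ W, IsLin D (Qa D k) v := fun v hv => ⟨W, hW, hWD, hv⟩
  let Nn : Set (Derivation ℤ P P) := {ν | IsG (Qa D k) Φ ν ∧ Kil K ν}
  have hNN : ∀ ν ∈ Nn, ⁅D, ν⁆ ∈ Nn := fun ν hν => ⟨T.lieG hν.1, kil_lie hK hν.2⟩
  let Y : Submodule (Qa D k) P := W ⊓ W.comap (LinearMap.mulLeft (Qa D k) a)
  have hYN : ∀ ν ∈ Nn, ∀ v ∈ Y, ν v ∈ Y := by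
    rintro ν hν v ⟨h1, h2⟩
    refine ⟨hWG ν hν.1 v h1, ?_⟩
    have h3 := hWG ν hν.1 _ h2
    rw [LinearMap.mulLeft_apply, ν.leibniz, hν.2 a ha, smul_zero, add_zero] at h3
    exact h3
  haveI : Module.Finite (Qa D k) W := Module.Finite.iff_fg.2 hW
  haveI : Module.Finite (Qa D k) Y := Submodule.finiteDimensional_of_le (inf_le_left : Y ≤ W)
  let bY := Module.finBasis (Qa D k) Y
  let d := Module.finrank (Qa D k) Y
  have hd : 0 < d := by
    haveI : Nontrivial Y := ⟨⟨⟨y0, hy0W, hay0⟩, 0, fun h => hy0 (congrArg Subtype.val h)⟩⟩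
    exact Module.finrank_pos
  let y : Fin d → P := fun j => (bY j : P)
  have hyli : LinearIndependent (Qa D k) y := bY.linearIndependent.map' Y.subtype (by simp)
  have hrepr : ∀ v ∈ Y, ∃ c : Fin d → P, (∀ l, c l ∈ Qa D k) ∧ v = ∑ l, c l * y l := by
    intro v hv
    refine ⟨fun l => (bY.repr ⟨v, hv⟩ l : P), fun l => SetLike.coe_mem _, ?_⟩
    have := congrArg Subtype.val (bY.sum_repr ⟨v, hv⟩)
    refine (show v = _ from this.symm).trans ?_
    rw [AddSubmonoidClass.coe_finset_sum]
    rfl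
  obtain ⟨u, hu, hdet, i0, hi0⟩ := T.wronsk y hyli hd
  set M1 : Matrix (Fin d) (Fin d) P := Matrix.of fun i j => u i (y j) with hM1
  set Δ := M1.det with hΔ
  have hyW : ∀ j, y j ∈ W := fun j => (bY j).2.1
  have hayW : ∀ j, a * y j ∈ W := fun j => (bY j).2.2
  have hΔL : IsLin D (Qa D k) Δ := by
    refine subring_det_mem (Lin D (Qa D k) hLD) M1 fun i j => ?_
    exact (hu i).lin T (hWL _ (hyW j))
  have hpow : ∀ n : ℕ, Δ ^ n ∈ Lin D (Qa D k) hLD := fun n => pow_mem (show Δ ∈ Lin D (Qa D k) hLD from hΔL) n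
  have haΔL : IsLin D (Qa D k) (a * Δ) := by
    have e : a * Δ = (M1.updateRow i0 (a • M1 i0)).det := by
      rw [Matrix.det_updateRow_smul, Matrix.updateRow_eq_self]
    rw [e]
    refine subring_det_mem (Lin D (Qa D k) hLD) _ fun i j => ?_
    by_cases h : i = i0
    · subst h
      rw [Matrix.updateRow_self]
      have : (a • M1 i) j = a * y j := by simp [hM1, hi0]
      rw [this]
      exact hWL _ (hayW j)
    · rw [Matrix.updateRow_ne h]
      exact (hu i).lin T (hWL _ (hyW j))
  have hχ : ∀ ν ∈ Nn, ∃ χ ∈ Qa D k, ν Δ = χ * Δ := by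
    intro ν hν
    choose c hc hce using fun j => hrepr _ (hYN ν hν (y j) (bY j).2)
    refine ⟨_, ?_, detU u hu ν (fun f hf x => hf.commG T hν.1 x) y (Matrix.of fun l j => c j l) (fun i j => hc j i) hce⟩
    exact sum_mem fun i _ => hc _ _
  obtain ⟨m, hm1, hm2⟩ := lin_order_min Δ hΔL
  let b : Fin m → P := fun i => D^[i] Δ
  have hm : 0 < m := by
    rcases Nat.eq_zero_or_pos m with h | h
    · subst h
      simp at hm1
      exact absurd hm1 hdet
    · exact h
  obtain ⟨u', hu', hdet', _⟩ := T.wronsk b hm2 hm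
  set Δ2 := (Matrix.of fun i j => u' i (b j)).det with hΔ2
  have hDΔ2 : ∃ t ∈ Qa D k, D Δ2 = t * Δ2 := by
    have h1 : ∀ j, ∃ c : Fin m → P, (∀ l, c l ∈ Qa D k) ∧ D (b j) = ∑ l, c l * b l := by
      intro j
      have h2 : D (b j) ∈ Submodule.span (Qa D k) {x | ∃ i : Fin m, True ∧ x = b i} := by
        have e : D (b j) = D^[(j : ℕ) + 1] Δ := (Function.iterate_succ_apply' _ _ _).symm
        rw [e]
        rcases Nat.lt_or_ge ((j : ℕ) + 1) m with h | h
        · exact Submodule.subset_span ⟨⟨_, h⟩, trivial, rfl⟩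
        · have : (j : ℕ) + 1 = m := by omega
          rw [this]
          refine Submodule.span_mono ?_ hm1
          rintro x ⟨i, hi, rfl⟩
          exact ⟨⟨i, hi⟩, trivial, rfl⟩
      obtain ⟨c, h3, _, h4⟩ := span_coef b _ _ h2
      exact ⟨c, h3, h4⟩
    choose c hc hce using h1
    refine ⟨_, ?_, detU u' hu' D (fun f hf x => hf.commD T x) b (Matrix.of fun l j => c j l) (fun i j => hc j i) hce⟩
    exact sum_mem fun i _ => hc _ _
  have hνΔ2 : ∀ ν ∈ Nn, ∀ χ ∈ Qa D k, ν Δ = χ * Δ → ν Δ2 = (m * χ) * Δ2 := by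
    intro ν hν χ hχL hχe
    have h1 : ∀ j, ∃ c : Fin m → P, (∀ l, c l ∈ Qa D k) ∧ c j = χ ∧ ν (b j) = ∑ l, c l * b l := by
      intro j
      have h2 := nu_filter hLD Nn (fun ν hν => hν.1.1) hNN Δ hχ j ν hν χ hχL hχe
      have h3 : ν (b j) - χ * b j ∈ Submodule.span (Qa D k) {x | ∃ i : Fin m, i < j ∧ x = b i} := by
        refine Submodule.span_mono ?_ h2
        rintro x ⟨i, hi, rfl⟩
        exact ⟨⟨i, by omega⟩, hi, rfl⟩
      obtain ⟨c, h4, h5, h6⟩ := span_coef b _ _ h3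
      refine ⟨c + Pi.single j χ, ?_, ?_, ?_⟩
      · intro l
        refine add_mem (h4 l) ?_
        by_cases h : l = j
        · subst h; simpa using hχL
        · rw [Pi.single_eq_of_ne h]; exact zero_mem _
      · simp [h5 j (lt_irrefl _)]
      · rw [sub_eq_iff_eq_add] at h6
        rw [h6]
        simp [add_mul, Finset.sum_add_distrib, Pi.single_apply]
    choose c hc hcj hce using h1
    have := detU u' hu' ν (fun f hf x => hf.commG T hν.1 x) b (Matrix.of fun l j => c j l) (fun i j => hc j i) hce
    rw [← hΔ2] at this
    rw [this]
    congr 1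
    simp [Matrix.trace, hcj]
  obtain ⟨t, ht, hte⟩ := hDΔ2
  have hinvL : IsLin D (Qa D k) Δ2⁻¹ := by
    refine isLin_fin (ι := Unit) D (Qa D k) hLD (fun _ => Δ2⁻¹) (fun _ _ => - t) (fun _ _ => neg_mem ht) ?_ ()
    intro _
    rw [der_inv, hte]
    simp
    field_simp
  have hL2 : ∀ x, IsLin D (Qa D k) x → (∀ ν ∈ Nn, ν x = 0) → x ∈ Qa D k := fun x h1 h2 =>
    five hk hK hkK hP x h1 (T.stepN hk hK hkK hP a ha hgen x fun ε h3 h4 => h2 ε ⟨h3, h4⟩)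
  obtain ⟨m', rfl⟩ : ∃ m', m = m' + 1 := ⟨m - 1, by omega⟩
  have hνf : ∀ ν ∈ Nn, ν (Δ ^ (m'+1) * Δ2⁻¹) = 0 := by
    intro ν hν
    obtain ⟨χ, h1, h2⟩ := hχ ν hν
    have h3 := hνΔ2 ν hν χ h1 h2
    rw [ν.leibniz, der_inv, h3, ν.leibniz_pow, h2]
    simp only [smul_eq_mul, nsmul_eq_mul, Nat.add_sub_cancel]
    field_simp
    ring
  have hf : Δ ^ (m'+1) * Δ2⁻¹ ∈ Qa D k := hL2 _
    (mul_mem (S := Subring P) (s := Lin D (Qa D k) hLD) (hpow _) hinvL) hνf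
  have hg : a * (Δ ^ (m'+1) * Δ2⁻¹) ∈ Qa D k := by
    apply hL2
    · have e : a * (Δ ^ (m'+1) * Δ2⁻¹) = (a * Δ) * Δ ^ m' * Δ2⁻¹ := by ring
      rw [e]
      exact mul_mem (S := Subring P) (s := Lin D (Qa D k) hLD) (mul_mem (S := Subring P) (s := Lin D (Qa D k) hLD) haΔL (hpow _)) hinvL
    · intro ν hν
      rw [ν.leibniz, hνf ν hν, hν.2 a ha]
      simp
  apply Qa_inter hk hK hkK hP a ha
  have hne : Δ ^ (m'+1) * Δ2⁻¹ ≠ 0 := mul_ne_zero (pow_ne_zero _ hdet) (inv_ne_zero hdet')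
  have := div_mem hg hf
  rwa [mul_div_cancel_right₀ _ hne] at this
end
end PVR
namespace PVR
open scoped TensorProduct
section
variable {P : Type u} [Field P] [CharZero P] {ι : Type} [Fintype ι] [DecidableEq ι]
variable {D : Derivation ℤ P P} {k K L : Subfield P} {Φ A : Matrix ι ι P}

theorem Tor.endC0' (hk : DSt D k) (hK : DSt D K) (hkK : k ≤ K) (hP : PP D K k) (T : Tor D (Qa D k) Φ A)
    (a : P) (ha : a ∈ K) (hgen : ∀ F : Subfield P, DSt D F → k ≤ F → a ∈ F → K ≤ F)
    (γ : ι → P) (hγ : ∀ i, D (γ i) = 0) (y0 : P) (hy0 : y0 ≠ 0)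
    (hy0W : y0 ∈ Submodule.span (Qa D k) (Set.range (Φ.mulVec γ)))
    (hay0 : a * y0 ∈ Submodule.span (Qa D k) (Set.range (Φ.mulVec γ))) : a ∈ k := by
  have hD : ∀ i, D (Φ.mulVec γ i) = ∑ j, A i j * Φ.mulVec γ j := by
    intro i
    have e : ∑ j, A i j * Φ.mulVec γ j = (A * Φ).mulVec γ i := by
      rw [← Matrix.mulVec_mulVec]; rfl
    rw [e, ← T.hD]
    simp [Matrix.mulVec, dotProduct, hγ, mul_comm]
  have hmem : ∀ (c : ι → P), (∀ j, c j ∈ Qa D k) → ∑ j, c j * Φ.mulVec γ j ∈ Submodule.span (Qa D k) (Set.range (Φ.mulVec γ)) :=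
    fun c hc => sum_mem fun j _ => Submodule.smul_mem _ (⟨c j, hc j⟩ : Qa D k) (Submodule.subset_span ⟨j, rfl⟩)
  refine T.endC0 hk hK hkK hP a ha hgen _ (Submodule.fg_span (Set.finite_range _)) ?_ ?_ y0 hy0 hy0W hay0
  · apply span_dst D (Qa D k) dst_Qa _ _ le_rfl
    rintro _ ⟨i, rfl⟩
    rw [hD]
    exact hmem _ (fun j => T.hA i j)
  · intro ε hε v hv
    induction hv using Submodule.span_induction with
    | mem x hx =>
      obtain ⟨i, rfl⟩ := hx
      have e : ∑ j, (TG Φ ε) i j * Φ.mulVec γ j = (TG Φ ε * Φ).mulVec γ i := by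
        rw [← Matrix.mulVec_mulVec]; rfl
      have e2 : ε (Φ.mulVec γ i) = ∑ j, (TG Φ ε) i j * Φ.mulVec γ j := by
        rw [e, ← T.TG_spec]
        have : ∀ j, ε (γ j) = 0 := fun j => hε.1 _ (T.hc _ (hγ j))
        simp [Matrix.mulVec, dotProduct, this, mul_comm]
      rw [e2]
      exact hmem _ (fun j => T.G_B hε i j)
    | zero => rw [map_zero]; exact zero_mem _
    | add x y _ _ hx hy => rw [map_add]; exact add_mem hx hy
    | smul a x h1 hx =>
      rw [Subfield.smul_def, smul_eq_mul, ε.leibniz, hε.1 _ a.2, smul_zero, add_zero]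
      exact Submodule.smul_mem _ a hx
end

section
variable {N : Type u} [Field N] [CharZero N] {D : Derivation ℤ N N} {k K P : Subfield N}

theorem map_comap_sub (h : k ≤ P) : (k.comap P.subtype).map P.subtype = k := by
  ext x
  constructor
  · rintro ⟨y, hy, rfl⟩; exact hy
  · intro hx; exact ⟨⟨x, h hx⟩, hx, rfl⟩

theorem dst_comap (hP : DSt D P) (hk : DSt D k) : DSt (restr D P hP) (k.comap P.subtype) :=
  fun x hx => hk _ hx

/-- amalgamation of two extensions of a subfield -/
theorem amalg_ext (hPd : DSt D P) {N' : Type u} [Field N'] [CharZero N'] {D' : Derivation ℤ N' N'} (j : P →+* N')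
    (hj : DHom (restr D P hPd) D' j) :
    ∃ (Ω : Type u) (_ : Field Ω) (_ : CharZero Ω) (DΩ : Derivation ℤ Ω Ω) (s : N →+* Ω) (t : N' →+* Ω),
      DHom D DΩ s ∧ DHom D' DΩ t ∧ ∀ x : P, s x = t (j x) := by
  letI : Algebra P N' := j.toAlgebra
  obtain ⟨Ω, i1, i2, DΩ, θ, h1, h2, h3⟩ := amalgam (F := P) (N1 := N) (N2 := N') D D'
    (fun x => ⟨restr D P hPd x, rfl, (hj x)⟩) 1 one_ne_zero
  refine ⟨Ω, i1, i2, DΩ, θ.comp (Algebra.TensorProduct.includeLeft (R := P) (S := P)).toRingHom,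
    θ.comp (Algebra.TensorProduct.includeRight (R := P)).toRingHom, h1, h2, ?_⟩
  intro x
  change θ ((algebraMap P N x) ⊗ₜ 1) = θ (1 ⊗ₜ (algebraMap P N' x))
  rw [Algebra.algebraMap_eq_smul_one, Algebra.algebraMap_eq_smul_one, TensorProduct.smul_tmul]

theorem PP_sub (hPd : DSt D P) (hk : DSt D k) (hkP : k ≤ P) (hP : PP D K k) :
    PP (restr D P hPd) (K.comap P.subtype) (k.comap P.subtype) := by
  intro N' _ _ D' j hj x hx hxq
  obtain ⟨Ω, _, _, DΩ, s, t, hs, ht, hst⟩ := amalg_ext hPd j hj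
  apply hP Ω DΩ s hs x hx
  have h1 : t (j x) ∈ (Qf D' ((k.comap P.subtype).map j)).map t := ⟨_, hxq, rfl⟩
  have h2 := Qf_map ht (dst_map hj (dst_comap hPd hk)) h1
  have e : ((k.comap P.subtype).map j).map t = k.map s := by
    rw [← map_comap_sub hkP, Subfield.map_map, Subfield.map_map]
    congr 1
    · ext y; exact (hst y).symm
    · rw [map_comap_sub hkP]
  rw [e, ← hst] at h2
  exact h2

theorem Qa_sub (hPd : DSt D P) (hk : DSt D k) (hL : Qa D k ≤ P) (x : P) (hx : (x : N) ∈ Qa D k) :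
    x ∈ Qa (restr D P hPd) (k.comap P.subtype) := by
  have hkP : k ≤ P := (le_Qa hk).trans hL
  have hlin : ∀ y, IsLin D k y → y ∈ P := fun y hy => hL (Qf_le_Qa (lin_le_Qf hy))
  have hQ : Qf D k ≤ (Qf (restr D P hPd) (k.comap P.subtype)).map P.subtype := by
    rw [Qf, Subfield.closure_le]
    intro y hy
    refine ⟨⟨y, hlin y hy⟩, lin_le_Qf ?_, rfl⟩
    rw [isLin_iff_exists _ _ (dst_comap hPd hk)]
    obtain ⟨n, w, A, c, hA, hc, hw, hyw⟩ := (isLin_iff_exists D k hk y).1 hy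
    refine ⟨n, fun i => ⟨w i, hlin _ (isLin_fin D k hk w A hA hw i)⟩, Matrix.of fun i j => ⟨A i j, hkP (hA i j)⟩,
      fun i => ⟨c i, hkP (hc i)⟩, hA, hc, ?_, ?_⟩
    · intro i
      apply Subtype.ext
      refine (hw i).trans ?_
      simp
    · apply Subtype.ext
      simp [hyw]
  rw [mem_Qa] at hx ⊢
  have h2 := isAlgebraic_subfield_mono hQ hx
  let M := Qf (restr D P hPd) (k.comap P.subtype)
  let f : M →+* M.map P.subtype := (P.subtype.comp M.subtype).codRestrict _ (fun y => ⟨y, y.2, rfl⟩)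
  refine IsAlgebraic.of_ringHom_of_comp_eq f P.subtype h2 ?_ Subtype.val_injective ?_
  · rintro ⟨_, y, hy, rfl⟩; exact ⟨⟨y, hy⟩, rfl⟩
  · ext y; rfl

theorem mulVec_const {N : Type*} [Field N] {ι : Type*} [Fintype ι] [DecidableEq ι] (D : Derivation ℤ N N)
    (X A : Matrix ι ι N) (w : ι → N) (hX : X.det ≠ 0) (hXD : X.map D = A * X) (hw : ∀ i, D (w i) = ∑ j, A i j * w j) :
    ∀ i, D (X⁻¹.mulVec w i) = 0 := by
  have hu : IsUnit X.det := isUnit_iff_ne_zero.2 hX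
  set γ := X⁻¹.mulVec w with hγ
  have h1 : X.mulVec γ = w := by rw [hγ, Matrix.mulVec_mulVec, Matrix.mul_nonsing_inv _ hu, Matrix.one_mulVec]
  have h2 : X.mulVec (fun i => D (γ i)) = 0 := by
    ext i
    have e1 : D (X.mulVec γ i) = ∑ j, A i j * X.mulVec γ j := by rw [h1]; exact hw i
    have e : ∑ j, A i j * X.mulVec γ j = (A * X).mulVec γ i := by
      rw [← Matrix.mulVec_mulVec]; rfl
    rw [e, ← hXD] at e1
    simp only [Matrix.mulVec, dotProduct, map_sum, Derivation.leibniz, smul_eq_mul, Finset.sum_add_distrib, Matrix.map_apply] at e1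
    simp only [mul_comm (γ _)] at e1
    simpa [Matrix.mulVec, dotProduct] using e1
  have h3 := congrArg (X⁻¹.mulVec) h2
  rw [Matrix.mulVec_mulVec, Matrix.nonsing_inv_mul _ hu, Matrix.one_mulVec, Matrix.mulVec_zero] at h3
  exact fun i => congrFun h3 i

/-- C0 with `K` generated by `a` -/
theorem C0_gen (hk : DSt D k) (hK : DSt D K) (hkK : k ≤ K) (hP : PP D K k) (a : N) (ha : a ∈ K)
    (hgen : ∀ F : Subfield N, DSt D F → k ≤ F → a ∈ F → K ≤ F) (hq : a ∈ Qf D (Qa D k)) : a ∈ k := by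
  obtain ⟨u, v, hu, hv, hv0, rfl⟩ := (mem_Qf_iff dst_Qa).1 hq
  obtain ⟨V, hVfg, hVD, huV, hvV⟩ : ∃ V : Submodule (Qa D k) N, V.FG ∧ (∀ x ∈ V, D x ∈ V) ∧ u ∈ V ∧ v ∈ V := by
    obtain ⟨V1, h1, h2, h3⟩ := hu
    obtain ⟨V2, h1', h2', h3'⟩ := hv
    refine ⟨V1 ⊔ V2, h1.sup h1', ?_, Submodule.mem_sup_left h3, Submodule.mem_sup_right h3'⟩
    intro x hx
    obtain ⟨y, hy, z, hz, rfl⟩ := Submodule.mem_sup.1 hx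
    rw [map_add]
    exact add_mem (Submodule.mem_sup_left (h2 y hy)) (Submodule.mem_sup_right (h2' z hz))
  obtain ⟨n, w, rfl⟩ := Submodule.fg_iff_exists_fin_generating_family.1 hVfg
  have hco : ∀ x ∈ Submodule.span (Qa D k) (Set.range w), ∃ c : Fin n → N, (∀ i, c i ∈ Qa D k) ∧ x = ∑ i, c i * w i := by
    intro x hx
    obtain ⟨c, hc⟩ := (Submodule.mem_span_range_iff_exists_fun _).1 hx
    exact ⟨fun i => c i, fun i => SetLike.coe_mem _, hc.symm⟩
  choose A hA hAw using fun i => hco _ (hVD (w i) (Submodule.subset_span ⟨i, rfl⟩))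
  obtain ⟨cu, hcu, hue⟩ := hco u huV
  obtain ⟨cv, hcv, hve⟩ := hco v hvV
  obtain ⟨N1, _, _, D1, i, X, hi, hX, hXD⟩ := generic D (Matrix.of A)
  have hk1 : DSt D1 (k.map i) := dst_map hi hk
  have hK1 : DSt D1 (K.map i) := dst_map hi hK
  have hkK1 : k.map i ≤ K.map i := by rintro _ ⟨x, hx, rfl⟩; exact ⟨x, hkK hx, rfl⟩
  have hP1 := PP_map hP i hi
  set k1 := k.map i with hk1e
  set K1 := K.map i with hK1e
  have hQm : ∀ x ∈ Qa D k, i x ∈ Qa D1 k1 := fun x hx => Qa_map hi hk ⟨x, hx, rfl⟩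
  set L := Qa D1 k1 with hLe
  have hLd : DSt D1 L := dst_Qa
  have hw1 : ∀ l, D1 (i (w l)) = ∑ j, (Matrix.of A).map i l j * i (w j) := by
    intro l; rw [hi, hAw l, map_sum]; simp
  have hγ := mulVec_const D1 X _ (fun l => i (w l)) hX hXD hw1
  set γ := X⁻¹.mulVec (fun l => i (w l)) with hγe
  have hXγ : X.mulVec γ = fun l => i (w l) := by
    rw [hγe, Matrix.mulVec_mulVec, Matrix.mul_nonsing_inv _ (isUnit_iff_ne_zero.2 hX), Matrix.one_mulVec]
  have hγL : ∀ l, γ l ∈ L := fun l => Qf_le_Qa (lin_le_Qf (isLin_const D1 k1 hk1 _ (hγ l)))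
  let P : Subfield N1 := Subfield.closure ((L : Set N1) ∪ {x | ∃ l j, x = X l j})
  have hLP : L ≤ P := fun x hx => Subfield.subset_closure (Or.inl hx)
  have hXP : ∀ l j, X l j ∈ P := fun l j => Subfield.subset_closure (Or.inr ⟨l, j, rfl⟩)
  have hAL : ∀ l j, (Matrix.of A).map i l j ∈ L := fun l j => hQm _ (hA l j)
  have hPd : DSt D1 P := by
    apply dst_closure
    rintro x (hx | ⟨l, j, rfl⟩)
    · exact hLP (hLd x hx)
    · have : D1 (X l j) = ((Matrix.of A).map i * X) l j := by rw [← hXD]; rfl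
      rw [this, Matrix.mul_apply]
      exact sum_mem fun m _ => mul_mem (hLP (hAL l m)) (hXP m j)
  have hwP : ∀ l, i (w l) ∈ P := by
    intro l
    have := congrFun hXγ l
    rw [← this]
    change ∑ j, X l j * γ j ∈ P
    exact sum_mem fun j _ => mul_mem (hXP l j) (hLP (hγL j))
  have hcP : ∀ c : Fin n → N, (∀ i, c i ∈ Qa D k) → i (∑ l, c l * w l) ∈ P := by
    intro c hc
    rw [map_sum]
    exact sum_mem fun j _ => by rw [map_mul]; exact mul_mem (hLP (hQm _ (hc j))) (hwP j)
  have hvP : i v ∈ P := by rw [hve]; exact hcP _ hcv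
  have huP : i u ∈ P := by rw [hue]; exact hcP _ hcu
  have haP : i (u / v) ∈ P := by
    rw [map_div₀]; exact div_mem huP hvP
  have hgen1 : ∀ F : Subfield N1, DSt D1 F → k1 ≤ F → i (u/v) ∈ F → K1 ≤ F := by
    intro F hF hkF haF
    rw [hK1e, Subfield.map_le_iff_le_comap]
    apply hgen _ _ _ haF
    · intro x hx
      change i (D x) ∈ F
      rw [← hi]; exact hF _ hx
    · intro x hx; exact hkF ⟨x, hx, rfl⟩
  have hkP : k1 ≤ P := (le_Qa hk1).trans hLP
  have hKP : K1 ≤ P := hgen1 P hPd hkP haP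
  have hP2 := PP_sub hPd hk1 hkP hP1
  have hQs := Qa_sub hPd hk1 hLP
  let Φ : Matrix (Fin n) (Fin n) P := Matrix.of fun l j => ⟨X l j, hXP l j⟩
  let A' : Matrix (Fin n) (Fin n) P := Matrix.of fun l j => ⟨(Matrix.of A).map i l j, hLP (hAL l j)⟩
  have hk2 : DSt (restr D1 P hPd) (k1.comap P.subtype) := dst_comap hPd hk1
  have T : Tor (restr D1 P hPd) (Qa (restr D1 P hPd) (k1.comap P.subtype)) Φ A' := by
    refine ⟨dst_Qa, fun x hx => Qf_le_Qa (lin_le_Qf (isLin_const _ _ hk2 _ hx)), fun x hx => Qa_algClosed hx, ?_, ?_, ?_, ?_⟩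
    · intro h
      have e : P.subtype Φ.det = X.det := by
        rw [RingHom.map_det]; rfl
      rw [h, map_zero] at e
      exact hX e.symm
    · intro l j
      exact hQs _ (hAL l j)
    · ext l j
      have e1 : P.subtype ((A' * Φ) l j) = ((A'.map P.subtype) * (Φ.map P.subtype)) l j := by
        rw [← Matrix.map_mul]; rfl
      refine Eq.trans ?_ e1.symm
      change D1 (X l j) = (((Matrix.of A).map i) * X) l j
      rw [← hXD]; rfl
    · intro F hF hΦ
      have h1 : P ≤ F.map P.subtype := by
        rw [Subfield.closure_le]
        rintro x (hx | ⟨l, j, rfl⟩)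
        · exact ⟨⟨x, hLP hx⟩, hF (hQs _ hx), rfl⟩
        · exact ⟨_, hΦ l j, rfl⟩
      intro x
      obtain ⟨y, hy, hyx⟩ := h1 x.2
      rwa [Subtype.ext hyx] at hy
  let γ' : Fin n → P := fun l => ⟨γ l, hLP (hγL l)⟩
  have hΦγ : ∀ l, Φ.mulVec γ' l = ⟨i (w l), hwP l⟩ := by
    intro l
    apply Subtype.ext
    have := congrFun hXγ l
    rw [show ((⟨i (w l), hwP l⟩ : P) : N1) = X.mulVec γ l from this.symm]
    simp [Matrix.mulVec, dotProduct, Φ, γ']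
  have hspan : ∀ (c : Fin n → N) (hc : ∀ j, c j ∈ Qa D k), (⟨i (∑ l, c l * w l), hcP c hc⟩ : P) ∈
      Submodule.span (Qa (restr D1 P hPd) (k1.comap P.subtype)) (Set.range (Φ.mulVec γ')) := by
    intro c hc
    have : (⟨i (∑ l, c l * w l), hcP c hc⟩ : P) = ∑ l, (⟨i (c l), hLP (hQm _ (hc l))⟩ : P) * Φ.mulVec γ' l := by
      apply Subtype.ext
      simp [hΦγ]
    rw [this]
    exact sum_mem fun l _ => Submodule.smul_mem _ (⟨⟨i (c l), hLP (hQm _ (hc l))⟩, hQs _ (hQm _ (hc l))⟩ :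
      Qa (restr D1 P hPd) (k1.comap P.subtype)) (Submodule.subset_span ⟨l, rfl⟩)
  have hfin := T.endC0' hk2 (dst_comap hPd hK1) (fun x hx => hkK1 hx) hP2 ⟨i (u/v), haP⟩ ⟨_, ha, rfl⟩ ?_ γ' ?_ ⟨i v, hvP⟩ ?_ ?_ ?_
  · obtain ⟨x, hx, hxe⟩ := hfin
    rwa [← i.injective hxe]
  · intro F hF hkF haF
    have h1 : K1 ≤ F.map P.subtype := by
      apply hgen1
      · rintro _ ⟨x, hx, rfl⟩
        exact ⟨_, hF x hx, rfl⟩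
      · intro x hx
        exact ⟨⟨x, hkP hx⟩, hkF hx, rfl⟩
      · exact ⟨_, haF, rfl⟩
    intro x hx
    obtain ⟨y, hy, hyx⟩ := h1 hx
    rwa [Subtype.ext hyx] at hy
  · intro l
    apply Subtype.ext
    exact hγ l
  · intro h
    have := congrArg Subtype.val h
    exact hv0 (i.injective (this.trans (map_zero i).symm))
  · have := hspan cv hcv
    simpa only [← hve] using this
  · have := hspan cu hcu
    have e : (⟨i (u/v), haP⟩ : P) * ⟨i v, hvP⟩ = ⟨i u, huP⟩ := by
      apply Subtype.ext
      change i (u/v) * i v = i u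
      rw [← map_mul, div_mul_cancel₀ _ hv0]
    rw [e]
    simpa only [← hue] using this

theorem C0 (hk : DSt D k) (hK : DSt D K) (hkK : k ≤ K) (hP : PP D K k) (a : N) (ha : a ∈ K)
    (hq : a ∈ Qf D (Qa D k)) : a ∈ k := by
  let K' : Subfield N := sInf {F | DSt D F ∧ k ≤ F ∧ a ∈ F}
  have hle : ∀ F : Subfield N, DSt D F → k ≤ F → a ∈ F → K' ≤ F := fun F h1 h2 h3 => sInf_le ⟨h1, h2, h3⟩
  have hK'K : K' ≤ K := hle K hK hkK ha
  refine C0_gen (K := K') hk ?_ ?_ ?_ a ?_ hle hq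
  · intro x hx
    rw [Subfield.mem_sInf] at hx ⊢
    exact fun F hF => hF.1 _ (hx F hF)
  · exact le_sInf fun F hF => hF.2.1
  · intro N' _ _ D' i hi x hx
    exact hP N' D' i hi x (hK'K hx)
  · exact Subfield.mem_sInf.2 fun F hF => hF.2.2
end
end PVR
namespace PVR
section
variable {N : Type u} [Field N] [CharZero N] {D : Derivation ℤ N N} {K k : Subfield N}

theorem LD_QfQa (hk : DSt D k) (hK : DSt D K) (hkK : k ≤ K) (hP : PP D K k) : LD k K (Qf D (Qa D k)) := by
  refine lindis D K k hK _ (fun N' _ _ D' i hi => ⟨Qf D' (Qa D' (k.map i)), ?_, ?_⟩)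
  · intro x hx hxa
    have h := C0 (dst_map hi hk) (dst_map hi hK) (by rintro _ ⟨y, hy, rfl⟩; exact ⟨y, hkK hy, rfl⟩)
      (PP_map hP i hi) (i x) ⟨x, hx, rfl⟩ hxa
    obtain ⟨y, hy, h⟩ := h
    rwa [← i.injective h]
  intro σ hσ hσi s hs
  rw [← map_eq_of_agree hkK hσi]
  exact Qf_mono (dst_map hσ dst_Qa) dst_Qa (Qa_map hσ hk) (Qf_map hσ dst_Qa ⟨s, hs, rfl⟩)

theorem LD_sup {Y M : Subfield N} (h : LD k K Y) (hkK : k ≤ K) (hkM : k ≤ M) (hMY : M ≤ Y) (f : N) (hf : f ∈ K ⊔ M) (hfY : f ∈ Y) :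
    f ∈ M := by
  by_contra hfM
  obtain ⟨β, b, hbL, hbi, hbs⟩ : ∃ (β : Type u) (b : β → N), (∀ i, b i ∈ M) ∧ LinearIndependent k b ∧
      ∀ l ∈ M, l ∈ Submodule.span k (Set.range b) := by
    let W : Submodule k N :=
      { carrier := M, zero_mem' := zero_mem _, add_mem' := fun h1 h2 => add_mem h1 h2
        smul_mem' := fun c y hy => mul_mem (hkM c.2) hy }
    let B := Module.Basis.ofVectorSpace k W
    refine ⟨_, fun i => (B i : N), fun i => (B i).2, ?_, ?_⟩
    · have := B.linearIndependent.map' W.subtype (by simp)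
      exact this
    · intro l hl
      have h1 := B.mem_span (⟨l, hl⟩ : W)
      have h2 := Submodule.mem_map_of_mem (f := W.subtype) h1
      rw [Submodule.map_span, ← Set.range_comp] at h2
      exact h2
  have hspan : ∀ y ∈ Algebra.adjoin K (M : Set N), y ∈ Submodule.span K (Set.range b) := by
    intro y hy
    have h1 := adjoin_le_span M.toSubmonoid K y hy
    refine (Submodule.span_le.2 ?_) h1
    intro l hl
    have h2 := hbs l hl
    clear hl
    induction h2 using Submodule.span_induction with
    | mem x hx => exact Submodule.subset_span hx
    | zero => exact zero_mem _
    | add x y _ _ h1 h2 => exact add_mem h1 h2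
    | smul c x _ h => exact Submodule.smul_mem _ (⟨c, hkK c.2⟩ : K) h
  have hf0 : f ≠ 0 := fun h => hfM (h ▸ zero_mem _)
  obtain ⟨w, hw, hw0, hwf⟩ := sup_frac M K f (by rwa [sup_comm])
  have hk : LinearIndependent k (Sum.elim b (fun i => f * b i)) := by
    rw [linearIndependent_sum]
    refine ⟨hbi, ?_, ?_⟩
    · have := hbi.map' (LinearMap.mulLeft k f) (LinearMap.ker_eq_bot.2 (mul_right_injective₀ hf0))
      exact this
    · rw [Submodule.disjoint_def]
      intro x h1 h2
      have e1 : x ∈ M := by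
        clear h2
        induction h1 using Submodule.span_induction with
        | mem x hx => obtain ⟨i, rfl⟩ := hx; exact hbL i
        | zero => exact zero_mem _
        | add x y _ _ h1 h2 => exact add_mem h1 h2
        | smul c x _ h => exact mul_mem (hkM c.2) h
      have e2 : x * f⁻¹ ∈ M := by
        clear h1 e1
        induction h2 using Submodule.span_induction with
        | mem x hx =>
          obtain ⟨i, rfl⟩ := hx
          have : f * b i * f⁻¹ = b i := by field_simp
          show f * b i * f⁻¹ ∈ M
          rw [this]; exact hbL i
        | zero => rw [zero_mul]; exact zero_mem _
        | add x y _ _ h1 h2 => rw [add_mul]; exact add_mem h1 h2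
        | smul c x _ h =>
          have : c • x * f⁻¹ = c * (x * f⁻¹) := mul_assoc _ _ _
          rw [this]; exact mul_mem (hkM c.2) h
      by_contra hx
      apply hfM
      have : f = x * (x * f⁻¹)⁻¹ := by field_simp
      rw [this]
      exact mul_mem e1 (inv_mem e2)
  have hKi := LD_inf h _ (by
    rintro (i | i)
    · exact hMY (hbL i)
    · exact mul_mem hfY (hMY (hbL i))) hk
  rw [linearIndependent_sum] at hKi
  have hd := hKi.2.2
  rw [Submodule.disjoint_def] at hd
  have := hd (w * f) (hspan _ hwf) (by
    have h1 := Submodule.mem_map_of_mem (f := LinearMap.mulLeft K f) (hspan w hw)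
    rw [Submodule.map_span, ← Set.range_comp] at h1
    rw [mul_comm]
    exact h1)
  exact (mul_ne_zero hw0 hf0) this

theorem step2 (hk : DSt D k) (hK : DSt D K) (hkK : k ≤ K) (hP : PP D K k) : PP D (K ⊔ Qa D k) (Qa D k) := by
  intro N' _ _ D' i hi f hf hq
  have hle : (Qa D k).map i ≤ Qa D' (k.map i) := Qa_map hi hk
  have hkK' : k.map i ≤ K.map i := by rintro _ ⟨y, hy, rfl⟩; exact ⟨y, hkK hy, rfl⟩
  have h := LD_sup (M := (Qa D k).map i) (LD_QfQa (dst_map hi hk) (dst_map hi hK) hkK'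
    (PP_map hP i hi)) hkK' (by rintro _ ⟨y, hy, rfl⟩; exact ⟨y, le_Qa hk hy, rfl⟩)
    (hle.trans (le_Qf dst_Qa)) (i f)
    (by rw [← Subfield.map_sup]; exact ⟨f, hf, rfl⟩) (Qf_mono (dst_map hi dst_Qa) dst_Qa hle hq)
  obtain ⟨y, hy, h⟩ := h
  rwa [← i.injective h]

theorem tower (n : ℕ) : ∀ (K F : Subfield N) (hF : DSt D F) (hK : DSt D K) (hFK : F ≤ K) (hP : PP D K F)
    (T : Fin (n + 1) → Subfield N) (h0 : T 0 ≤ F) (hn : T (Fin.last n) = ⊤) (hTd : ∀ i, DSt D (T i))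
    (hT : ∀ i : Fin n, T i.succ ≤ Qf D (T i.castSucc)), K ≤ F := by
  induction n with
  | zero =>
    intro K F hF hK hFK hP T h0 hn hTd hT
    have : T 0 = ⊤ := hn
    rw [this] at h0
    exact le_top.trans h0
  | succ n ih =>
    intro K F hF hK hFK hP T h0 hn hTd hT
    have h := ih (K ⊔ Qa D F) (Qa D F) dst_Qa (dst_sup D _ _ hK dst_Qa) le_sup_right (step2 hF hK hFK hP)
      (fun i => T i.succ) ((hT 0).trans ((Qf_mono (hTd _) hF h0).trans Qf_le_Qa)) hn (fun i => hTd _)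
      (fun i => hT i.succ)
    intro x hx
    exact Qa_inter hF hK hFK hP x hx (h (le_sup_left (a := K) hx))

theorem tower' (n : ℕ) (K F : Subfield N) (hF : DSt D F) (hK : DSt D K) (hFK : F < K)
    (T : Fin (n + 1) → Subfield N) (h0 : T 0 ≤ F) (hn : T (Fin.last n) = ⊤) (hTd : ∀ i, DSt D (T i))
    (hT : ∀ i : Fin n, T i.succ ≤ Qf D (T i.castSucc)) :
    ∃ (N' : Type u) (_ : Field N') (_ : CharZero N') (D' : Derivation ℤ N' N') (i : N →+* N'), DHom D D' i ∧
      ∃ a ∈ K, a ∉ F ∧ i a ∈ Qf D' (F.map i) := by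
  by_contra hcon
  push Not at hcon
  refine absurd (tower n K F hF hK hFK.le ?_ T h0 hn hTd hT) (not_le_of_gt hFK)
  intro N' _ _ D' i hi x hx hq
  by_contra hxF
  exact hcon N' _ inferInstance D' i hi x hx hxF hq
end
end PVR
namespace PVR

theorem alg_of_units {K S : Type u} [Field K] [CommRing S] [IsDomain S] [Algebra K S] [Algebra.FiniteType K S]
    (C : Set K) (hC : C.Infinite) (c : S) (hu : ∀ β ∈ C, c - algebraMap K S β ≠ 0 → IsUnit (c - algebraMap K S β)) :
    IsAlgebraic K c := by
  classical
  by_contra hc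
  have hc : Transcendental K c := hc
  have hinj : Function.Injective (Polynomial.aeval (R := K) c) := transcendental_iff_injective.1 hc
  letI : Algebra (Polynomial K) S := (Polynomial.aeval (R := K) c).toRingHom.toAlgebra
  haveI : IsScalarTower K (Polynomial K) S := IsScalarTower.of_algebraMap_eq' (by
    ext x
    exact ((Polynomial.aeval (R := K) c).commutes x).symm)
  haveI : Algebra.FiniteType (Polynomial K) S := Algebra.FiniteType.of_restrictScalars_finiteType K _ S
  haveI : Algebra.FinitePresentation (Polynomial K) S := Algebra.FinitePresentation.of_finiteType.1 inferInstance
  haveI : FaithfulSMul (Polynomial K) S := (faithfulSMul_iff_algebraMap_injective _ _).2 hinj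
  haveI : Module.IsTorsionFree (Polynomial K) S := inferInstance
  haveI : Module.Flat (Polynomial K) S := inferInstance
  have ho := PrimeSpectrum.isOpenMap_comap_of_hasGoingDown_of_finitePresentation (R := Polynomial K) (S := S)
  have hr := ho.isOpen_range
  let b : PrimeSpectrum (Polynomial K) := PrimeSpectrum.comap (algebraMap (Polynomial K) S) ⟨⊥, Ideal.isPrime_bot⟩
  have hb : b ∈ Set.range (PrimeSpectrum.comap (algebraMap (Polynomial K) S)) := ⟨_, rfl⟩
  obtain ⟨_, ⟨_, ⟨g, rfl⟩, rfl⟩, hgb, hgr⟩ := PrimeSpectrum.isBasis_basic_opens.exists_subset_of_mem_open hb hr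
  have hg0 : g ≠ 0 := by
    rintro rfl
    exact hgb (zero_mem _)
  obtain ⟨β, hβC, hβ⟩ : ∃ β ∈ C, ¬ g.IsRoot β := by
    by_contra hcon
    push Not at hcon
    exact hC ((g.roots.toFinset.finite_toSet).subset fun β hβ => by
      simp only [Finset.mem_coe, Multiset.mem_toFinset]
      exact (Polynomial.mem_roots hg0).2 (hcon β hβ))
  have hne : c - algebraMap K S β ≠ 0 := by
    intro h
    exact hc (by rw [sub_eq_zero.1 h]; exact isAlgebraic_algebraMap _)
  have hp : (Ideal.span {Polynomial.X - Polynomial.C β}).IsPrime :=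
    (Ideal.span_singleton_prime (Polynomial.X_sub_C_ne_zero β)).2 (Polynomial.prime_X_sub_C β)
  have hmem : (⟨_, hp⟩ : PrimeSpectrum (Polynomial K)) ∈ (PrimeSpectrum.basicOpen g : Set _) := by
    intro h
    apply hβ
    exact Polynomial.dvd_iff_isRoot.1 (Ideal.mem_span_singleton.1 h)
  obtain ⟨Q, hQ⟩ := hgr hmem
  have h1 : (Polynomial.X - Polynomial.C β) ∈ (PrimeSpectrum.comap (algebraMap (Polynomial K) S) Q).asIdeal := by
    rw [hQ]; exact Ideal.mem_span_singleton_self _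
  have h2 : (Polynomial.aeval (R := K) c) (Polynomial.X - Polynomial.C β) ∈ Q.asIdeal := h1
  simp only [map_sub, Polynomial.aeval_X, Polynomial.aeval_C] at h2
  exact Q.isPrime.ne_top (Ideal.eq_top_of_isUnit_mem _ h2 (hu β hβC hne))

theorem const_alg {K S : Type u} [Field K] [CharZero K] [CommRing S] [IsDomain S] [Algebra K S]
    (d : Derivation ℤ K K) (δ : Derivation ℤ S S) (hδ : ∀ x, δ (algebraMap K S x) = algebraMap K S (d x))
    (C : Subfield K) [IsAlgClosed C] (hC : ∀ x, x ∈ C ↔ d x = 0) (c : S) (hc : δ c = 0) (ha : IsAlgebraic K c) :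
    ∃ x ∈ C, algebraMap K S x = c := by
  classical
  have hi : IsIntegral K c := isAlgebraic_iff_isIntegral.1 ha
  let p := minpoly K c
  have hcp : ∀ n, δ (c ^ n) = 0 := by
    intro n
    rw [Derivation.leibniz_pow, hc]; simp
  -- coefficients are constant
  have hcoef : ∀ n, d (p.coeff n) = 0 := by
    let r : Polynomial K := ∑ n ∈ Finset.range p.natDegree, Polynomial.monomial n (d (p.coeff n))
    have hr0 : Polynomial.aeval c r = 0 := by
      have h1 := minpoly.aeval K c
      have h2 := congrArg δ h1
      rw [Polynomial.aeval_eq_sum_range, map_zero, map_sum, Finset.sum_range_succ] at h2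
      have h3 : (minpoly K c).coeff (minpoly K c).natDegree = 1 := minpoly.monic hi
      rw [h3, one_smul, hcp, add_zero] at h2
      rw [← h2]
      simp only [r, map_sum, Polynomial.aeval_monomial]
      apply Finset.sum_congr rfl
      intro n _
      rw [Algebra.smul_def, Derivation.leibniz, hcp, smul_zero, zero_add, hδ, smul_eq_mul, mul_comm]
    have hr : r = 0 := by
      by_contra hne
      have h1 := minpoly.degree_le_of_ne_zero K c hne hr0
      have h2 : r.degree < p.natDegree := by
        refine (Polynomial.degree_sum_le _ _).trans_lt ?_
        rw [Finset.sup_lt_iff (WithBot.bot_lt_coe _)]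
        intro n hn
        exact (Polynomial.degree_monomial_le _ _).trans_lt (by exact_mod_cast Finset.mem_range.1 hn)
      rw [Polynomial.degree_eq_natDegree (minpoly.ne_zero hi)] at h1
      exact absurd h2 (not_lt.2 h1)
    intro n
    by_cases hn : n < p.natDegree
    · have := congrArg (fun q => Polynomial.coeff q n) hr
      simp only [r, Polynomial.finset_sum_coeff, Polynomial.coeff_monomial, Polynomial.coeff_zero] at this
      rw [Finset.sum_ite_eq' (Finset.range p.natDegree) n (fun n => d (p.coeff n))] at this
      rwa [if_pos (Finset.mem_range.2 hn)] at this
    · rcases (not_lt.1 hn).eq_or_lt with h | h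
      · rw [← h, show p.coeff p.natDegree = 1 from minpoly.monic hi]; simp
      · rw [Polynomial.coeff_eq_zero_of_natDegree_lt h]; simp
  obtain ⟨q, hq⟩ : ∃ q : Polynomial C, q.map C.subtype = p := by
    have : p ∈ Polynomial.lifts C.subtype := by
      rw [Polynomial.lifts_iff_coeff_lifts]
      intro n
      exact ⟨⟨p.coeff n, (hC _).2 (hcoef n)⟩, rfl⟩
    exact (Polynomial.mem_lifts _).1 this
  have hqs : (q.map C.subtype).Splits := (IsAlgClosed.splits q).map _
  have hirr : Irreducible (q.map C.subtype) := by rw [hq]; exact minpoly.irreducible hi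
  have hq0 : q ≠ 0 := by
    rintro rfl
    simp at hirr
  obtain ⟨z, hz⟩ := IsAlgClosed.exists_root q (by
    have := hirr.degree_pos.ne'
    rwa [Polynomial.degree_map] at this)
  refine ⟨z, z.2, ?_⟩
  have hroot : (minpoly K c).IsRoot (z : K) := by
    have : (q.map C.subtype).IsRoot (C.subtype z) := hz.map
    rw [hq] at this
    exact this
  exact minpoly.root hi hroot

theorem const_simple {K S : Type u} [Field K] [CharZero K] [CommRing S] [IsDomain S] [Algebra K S] [Algebra.FiniteType K S]
    (d : Derivation ℤ K K) (δ : Derivation ℤ S S) (hδ : ∀ x, δ (algebraMap K S x) = algebraMap K S (d x))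
    (C : Subfield K) [IsAlgClosed C] (hC : ∀ x, x ∈ C ↔ d x = 0)
    (hs : ∀ I : Ideal S, (∀ x ∈ I, δ x ∈ I) → I = ⊥ ∨ I = ⊤)
    (Q : Type u) [Field Q] [Algebra S Q] [IsFractionRing S Q] (DQ : Derivation ℤ Q Q)
    (hDQ : ∀ x, DQ (algebraMap S Q x) = algebraMap S Q (δ x)) (c : Q) (hc : DQ c = 0) :
    ∃ x ∈ C, algebraMap S Q (algebraMap K S x) = c := by
  have hinj : Function.Injective (algebraMap S Q) := IsFractionRing.injective S Q
  obtain ⟨c, rfl⟩ : ∃ s, algebraMap S Q s = c := by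
    let I : Ideal S :=
      { carrier := {s | ∃ t, algebraMap S Q t = algebraMap S Q s * c}
        zero_mem' := ⟨0, by simp⟩
        add_mem' := by
          rintro a b ⟨t, ht⟩ ⟨r, hr⟩
          exact ⟨t + r, by rw [map_add, ht, hr, map_add, add_mul]⟩
        smul_mem' := by
          rintro a b ⟨t, ht⟩
          exact ⟨a * t, by rw [smul_eq_mul, map_mul, ht, map_mul, mul_assoc]⟩ }
    have hI : ∀ x ∈ I, δ x ∈ I := by
      rintro x ⟨t, ht⟩
      refine ⟨δ t, ?_⟩
      rw [← hDQ, ht, Derivation.leibniz, hc, hDQ]; simp [mul_comm]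
    rcases hs I hI with h | h
    · exfalso
      obtain ⟨a, b, hb, rfl⟩ := IsFractionRing.div_surjective (A := S) c
      have hb0 : b ≠ 0 := nonZeroDivisors.ne_zero hb
      have : b ∈ I := ⟨a, by
        rw [mul_div_cancel₀]
        exact fun h => hb0 (hinj (h.trans (map_zero _).symm))⟩
      rw [h] at this
      exact hb0 this
    · have : (1 : S) ∈ I := by rw [h]; trivial
      obtain ⟨t, ht⟩ := this
      exact ⟨t, by rw [ht, map_one, one_mul]⟩
  have hc' : δ c = 0 := hinj (by rw [← hDQ, hc, map_zero])
  haveI : Infinite C := inferInstance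
  have ha : IsAlgebraic K c := by
    refine alg_of_units (C : Set K) (Set.infinite_coe_iff.1 ‹_›) c ?_
    intro β hβ hne
    have hk : δ (c - algebraMap K S β) = 0 := by
      rw [map_sub, hc', hδ, (hC β).1 hβ, map_zero, sub_zero]
    rcases hs (Ideal.span {c - algebraMap K S β}) (by
      intro x hx
      rw [Ideal.mem_span_singleton] at hx ⊢
      obtain ⟨y, rfl⟩ := hx
      rw [Derivation.leibniz, hk, smul_zero, add_zero]
      exact Dvd.intro _ rfl) with h | h
    · exact absurd (Ideal.span_singleton_eq_bot.1 h) hne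
    · exact Ideal.span_singleton_eq_top.1 h
  obtain ⟨x, hx, h⟩ := const_alg d δ hδ C hC c hc' ha
  exact ⟨x, hx, by rw [h]⟩

theorem exists_simple {R : Type u} [CommRing R] [IsNoetherianRing R] [Nontrivial R] (hQ : ∀ n : ℕ, n ≠ 0 → IsUnit (n : R))
    (d : Derivation ℤ R R) : ∃ J : Ideal R, J.IsPrime ∧ (∀ x ∈ J, d x ∈ J) ∧
      ∀ I : Ideal R, (∀ x ∈ I, d x ∈ I) → J ≤ I → I = J ∨ I = ⊤ := by
  obtain ⟨I0, ⟨h1, h2⟩, h3⟩ := set_has_maximal_iff_noetherian.2 (inferInstance : IsNoetherian R R)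
    {I : Submodule R R | I ≠ ⊤ ∧ ∀ x ∈ I, d x ∈ I} ⟨⊥, bot_ne_top, fun x hx => by
      rw [(Submodule.mem_bot R).1 hx, map_zero]; exact zero_mem _⟩
  obtain ⟨q, hq, hle⟩ := Ideal.exists_le_maximal I0 h1
  obtain ⟨J, hJ, hJq⟩ := prime_core hQ d.toLinearMap.toAddMonoidHom (fun a b => by simp) q hq.isPrime
  have hst : ∀ x ∈ J, d x ∈ J := by
    intro x hx
    rw [hJq] at hx ⊢
    intro i
    exact hx (i + 1)
  have hI0J : I0 ≤ J := by
    intro x hx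
    rw [hJq]
    intro i
    apply hle
    induction i with
    | zero => exact hx
    | succ i ih => rw [Function.iterate_succ_apply']; exact h2 _ ih
  have hmax : ∀ I : Ideal R, (∀ x ∈ I, d x ∈ I) → I0 ≤ I → I = I0 ∨ I = ⊤ := by
    intro I hI hle
    by_contra hcon
    push Not at hcon
    exact h3 I ⟨hcon.2, hI⟩ (lt_of_le_of_ne hle (Ne.symm hcon.1))
  have : J = I0 := (hmax J hst hI0J).resolve_right hJ.ne_top
  exact ⟨J, hJ, hst, by rw [this]; exact hmax⟩

end PVR
namespace PVR

theorem adjoin_stable {K N : Type u} [Field K] [Field N] [Algebra K N] (d : Derivation ℤ K K) (D : Derivation ℤ N N)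
    (hi : ∀ x, D (algebraMap K N x) = algebraMap K N (d x)) (Z : Set N) (S : Subalgebra K N)
    (hZ : ∀ z ∈ Z, D z ∈ S) (hZS : Z ⊆ S) : ∀ s ∈ Algebra.adjoin K Z, D s ∈ S := by
  have hle : Algebra.adjoin K Z ≤ S := Algebra.adjoin_le hZS
  intro s hs
  induction hs using Algebra.adjoin_induction with
  | mem x hx => exact hZ x hx
  | algebraMap r => rw [hi]; exact S.algebraMap_mem _
  | add x y _ _ h1 h2 => rw [map_add]; exact add_mem h1 h2
  | mul x y hx hy h1 h2 =>
    rw [Derivation.leibniz]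
    exact add_mem (mul_mem (hle hx) h2) (mul_mem (hle hy) h1)

theorem ringQ {K N : Type u} [Field K] [CharZero K] [Field N] [CharZero N] [Algebra K N] (d : Derivation ℤ K K) (D : Derivation ℤ N N)
    (hi : ∀ x, D (algebraMap K N x) = algebraMap K N (d x))
    (C : Subfield K) [IsAlgClosed C] (hC : ∀ x, x ∈ C ↔ d x = 0)
    (Z : Set N) (hfin : Z.Finite) (hZ : ∀ z ∈ Z, D z ∈ Algebra.adjoin K Z) (w : N) (hw : w ∈ Algebra.adjoin K Z) (hw0 : w ≠ 0) :
    ∃ (Q : Type u) (_ : Field Q) (_ : CharZero Q) (DQ : Derivation ℤ Q Q) (S : Subalgebra K N) (θ : S →+* Q),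
      Z ⊆ S ∧ (∀ s t : S, D s = t → DQ (θ s) = θ t) ∧ (∀ s : S, s = w → θ s ≠ 0) ∧
      ∀ c, DQ c = 0 → ∃ x ∈ C, θ (algebraMap K S x) = c := by
  classical
  let S : Subalgebra K N := Algebra.adjoin K (Z ∪ {w⁻¹})
  have hZS : Z ⊆ S := fun z hz => Algebra.subset_adjoin (Or.inl hz)
  have hle : Algebra.adjoin K Z ≤ S := Algebra.adjoin_mono Set.subset_union_left
  have hwS : w⁻¹ ∈ S := Algebra.subset_adjoin (Or.inr rfl)
  have hst : ∀ s ∈ S, D s ∈ S := by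
    refine adjoin_stable d D hi _ S ?_ Algebra.subset_adjoin
    rintro z (hz | rfl)
    · exact hle (hZ z hz)
    · rw [der_inv]
      have : D w ∈ S := hle (adjoin_stable d D hi Z _ hZ Algebra.subset_adjoin w hw)
      exact mul_mem (neg_mem (pow_mem hwS 2)) this
  haveI : Algebra.FiniteType K S := (Subalgebra.fg_iff_finiteType S).1
    (Subalgebra.fg_def.2 ⟨_, hfin.union (Set.finite_singleton _), rfl⟩)
  haveI : IsNoetherianRing S := Algebra.FiniteType.isNoetherianRing K S
  let δ : Derivation ℤ S S := mkDer (AddMonoidHom.mk' (fun x => ⟨D x, hst x x.2⟩) (fun a b => by ext; simp))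
    (fun a b => by ext; simp)
  have hδc : ∀ s : S, ((δ s : S) : N) = D s := fun s => rfl
  have hδ : ∀ x, δ (algebraMap K S x) = algebraMap K S (d x) := fun x => Subtype.ext (hi x)
  have hQ : ∀ n : ℕ, n ≠ 0 → IsUnit (n : S) := by
    intro n hn
    have := (IsUnit.mk0 (n : K) (by exact_mod_cast hn)).map (algebraMap K S)
    simpa using this
  obtain ⟨J, hJ, hJd, hJm⟩ := exists_simple hQ δ
  obtain ⟨δ', hδ'⟩ := der_quot δ J hJd
  haveI : Algebra.FiniteType K (S ⧸ J) := Algebra.FiniteType.of_surjective (Ideal.Quotient.mkₐ K J) Ideal.Quotient.mk_surjective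
  have hδ'K : ∀ x, δ' (algebraMap K (S ⧸ J) x) = algebraMap K (S ⧸ J) (d x) := by
    intro x
    have h1 := hδ' (algebraMap K S x)
    rw [hδ] at h1
    exact h1
  have hs : ∀ I : Ideal (S ⧸ J), (∀ x ∈ I, δ' x ∈ I) → I = ⊥ ∨ I = ⊤ := by
    intro I hI
    rcases hJm (I.comap (Ideal.Quotient.mk J)) (by
      intro x hx
      rw [Ideal.mem_comap] at hx ⊢
      rw [← hδ']; exact hI _ hx) (by
      intro x hx
      rw [Ideal.mem_comap, Ideal.Quotient.eq_zero_iff_mem.2 hx]; exact zero_mem _) with h | h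
    · left
      rw [eq_bot_iff]
      intro x hx
      obtain ⟨x, rfl⟩ := Ideal.Quotient.mk_surjective x
      have : x ∈ I.comap (Ideal.Quotient.mk J) := hx
      rw [h] at this
      exact (Submodule.mem_bot _).2 (Ideal.Quotient.eq_zero_iff_mem.2 this)
    · right
      rw [Ideal.eq_top_iff_one]
      have : (1 : S) ∈ I.comap (Ideal.Quotient.mk J) := by rw [h]; trivial
      simpa using this
  have main : ∀ (Q : Type u) [Field Q] [Algebra (S ⧸ J) Q] [IsFractionRing (S ⧸ J) Q],
    ∃ (Q : Type u) (_ : Field Q) (_ : CharZero Q) (DQ : Derivation ℤ Q Q) (S : Subalgebra K N) (θ : S →+* Q),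
      Z ⊆ S ∧ (∀ s t : S, D s = t → DQ (θ s) = θ t) ∧ (∀ s : S, s = w → θ s ≠ 0) ∧
      ∀ c, DQ c = 0 → ∃ x ∈ C, θ (algebraMap K S x) = c := by
    intro Q _ _ _
    let θ : S →+* Q := (algebraMap (S ⧸ J) Q).comp (Ideal.Quotient.mk J)
    have hchar : CharZero Q := by
      refine charZero_of_inj_zero (fun n hn => ?_)
      by_contra h
      have := (hQ n h).map θ
      rw [map_natCast, hn] at this
      exact not_isUnit_zero this
    obtain ⟨d2, hd2⟩ := der_ext_frac (R := S ⧸ J) (P := Q)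
      (Derivation.mk' ((algebraMap (S ⧸ J) Q).toAddMonoidHom.comp
        δ'.toLinearMap.toAddMonoidHom).toIntLinearMap (fun a b => by
        simp [Algebra.smul_def]))
    have hd2' : ∀ x, d2 (algebraMap (S ⧸ J) Q x) = algebraMap (S ⧸ J) Q (δ' x) := fun x => hd2 x
    refine ⟨Q, inferInstance, hchar, d2, S, θ, hZS, ?_, ?_, ?_⟩
    · intro s t hst
      have e : δ s = t := Subtype.ext hst
      rw [← e]
      show d2 (algebraMap (S ⧸ J) Q (Ideal.Quotient.mk J s)) = algebraMap (S ⧸ J) Q (Ideal.Quotient.mk J (δ s))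
      rw [hd2', hδ']
    · intro s hsw h0
      have : s * ⟨w⁻¹, hwS⟩ = 1 := Subtype.ext (by
        show (s : N) * w⁻¹ = 1
        rw [hsw, mul_inv_cancel₀ hw0])
      have h2 := congrArg θ this
      rw [map_mul, h0, zero_mul, map_one] at h2
      exact zero_ne_one h2
    · intro c hc
      obtain ⟨x, hx, h⟩ := const_simple d δ' hδ'K C hC hs Q d2 hd2' c hc
      exact ⟨x, hx, h⟩
  exact main (FractionRing (S ⧸ J))

theorem pv_transfer {Q : Type u} [Field Q] (D : Derivation ℤ Q Q) (k M : Subfield Q) (hM : ∀ x ∈ M, D x ∈ M)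
    (n : ℕ) (a : Fin n → Q) (h : IsPVWith D k M n a) :
    IsPV (restr D M hM) (k.comap M.subtype) ⊤ := by
  obtain ⟨h1, h2, h3, h4, h5, y, h6, h7, h8, h9⟩ := h
  have hit : ∀ (j : ℕ) (x : M), (((restr D M hM)^[j] x : M) : Q) = D^[j] x := by
    intro j
    induction j with
    | zero => intro x; rfl
    | succ j ih => intro x; rw [Function.iterate_succ_apply, ih, Function.iterate_succ_apply]; rfl
  refine ⟨n, fun i => ⟨a i, h1 (h5 i)⟩, le_top, fun x hx => h2 _ hx, fun _ _ => trivial, ?_, h5,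
    fun i => ⟨y i, h6 i⟩, fun _ => trivial, ?_, ?_, ?_⟩
  · intro x _ hx
    exact h4 x x.2 (congrArg Subtype.val hx)
  · intro i
    apply Subtype.ext
    have := h7 i
    simp only [LApply] at this ⊢
    rw [Subfield.coe_add, hit]
    push_cast
    simp only [hit]
    exact this
  · intro c hc hs i
    apply Subtype.ext
    refine h8 (fun i => c i) (fun i => ⟨(hc i).1, congrArg Subtype.val (hc i).2⟩) ?_ i
    have := congrArg Subtype.val hs
    push_cast at this
    exact this
  · rw [eq_top_iff]
    refine le_sInf ?_
    rintro G ⟨hG1, hG2, hG3⟩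
    have : M ≤ G.map M.subtype := by
      conv_lhs => rw [← h9]
      refine sInf_le ⟨?_, ?_, ?_⟩
      · intro x hx; exact ⟨⟨x, h1 hx⟩, hG1 hx, rfl⟩
      · rintro _ ⟨i, rfl⟩; exact ⟨⟨y i, h6 i⟩, hG2 ⟨i, rfl⟩, rfl⟩
      · rintro _ ⟨x, hx, rfl⟩; exact ⟨_, hG3 x hx, rfl⟩
    intro x _
    obtain ⟨z, hz, hzx⟩ := this x.2
    rwa [← Subtype.ext hzx]

theorem pair_order {L M : Type*} [Field L] [AddCommGroup M] [Module L M] (V : Submodule L M) (hV : V.FG) (f : M → M)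
    (hf : ∀ v ∈ V, f v ∈ V) (y : M) (hy : y ∈ V) :
    ∃ (m : ℕ) (c : Fin m → L), f^[m] y = ∑ i, c i • f^[i] y := by
  haveI : Module.Finite L V := Module.Finite.iff_fg.2 hV
  have hyV : ∀ i, f^[i] y ∈ V := by
    intro i
    induction i with
    | zero => exact hy
    | succ i ih => rw [Function.iterate_succ_apply']; exact hf _ ih
  let U : ℕ →o Submodule L V :=
    { toFun := fun m => (Submodule.span L (Set.range fun i : Fin m => f^[i] y)).comap V.subtype
      monotone' := by
        intro m n hmn
        apply Submodule.comap_mono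
        apply Submodule.span_mono
        rintro x ⟨i, rfl⟩
        exact ⟨⟨i, by omega⟩, rfl⟩ }
  obtain ⟨m, hm⟩ := monotone_stabilizes_iff_noetherian.2 inferInstance U
  have h1 : (⟨_, hyV m⟩ : V) ∈ U (m+1) := Submodule.subset_span ⟨⟨m, by omega⟩, rfl⟩
  rw [← hm (m+1) (by omega)] at h1
  obtain ⟨c, hc⟩ := (Submodule.mem_span_range_iff_exists_fun L).1 h1
  exact ⟨m, c, hc.symm⟩
end PVR
namespace PVR

def comp {K : Type*} [Field K] {m : ℕ} (c : Fin (m+1) → K) : Matrix (Fin (m+1)) (Fin (m+1)) K :=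
  fun r s => if (r : ℕ) = m then c s else if (s : ℕ) = r + 1 then 1 else 0

theorem comp_lt {K N : Type*} [Field K] [Field N] {m : ℕ} (c : Fin (m+1) → K) (i : K →+* N) (f : Fin (m+1) → N)
    (r : ℕ) (hr : r < m) : ∑ s, i (comp c ⟨r, by omega⟩ s) * f s = f ⟨r + 1, by omega⟩ := by
  rw [Finset.sum_eq_single ⟨r+1, by omega⟩]
  · simp [comp, hr.ne]
  · intro b _ hb
    have : (b : ℕ) ≠ r + 1 := fun h => hb (Fin.ext h)
    simp [comp, hr.ne, this]
  · simp

theorem comp_last {K N : Type*} [Field K] [Field N] {m : ℕ} (c : Fin (m+1) → K) (i : K →+* N) (f : Fin (m+1) → N) :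
    ∑ s, i (comp c ⟨m, by omega⟩ s) * f s = ∑ s, i (c s) * f s := by
  simp [comp]

/-- Solution data for a scalar equation. -/
structure Sol {K : Type u} [Field K] (d : Derivation ℤ K K) (F : Subfield K) (a : K) {N : Type u} [Field N]
    (D : Derivation ℤ N N) (i : K →+* N) (m : ℕ) (c : Fin (m+1) → K) (X : Matrix (Fin (m+1)) (Fin (m+1)) N)
    (γ δ : Fin (m+1) → N) : Prop where
  hi : DHom d D i
  hc : ∀ t, c t ∈ F
  hX : X.det ≠ 0
  hXD : ∀ r s, D (X r s) = ∑ t, i (comp c r t) * X t s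
  hγ : ∀ s, D (γ s) = 0
  hδ : ∀ s, D (δ s) = 0
  hne : ∑ s, X 0 s * δ s ≠ 0
  ha : i a * ∑ s, X 0 s * δ s = ∑ s, X 0 s * γ s

theorem sol_gen {K : Type u} [Field K] [CharZero K] (d : Derivation ℤ K K) (F : Subfield K) (hF : DSt d F) (a : K)
    (N : Type u) [Field N] [CharZero N] (D : Derivation ℤ N N) (i : K →+* N) (hi : DHom d D i)
    (hq : i a ∈ Qf D (F.map i)) :
    ∃ (N' : Type u) (_ : Field N') (_ : CharZero N') (D' : Derivation ℤ N' N') (j : K →+* N') (m : ℕ) (c : Fin (m+1) → K)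
      (X : Matrix (Fin (m+1)) (Fin (m+1)) N') (γ δ : Fin (m+1) → N'), Sol d F a D' j m c X γ δ := by
  classical
  obtain ⟨u, v, ⟨V1, hV1, hV1D, hu⟩, ⟨V2, hV2, hV2D, hv⟩, hv0, hauv⟩ := (mem_Qf_iff (dst_map hi hF)).1 hq
  obtain ⟨m, c, hm⟩ := pair_order (V1.prod V2) (hV1.prod hV2) (Prod.map D D)
    (fun x hx => ⟨hV1D _ hx.1, hV2D _ hx.2⟩) (u, v) ⟨hu, hv⟩
  have hit : ∀ j, (Prod.map D D)^[j] (u, v) = (D^[j] u, D^[j] v) := by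
    intro j
    rw [Prod.map_iterate]; rfl
  simp only [hit] at hm
  have hmu : D^[m] u = ∑ t, (c t : N) * D^[t] u := by
    have := congrArg Prod.fst hm
    rw [Prod.fst_sum] at this
    exact this
  have hmv : D^[m] v = ∑ t, (c t : N) * D^[t] v := by
    have := congrArg Prod.snd hm
    rw [Prod.snd_sum] at this
    exact this
  cases m with
  | zero => exact absurd (by simpa using hmv) hv0
  | succ m =>
    choose c' hc' hc'' using fun t => (c t).2
    obtain ⟨N', _, _, D', i2, X, h1, h2, h3⟩ := generic D ((comp c').map i)
    have hcol : ∀ w : N, D^[m+1] w = ∑ t, (c t : N) * D^[t] w →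
        ∀ r : Fin (m+1), D' (i2 (D^[r] w)) = ∑ s, (((comp c').map i).map i2) r s * i2 (D^[s] w) := by
      intro w hw r
      rw [h1, ← Function.iterate_succ_apply' (⇑D)]
      obtain ⟨r, hr⟩ := r
      rcases (Nat.lt_succ_iff.1 hr).lt_or_eq with h | rfl
      · exact (comp_lt c' (i2.comp i) (fun s => i2 (D^[s] w)) r h).symm
      · refine Eq.trans ?_ (comp_last c' (i2.comp i) (fun s => i2 (D^[s] w))).symm
        simp only [Nat.succ_eq_add_one]
        rw [hw, map_sum]
        apply Finset.sum_congr rfl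
        intro t _
        rw [map_mul, ← hc'' t]; rfl
    have hun : IsUnit X.det := isUnit_iff_ne_zero.2 h2
    have key : ∀ w : N, ∑ s, X 0 s * (X⁻¹.mulVec (fun r => i2 (D^[r] w))) s = i2 w := by
      intro w
      have : X.mulVec (X⁻¹.mulVec (fun r : Fin (m+1) => i2 (D^[r] w))) = (fun r : Fin (m+1) => i2 (D^[r] w)) := by
        rw [Matrix.mulVec_mulVec, Matrix.mul_nonsing_inv _ hun, Matrix.one_mulVec]
      exact congrFun this 0
    refine ⟨N', inferInstance, inferInstance, D', i2.comp i, m, c', X, X⁻¹.mulVec (fun r => i2 (D^[r] u)),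
      X⁻¹.mulVec (fun r => i2 (D^[r] v)), DHom.comp h1 hi, hc', h2, ?_,
      mulVec_const D' X _ _ h2 h3 (hcol u hmu), mulVec_const D' X _ _ h2 h3 (hcol v hmv), ?_, ?_⟩
    · intro r s
      exact congrFun (congrFun h3 r) s
    · rw [key]
      exact (map_ne_zero i2).2 hv0
    · rw [key, key, RingHom.comp_apply, hauv, ← map_mul, div_mul_cancel₀ _ hv0]

theorem sol_Q {K : Type u} [Field K] [CharZero K] (d : Derivation ℤ K K) (F : Subfield K) (a : K)
    (C : Subfield K) [IsAlgClosed C] (hC : ∀ x, x ∈ C ↔ d x = 0)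
    (N : Type u) [Field N] [CharZero N] (D : Derivation ℤ N N) (i : K →+* N) (m : ℕ) (c : Fin (m+1) → K)
    (X : Matrix (Fin (m+1)) (Fin (m+1)) N) (γ δ : Fin (m+1) → N) (hS : Sol d F a D i m c X γ δ) :
    ∃ (N' : Type u) (_ : Field N') (_ : CharZero N') (D' : Derivation ℤ N' N') (j : K →+* N')
      (X : Matrix (Fin (m+1)) (Fin (m+1)) N') (γ δ : Fin (m+1) → N'), Sol d F a D' j m c X γ δ ∧
      ∀ z, D' z = 0 → ∃ x ∈ C, j x = z := by
  classical
  letI : Algebra K N := i.toAlgebra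
  let Z : Set N := Set.range (fun p : Fin (m+1) × Fin (m+1) => X p.1 p.2) ∪ (Set.range γ ∪ Set.range δ)
  have hZfin : Z.Finite := (Set.finite_range _).union ((Set.finite_range _).union (Set.finite_range _))
  have hZX : ∀ r s, X r s ∈ Z := fun r s => Or.inl ⟨(r, s), rfl⟩
  have hZγ : ∀ s, γ s ∈ Z := fun s => Or.inr (Or.inl ⟨s, rfl⟩)
  have hZδ : ∀ s, δ s ∈ Z := fun s => Or.inr (Or.inr ⟨s, rfl⟩)
  have hZ : ∀ z ∈ Z, D z ∈ Algebra.adjoin K Z := by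
    rintro z (⟨p, rfl⟩ | ⟨s, rfl⟩ | ⟨s, rfl⟩)
    · rw [hS.hXD]
      exact sum_mem fun t _ => mul_mem (Subalgebra.algebraMap_mem _ _) (Algebra.subset_adjoin (hZX _ _))
    · rw [hS.hγ]; exact zero_mem _
    · rw [hS.hδ]; exact zero_mem _
  have hdet : X.det ∈ Algebra.adjoin K Z :=
    subring_det_mem (Algebra.adjoin K Z).toSubring X (fun r s => Algebra.subset_adjoin (hZX r s))
  have hv : ∑ s, X 0 s * δ s ∈ Algebra.adjoin K Z :=
    sum_mem fun s _ => mul_mem (Algebra.subset_adjoin (hZX _ _)) (Algebra.subset_adjoin (hZδ _))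
  obtain ⟨Q, _, _, DQ, S, θ, hZS, hD, hw, hcon⟩ := ringQ d D hS.hi C hC Z hZfin hZ (X.det * ∑ s, X 0 s * δ s)
    (mul_mem hdet hv) (mul_ne_zero hS.hX hS.hne)
  let XS : Matrix (Fin (m+1)) (Fin (m+1)) S := fun r s => ⟨X r s, hZS (hZX r s)⟩
  let γS : Fin (m+1) → S := fun s => ⟨γ s, hZS (hZγ s)⟩
  let δS : Fin (m+1) → S := fun s => ⟨δ s, hZS (hZδ s)⟩
  have hXS : ((XS.det : S) : N) = X.det := by
    have := RingHom.map_det S.val.toRingHom XS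
    exact this
  have hvS : ((∑ s, XS 0 s * δS s : S) : N) = ∑ s, X 0 s * δ s := by push_cast; rfl
  have hne := hw (XS.det * ∑ s, XS 0 s * δS s) (by rw [Subalgebra.coe_mul, hXS, hvS])
  rw [map_mul] at hne
  refine ⟨Q, inferInstance, inferInstance, DQ, θ.comp (algebraMap K S), XS.map θ, fun s => θ (γS s), fun s => θ (δS s),
    ⟨?_, hS.hc, ?_, ?_, ?_, ?_, ?_, ?_⟩, hcon⟩
  · intro x
    exact hD _ _ (hS.hi x)
  · have := RingHom.map_det θ XS
    rw [RingHom.mapMatrix_apply] at this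
    rw [← this]; exact left_ne_zero_of_mul hne
  · intro r s
    have := hD (XS r s) (∑ t, algebraMap K S (comp c r t) * XS t s) (by
      push_cast
      exact hS.hXD r s)
    rw [map_sum] at this
    simp only [map_mul] at this
    exact this
  · intro s
    rw [hD (γS s) 0 (hS.hγ s), map_zero]
  · intro s
    rw [hD (δS s) 0 (hS.hδ s), map_zero]
  · have := right_ne_zero_of_mul hne
    rw [map_sum] at this
    simp only [map_mul] at this
    exact this
  · have : algebraMap K S a * ∑ s, XS 0 s * δS s = ∑ s, XS 0 s * γS s := by
      apply Subtype.ext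
      push_cast
      exact hS.ha
    have h2 := congrArg θ this
    simp only [map_mul, map_sum] at h2
    exact h2
end PVR
namespace PVR

theorem diffGen_props {E : Type u} [Field E] (D : E → E) (k : Subfield E) (S : Set E) :
    k ≤ diffGen D k S ∧ S ⊆ diffGen D k S ∧ (∀ x ∈ diffGen D k S, D x ∈ diffGen D k S) ∧
    ∀ M : Subfield E, k ≤ M → S ⊆ M → (∀ x ∈ M, D x ∈ M) → diffGen D k S ≤ M := by
  refine ⟨le_sInf fun F hF => hF.1, ?_, ?_, fun M h1 h2 h3 => sInf_le ⟨h1, h2, h3⟩⟩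
  · intro x hx
    exact Subfield.mem_sInf.2 fun F hF => hF.2.1 hx
  · intro x hx
    exact Subfield.mem_sInf.2 fun F hF => hF.2.2 _ (Subfield.mem_sInf.1 hx F hF)

theorem lemmaA {K : Type u} [Field K] [CharZero K] (d : Derivation ℤ K K) (F : Subfield K) (hF : DSt d F) (a : K)
    (C : Subfield K) [IsAlgClosed C] (hC : ∀ x, x ∈ C ↔ d x = 0) (hCF : C ≤ F)
    (hgen : ∀ M : Subfield K, DSt d M → F ≤ M → a ∈ M → M = ⊤)
    (N : Type u) [Field N] [CharZero N] (D : Derivation ℤ N N) (i : K →+* N) (hi : DHom d D i)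
    (hq : i a ∈ Qf D (F.map i)) :
    ∃ (Q : DFld.{u}) (ψ : K →+* Q.carrier), (∀ x, ψ (d x) = Q.deriv (ψ x)) ∧ IsPV Q.deriv (F.map ψ) ⊤ := by
  classical
  obtain ⟨N1, _, _, D1, i1, m, c, X1, γ1, δ1, hS1⟩ := sol_gen d F hF a N D i hi hq
  obtain ⟨Q, _, _, D, j, X, γ, δ, hS, hcon⟩ := sol_Q d F a C hC N1 D1 i1 m c X1 γ1 δ1 hS1
  obtain ⟨hi, hc, hX, hXD, hγ, hδ, hne, ha⟩ := hS
  have hit : ∀ (r : ℕ) (hr : r < m + 1) (s), X ⟨r, hr⟩ s = D^[r] (X 0 s) := by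
    intro r
    induction r with
    | zero => intro hr s; rfl
    | succ r ih =>
      intro hr s
      rw [Function.iterate_succ_apply', ← ih (by omega), hXD]
      exact (comp_lt c j (fun t => X t s) r (by omega)).symm
  have htop : ∀ s, D^[m+1] (X 0 s) = ∑ t, j (c t) * X t s := by
    intro s
    rw [Function.iterate_succ_apply', ← hit m (by omega), hXD]
    exact comp_last c j (fun t => X t s)
  obtain ⟨g1, g2, g3, g4⟩ := diffGen_props D (F.map j) (Set.range (X 0))
  generalize hM : diffGen D (F.map j) (Set.range (X 0)) = M at g1 g2 g3 g4
  have hconM : ∀ z, D z = 0 → z ∈ F.map j := by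
    intro z hz
    obtain ⟨x, hx, rfl⟩ := hcon z hz
    exact ⟨x, hCF hx, rfl⟩
  have hXM : ∀ s, X 0 s ∈ M := fun s => g2 ⟨s, rfl⟩
  have hja : j a ∈ M := by
    rw [eq_div_of_mul_eq hne ha]
    exact div_mem (sum_mem fun s _ => mul_mem (hXM s) (g1 (hconM _ (hγ s))))
      (sum_mem fun s _ => mul_mem (hXM s) (g1 (hconM _ (hδ s))))
  have hall : ∀ x, j x ∈ M := by
    have := hgen (M.comap j) (fun x hx => by
      change j (d x) ∈ M
      rw [← hi x]; exact g3 _ hx) (fun x hx => g1 ⟨x, hx, rfl⟩) hja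
    intro x
    have hx : x ∈ M.comap j := this ▸ Subfield.mem_top x
    exact hx
  let ψ : K →+* M := j.codRestrict M hall
  have hmap : (F.map j).comap M.subtype = F.map ψ := by
    ext ⟨x, hx⟩
    constructor
    · rintro ⟨y, hy, h⟩
      exact ⟨y, hy, Subtype.ext h⟩
    · rintro ⟨y, hy, h⟩
      exact ⟨y, hy, congrArg Subtype.val h⟩
  have hpv : IsPVWith D (F.map j) M (m+1) (fun t => - j (c t)) := by
    refine ⟨g1, dst_map hi hF, g3, fun x _ h => hconM x h, fun t => neg_mem ⟨c t, hc t, rfl⟩, X 0, hXM, ?_, ?_, hM⟩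
    · intro s
      rw [LApply, htop, ← Finset.sum_add_distrib]
      refine Finset.sum_eq_zero fun t _ => ?_
      rw [← hit t t.2]; ring
    · intro e he h0
      have hr : ∀ (r : ℕ) (hr : r < m + 1), ∑ s, X ⟨r, hr⟩ s * e s = 0 := by
        intro r
        induction r with
        | zero => intro hr; rw [← h0]; exact Finset.sum_congr rfl fun s _ => mul_comm _ _
        | succ r ih =>
          intro hr
          have := congrArg D (ih (by omega))
          rw [map_zero, map_sum] at this
          rw [← this]
          refine Finset.sum_congr rfl fun s _ => ?_
          rw [D.leibniz, (he s).2, smul_zero, zero_add, smul_eq_mul, mul_comm, hit (r+1) hr, Function.iterate_succ_apply', ← hit r (by omega)]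
      have := Matrix.eq_zero_of_mulVec_eq_zero hX (v := e) (funext fun r => hr r r.2)
      intro s
      exact congrFun this s
  have hfin := pv_transfer D (F.map j) M g3 _ _ hpv
  rw [hmap] at hfin
  exact ⟨⟨M, restr D M g3, map_add _, fun a b => by rw [Derivation.leibniz]; simp only [smul_eq_mul]; ring⟩, ψ, fun x => Subtype.ext (hi x).symm, hfin⟩
end PVR
namespace PVR

theorem rel_pv {E : Type u} [Field E] [CharZero E] (D : Derivation ℤ E E) (k M : Subfield E) (hk : DSt D k) (hM : DSt D M)
    (h : IsPVRel D k M hM) :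
    (∀ x ∈ M, D x = 0 → x ∈ k) ∧ M ≤ Qf D k ∧ ∃ s : Set E, s.Finite ∧ M ≤ Subfield.closure (k ∪ s) := by
  obtain ⟨n, a, -, -, -, hcon, ha, y, -, hy, -, hgen⟩ := h
  have hit : ∀ (j : ℕ) (x : M), (((fun x : M => (⟨D x, hM x x.2⟩ : M))^[j] x : M) : E) = D^[j] x := by
    intro j
    induction j with
    | zero => intro x; rfl
    | succ j ih => intro x; rw [Function.iterate_succ_apply, ih, Function.iterate_succ_apply]
  let w : Fin n × Fin n → E := fun p => D^[p.1] (y p.2)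
  have hw : ∀ p, D (w p) ∈ Submodule.span k (Set.range w) := by
    rintro ⟨j, i⟩
    change D (D^[j] (y i)) ∈ _
    rw [← Function.iterate_succ_apply' D]
    by_cases hj : (j : ℕ) + 1 < n
    · exact Submodule.subset_span ⟨(⟨j+1, hj⟩, i), rfl⟩
    · have hjn : (j : ℕ) + 1 = n := by omega
      rw [Nat.succ_eq_add_one, hjn]
      have := congrArg Subtype.val (hy i)
      rw [LApply] at this
      push_cast at this
      simp only [hit] at this
      rw [eq_neg_of_add_eq_zero_left this]
      refine Submodule.neg_mem _ (Submodule.sum_mem _ fun t _ => ?_)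
      exact Submodule.smul_mem _ (⟨a t, ha t⟩ : k) (Submodule.subset_span ⟨(t, i), rfl⟩)
  have hspan : ∀ x ∈ Submodule.span k (Set.range w), x ∈ Subfield.closure (k ∪ Set.range w) := by
    intro x hx
    induction hx using Submodule.span_induction with
    | mem x hx => exact Subfield.subset_closure (Or.inr hx)
    | zero => exact zero_mem _
    | add x y _ _ h1 h2 => exact add_mem h1 h2
    | smul c x _ h => exact mul_mem (Subfield.subset_closure (Or.inl c.2)) h
  have hG : DSt D (Subfield.closure (k ∪ Set.range w)) := by
    refine dst_closure D _ ?_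
    rintro x (hx | ⟨p, rfl⟩)
    · exact Subfield.subset_closure (Or.inl (hk x hx))
    · exact hspan _ (hw p)
  have hMG : M ≤ Subfield.closure (k ∪ Set.range w) := by
    have hkG : ∀ x ∈ k, x ∈ Subfield.closure (k ∪ Set.range w) := fun x hx => Subfield.subset_closure (Or.inl hx)
    have hyG : ∀ i, (y i : E) ∈ Subfield.closure (k ∪ Set.range w) := fun i =>
      Subfield.subset_closure (Or.inr ⟨((⟨0, i.pos⟩ : Fin n), i), rfl⟩)
    generalize Subfield.closure (k ∪ Set.range w) = G at hG hkG hyG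
    intro x hx
    have := (diffGen_props (fun x : M => (⟨D x, hM x x.2⟩ : M)) (k.comap M.subtype) (Set.range y)).2.2.2
      (G.comap M.subtype) (fun x hx => hkG _ hx) (by rintro _ ⟨i, rfl⟩; exact hyG i) (fun x hx => hG _ hx)
    rw [hgen] at this
    exact this (Subfield.mem_top ⟨x, hx⟩)
  refine ⟨fun x hx h0 => hcon ⟨x, hx⟩ (Subfield.mem_top _) (Subtype.ext h0), hMG.trans ?_, _, Set.finite_range w, hMG⟩
  rw [Subfield.closure_le]
  rintro x (hx | hx)
  · exact le_Qf hk hx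
  · refine lin_le_Qf (isLin_of_span D k hk _ (Set.finite_range w) ?_ x (Submodule.subset_span hx))
    rintro _ ⟨p, rfl⟩
    exact hw p

theorem acc {E : Type u} [Field E] (k : Subfield E) (s : Set E) (hs : s.Finite) (hks : Subfield.closure (k ∪ s) = ⊤)
    (P : Subfield E → Prop) (hP : ∀ F, k ≤ F → (∀ G, F < G → P G) → P F) : ∀ F, k ≤ F → P F := by
  classical
  have hfg : (⊤ : IntermediateField k E).FG := by
    refine ⟨hs.toFinset, ?_⟩
    rw [← IntermediateField.toSubfield_injective.eq_iff, IntermediateField.adjoin_toSubfield,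
      IntermediateField.top_toSubfield, ← hks]
    congr 2
    · ext x; exact ⟨fun ⟨y, hy⟩ => hy ▸ y.2, fun h => ⟨⟨x, h⟩, rfl⟩⟩
    · simp
  haveI : Algebra.EssFiniteType k E := IntermediateField.fg_top_iff.1 hfg
  haveI : IsNoetherianRing (TensorProduct k E E) := Algebra.EssFiniteType.isNoetherianRing E _
  let I : Subfield E → Ideal (TensorProduct k E E) := fun F =>
    Ideal.span ((fun x : E => x ⊗ₜ[k] (1:E) - (1:E) ⊗ₜ[k] x) '' F)
  have hI : ∀ F G, k ≤ F → F < G → I F < I G := by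
    intro F G hkF hFG
    refine lt_of_le_not_ge (Ideal.span_mono (Set.image_mono hFG.le)) fun hle => ?_
    obtain ⟨x, hxG, hxF⟩ := SetLike.exists_of_lt hFG
    let F' : IntermediateField k E := { F with algebraMap_mem' := fun r => hkF r.2 }
    let q : TensorProduct k E E →+* TensorProduct F' E E :=
      (Algebra.TensorProduct.lift (Algebra.TensorProduct.includeLeft (R := F') (S := k) (A := E) (B := E))
        ((Algebra.TensorProduct.includeRight (R := F') (A := E) (B := E)).restrictScalars k) (fun _ _ => Commute.all _ _)).toRingHom
    have hq1 : ∀ y : E, q (y ⊗ₜ 1) = y ⊗ₜ 1 := fun y => by simp [q]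
    have hq2 : ∀ y : E, q (1 ⊗ₜ y) = 1 ⊗ₜ y := fun y => by simp [q]
    have hker : I F ≤ RingHom.ker q := by
      refine Ideal.span_le.2 ?_
      rintro _ ⟨y, hy, rfl⟩
      change q _ = 0
      rw [map_sub, hq1, hq2, sub_eq_zero]
      have := TensorProduct.smul_tmul (R := F') (⟨y, hy⟩ : F') (1:E) (1:E)
      simpa [Algebra.smul_def] using this
    have hx0 : q (x ⊗ₜ 1 - 1 ⊗ₜ x) = 0 := hker (hle (Ideal.subset_span ⟨x, hxG, rfl⟩))
    rw [map_sub, hq1, hq2] at hx0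
    have hxn : x ∉ Submodule.span F' {(1:E)} := by
      intro h
      obtain ⟨c, hc⟩ := Submodule.mem_span_singleton.1 h
      apply hxF
      rw [← hc, Algebra.smul_def, mul_one]
      exact c.2
    obtain ⟨f, hf, hp⟩ := Submodule.exists_le_ker_of_notMem hxn
    have hf1 : f 1 = 0 := hp (Submodule.mem_span_singleton_self _)
    have := congrArg (TensorProduct.lift ((LinearMap.lsmul F' E).comp f)) hx0
    rw [map_sub, TensorProduct.lift.tmul, TensorProduct.lift.tmul, map_zero] at this
    simp [hf1, hf, Algebra.smul_def] at this
  have key : ∀ J : Ideal (TensorProduct k E E), ∀ F, k ≤ F → I F = J → P F := by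
    intro J
    induction J using WellFoundedGT.induction with
    | ind J ih =>
      rintro F hF rfl
      exact hP F hF fun G hG => ih (I G) (hI F G hF hG) G (hF.trans hG.le) rfl
  exact fun F hF => key _ F hF rfl

theorem tower_facts {E : Type u} [Field E] [CharZero E] (D : Derivation ℤ E E) :
    ∀ (n : ℕ) (T : Fin (n + 1) → Subfield E) (hTd : ∀ i, DSt D (T i))
    (hPV : ∀ i : Fin n, IsPVRel D (T i.castSucc) (T i.succ) (hTd i.succ)),
    (∀ x ∈ T (Fin.last n), D x = 0 → x ∈ T 0) ∧
      ∃ s : Set E, s.Finite ∧ T (Fin.last n) ≤ Subfield.closure (T 0 ∪ s) := by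
  intro n
  induction n with
  | zero => 
    intro T _ _
    exact ⟨fun x hx _ => hx, ∅, Set.finite_empty, fun x hx => Subfield.subset_closure (Or.inl hx)⟩
  | succ n ih =>
    intro T hTd hPV
    obtain ⟨h1, s, hs, h2⟩ := ih (fun i => T i.castSucc) (fun i => hTd _) (fun i => hPV i.castSucc)
    obtain ⟨g1, -, t, ht, g2⟩ := rel_pv D _ _ (hTd (Fin.last n).castSucc) (hTd (Fin.last n).succ) (hPV (Fin.last n))
    refine ⟨fun x hx h0 => h1 x (g1 x hx h0) h0, s ∪ t, hs.union ht, ?_⟩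
    refine g2.trans ?_
    rw [Subfield.closure_le]
    rintro x (hx | hx)
    · exact Subfield.closure_mono (Set.union_subset_union_right _ Set.subset_union_left) (h2 hx)
    · exact Subfield.subset_closure (Or.inr (Or.inr hx))
end PVR
namespace PVR

def Step {E : Type u} [Field E] (D : Derivation ℤ E E) (A B : Subfield E) : Prop :=
  ∃ (F : DFld.{u}) (ψ : ↥B →+* F.carrier),
    (∀ (x : E) (hx : x ∈ B) (hx' : D x ∈ B), ψ ⟨D x, hx'⟩ = F.deriv (ψ ⟨x, hx⟩)) ∧
    IsPV F.deriv (Subfield.map ψ (Subfield.comap B.subtype A)) ⊤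

theorem one_step {E : Type u} [Field E] [CharZero E] (D : Derivation ℤ E E) (k F : Subfield E) (hC : IsAlgClosed (constantsOf D k))
    (hkF : k ≤ F) (hcon : ∀ x, D x = 0 → x ∈ k) (hF : DSt D F) (a : E)
    (N : Type u) [Field N] [CharZero N] (D' : Derivation ℤ N N) (i : E →+* N) (hi : DHom D D' i)
    (ha : i a ∈ Qf D' (F.map i)) : Step D F (diffGen D F {a}) := by
  obtain ⟨g1, g2, g3, g4⟩ := diffGen_props D F {a}
  generalize diffGen D F {a} = G at g1 g2 g3 g4
  have haG : a ∈ G := g2 rfl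
  have hcG : ∀ x ∈ constantsOf D k, x ∈ G := fun x hx => g1 (hkF hx.1)
  let e : (constantsOf D k) ≃+* ((constantsOf D k).comap G.subtype) :=
    { toFun := fun x => ⟨⟨x, hcG x x.2⟩, x.2⟩
      invFun := fun x => ⟨x.1.1, x.2⟩
      left_inv := fun x => rfl
      right_inv := fun x => rfl
      map_mul' := fun x y => rfl
      map_add' := fun x y => rfl }
  haveI : IsAlgClosed ((constantsOf D k).comap G.subtype) := IsAlgClosed.of_ringEquiv _ _ e
  obtain ⟨Q, ψ, h1, h2⟩ := lemmaA (restr D G g3) (F.comap G.subtype) (fun x hx => hF _ hx) ⟨a, haG⟩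
    ((constantsOf D k).comap G.subtype)
    (fun x => ⟨fun h => Subtype.ext h.2, fun h => ⟨hcon _ (congrArg Subtype.val h), congrArg Subtype.val h⟩⟩)
    (fun x hx => hkF hx.1)
    (fun M hM hFM haM => by
      have := g4 (M.map G.subtype) (fun x hx => ⟨⟨x, g1 hx⟩, hFM hx, rfl⟩)
        (by rintro _ rfl; exact ⟨_, haM, rfl⟩)
        (by rintro _ ⟨x, hx, rfl⟩; exact ⟨_, hM x hx, rfl⟩)
      refine top_le_iff.1 fun x _ => ?_
      obtain ⟨y, hy, hyx⟩ := this x.2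
      rwa [← (Subtype.ext hyx : y = x)])
    N D' (i.comp G.subtype) (fun x => hi x)
    (by
      rw [← Subfield.map_map, map_comap_sub g1]
      exact ha)
  exact ⟨Q, ψ, fun x hx hx' => h1 ⟨x, hx⟩, h2⟩

theorem main {E : Type u} [Field E] [CharZero E] (D : Derivation ℤ E E)
    (k K : Subfield E) (hk : ∀ x ∈ k, D x ∈ k) (hK : ∀ x ∈ K, D x ∈ K)
    (hC : IsAlgClosed ↥(constantsOf D k)) (hkK : k < K)
    (n : ℕ) (T : Fin (n + 1) → Subfield E)
    (hT0 : T 0 = k) (hTn : T (Fin.last n) = ⊤)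
    (hTdiff : ∀ i, ∀ x ∈ T i, D x ∈ T i)
    (hPVtower : ∀ i : Fin n, IsPVRel (⇑D) (T i.castSucc) (T i.succ) (hTdiff i.succ)) :
    ∃ (m : ℕ) (S : Fin (m + 1) → Subfield E), S 0 = k ∧ S (Fin.last m) = K ∧
      (∀ i : Fin m, S i.castSucc < S i.succ) ∧ (∀ i, ∀ x ∈ S i, D x ∈ S i) ∧
      ∀ i : Fin m, Step D (S i.castSucc) (S i.succ) := by
  obtain ⟨hcon, s, hs, hks⟩ := tower_facts D n T hTdiff hPVtower
  rw [hTn, hT0] at hks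
  rw [hTn, hT0] at hcon
  refine acc k s hs (top_le_iff.1 hks) (fun F => DSt D F → F ≤ K → ∃ (m : ℕ) (S : Fin (m + 1) → Subfield E), S 0 = F ∧ S (Fin.last m) = K ∧
      (∀ i : Fin m, S i.castSucc < S i.succ) ∧ (∀ i, ∀ x ∈ S i, D x ∈ S i) ∧
      ∀ i : Fin m, Step D (S i.castSucc) (S i.succ)) ?_ k le_rfl hk hkK.le
  intro F hkF ih hF hFK
  rcases hFK.eq_or_lt with rfl | hlt
  · exact ⟨0, fun _ => F, rfl, rfl, fun i => i.elim0, fun _ => hF, fun i => i.elim0⟩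
  obtain ⟨N', _, _, D', i, hi, a, haK, haF, haq⟩ := tower' n K F hF hK hlt T (hT0.le.trans hkF) hTn hTdiff
    (fun i => (rel_pv D _ _ (hTdiff _) (hTdiff _) (hPVtower i)).2.1)
  have hst := one_step D k F hC hkF (fun x hx => hcon x (Subfield.mem_top x) hx) hF a N' D' i hi haq
  obtain ⟨g1, g2, g3, g4⟩ := diffGen_props D F {a}
  have hFG : F < diffGen D F {a} := lt_of_le_of_ne g1 fun h => haF (h ▸ g2 rfl)
  obtain ⟨m, S, h0, h1, h2, h3, h4⟩ := ih _ hFG g3 (g4 K hFK (by rintro _ rfl; exact haK) hK)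
  refine ⟨m + 1, Fin.cons F S, rfl, h1, ?_, ?_, ?_⟩
  · intro i
    refine Fin.cases ?_ (fun i => ?_) i
    · exact lt_of_lt_of_eq hFG h0.symm
    · exact h2 i
  · intro i
    refine Fin.cases ?_ (fun i => ?_) i
    · exact hF
    · exact h3 i
  · intro i
    refine Fin.cases ?_ (fun i => ?_) i
    · change Step D F (S 0)
      rw [h0]; exact hst
    · exact h4 i
end PVR

/-- Every intermediate differential field `k ⊂ K ⊆ E` of an iterated
Picard–Vessiot extension `E` of `k` can be resolved into a tower
`k = K₀ ⊂ K₁ ⊂ ⋯ ⊂ K_m = K` in which each `Kᵢ` embeds differentially over `Kᵢ₋₁` into a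
Picard–Vessiot extension of `Kᵢ₋₁`. -/
theorem stmt3 {E : Type u} [Field E] [CharZero E] (D : Derivation ℤ E E)
    (k K : Subfield E)
    (hk : ∀ x ∈ k, D x ∈ k) (hK : ∀ x ∈ K, D x ∈ K)
    (hC : IsAlgClosed ↥(constantsOf D k))
    (hkK : k < K)
    (n : ℕ) (T : Fin (n + 1) → Subfield E)
    (hT0 : T 0 = k) (hTn : T (Fin.last n) = ⊤)
    (hTmono : ∀ i : Fin n, T i.castSucc ≤ T i.succ)
    (hTdiff : ∀ i, ∀ x ∈ T i, D x ∈ T i)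
    (hPVtower : ∀ i : Fin n, IsPVRel (⇑D) (T i.castSucc) (T i.succ) (hTdiff i.succ)) :
    ∃ (m : ℕ) (S : Fin (m + 1) → Subfield E),
      S 0 = k ∧ S (Fin.last m) = K ∧
      (∀ i : Fin m, S i.castSucc < S i.succ) ∧
      (∀ i, ∀ x ∈ S i, D x ∈ S i) ∧
      ∀ i : Fin m,
        ∃ (F : DFld.{u}) (ψ : ↥(S i.succ) →+* F.carrier),
          (∀ (x : E) (hx : x ∈ S i.succ) (hx' : D x ∈ S i.succ),
            ψ ⟨D x, hx'⟩ = F.deriv (ψ ⟨x, hx⟩)) ∧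
          IsPV F.deriv
            (Subfield.map ψ (Subfield.comap (S i.succ).subtype (S i.castSucc))) ⊤ := by
  exact PVR.main D k K hk hK hC hkK n T hT0 hTn hTdiff hPVtower
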